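/- For every bounded continuous function φ : ℝ → ℝ, the limit as X → ∞ of (1/N_X) · Σ_{d positive odd fundamental discriminant, 1 < d < X} φ( f̃(d) / 3^{ω(d)} ) equals φ(1/192), where N_X is the number of positive odd fundamental discriminants d with 1 < d < X; that is, the empirical distributions of the values f̃(d)/3^{ω(d)} over positive odd fundamental discriminants converge weakly to the point mass at 1/192. -/

import Mathlib

open Finset Filter Asymptotics

open scoped Classical

noncomputable section

/-- `D` is a fundamental discriminant: either `D ≡ 1 (mod 4)` and `D` is squarefree,
or `D = 4m` with `m` squarefree and `m ≡ 2, 3 (mod 4)`. -/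
def IsFundDisc (D : ℤ) : Prop :=
  (D % 4 = 1 ∧ Squarefree D) ∨
    ∃ m : ℤ, D = 4 * m ∧ Squarefree m ∧ (m % 4 = 2 ∨ m % 4 = 3)

/-- `ω(d)`, the number of distinct primes dividing `|d|`. -/
def omegaZ (d : ℤ) : ℕ := d.natAbs.primeFactors.card

/-- The Legendre symbol `(m/p)` for odd primes `p`, and the Kronecker symbol at `p = 2`
(`0` if `m` is even, `1` if `m ≡ ±1 (mod 8)`, `-1` if `m ≡ ±3 (mod 8)`). -/
def kron (m : ℤ) (p : ℕ) : ℤ :=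
  if p = 2 then
    if m % 2 = 0 then 0 else if m % 8 = 1 ∨ m % 8 = 7 then 1 else -1
  else jacobiSym m p

/-- `α(d) = 1` if `d > 0` and `α(d) = 0` if `d < 0`. -/
def alphaFD (d : ℤ) : ℕ := if 0 < d then 1 else 0

/-- Ordered triples `(d₁, d₂, d₃)` of pairwise coprime fundamental discriminants,
each `≠ 1`, with `d₁ * d₂ * d₃ = d`. -/
def fdTriples (d : ℤ) : Finset (ℤ × ℤ × ℤ) :=
  (Finset.Icc (-(d.natAbs : ℤ)) (d.natAbs : ℤ) ×ˢ
      Finset.Icc (-(d.natAbs : ℤ)) (d.natAbs : ℤ) ×ˢ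
      Finset.Icc (-(d.natAbs : ℤ)) (d.natAbs : ℤ)).filter
    fun t =>
      IsFundDisc t.1 ∧ IsFundDisc t.2.1 ∧ IsFundDisc t.2.2 ∧
      t.1 ≠ 1 ∧ t.2.1 ≠ 1 ∧ t.2.2 ≠ 1 ∧
      IsCoprime t.1 t.2.1 ∧ IsCoprime t.1 t.2.2 ∧ IsCoprime t.2.1 t.2.2 ∧
      t.1 * t.2.1 * t.2.2 = d

/-- The summand attached to a factorization `d = d₁ d₂ d₃`:
`∏_{p ∣ d₃} (1 + (d₁d₂/p)) · ∏_{p ∣ d₂} (1 + (d₁d₃/p)) · ∏_{p ∣ d₁} (1 + (d₂d₃/p))`. -/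
def tripleTerm (t : ℤ × ℤ × ℤ) : ℤ :=
  (∏ p ∈ t.2.2.natAbs.primeFactors, (1 + kron (t.1 * t.2.1) p)) *
    (∏ p ∈ t.2.1.natAbs.primeFactors, (1 + kron (t.1 * t.2.2) p)) *
    (∏ p ∈ t.1.natAbs.primeFactors, (1 + kron (t.2.1 * t.2.2) p))

/-- `f̃(d) = 2^{-3-α(d)} Σ_{{d₁,d₂,d₃}} (…)`, the sum over *unordered* triples of
pairwise coprime fundamental discriminants `≠ 1` with product `d`.  Since the summand is
symmetric and the entries of any such triple are pairwise distinct, the unordered sum is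
one sixth of the ordered sum. -/
def ftilde (d : ℤ) : ℝ :=
  (1 / 2 ^ (3 + alphaFD d) : ℝ) * ((1 : ℝ) / 6) * ∑ t ∈ fdTriples d, (tripleTerm t : ℝ)

/-- `D⁻(X, n, m)`: fundamental discriminants `d` with `0 < -d < X` and `d ≡ n (mod m)`. -/
def Dminus (X : ℝ) (n m : ℤ) : Finset ℤ :=
  (Finset.Icc (-⌈X⌉) ⌈X⌉).filter fun d =>
    IsFundDisc d ∧ d < 0 ∧ -X < (d : ℝ) ∧ d % m = n % m

/-- `D⁺(X, n, m)`: fundamental discriminants `d` with `0 < d < X` and `d ≡ n (mod m)`. -/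
def Dplus (X : ℝ) (n m : ℤ) : Finset ℤ :=
  (Finset.Icc (-⌈X⌉) ⌈X⌉).filter fun d =>
    IsFundDisc d ∧ 0 < d ∧ (d : ℝ) < X ∧ d % m = n % m

/-- Positive odd fundamental discriminants `d` with `1 < d < X`:
squarefree integers `d > 1` with `d ≡ 1 (mod 4)`. -/
def DposOdd (X : ℝ) : Finset ℤ :=
  (Finset.Icc 0 ⌈X⌉).filter fun d =>
    1 < d ∧ Squarefree d ∧ d % 4 = 1 ∧ (d : ℝ) < X

/-- A completely multiplicative periodic function taking the value `-1` at a unit has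
vanishing sum over a period. -/
theorem sum_range_period_eq_zero {f : ℕ → ℝ} {q a : ℕ} (hq : 0 < q)
    (hper : Function.Periodic f q) (hmul : ∀ m n, f (m * n) = f m * f n)
    (ha : f a = -1) (hcop : a.Coprime q) : ∑ n ∈ range q, f n = 0 := by
  have h1 : ∑ n ∈ range q, f n = ∑ n ∈ range q, f ((a * n) % q) := by
    symm
    apply Finset.sum_nbij (fun n => (a * n) % q)
    · intro n _
      simpa using Nat.mod_lt _ hq
    · intro x hx y hy hxy
      simp only [coe_range, Set.mem_Iio] at hx hy
      have : a * x ≡ a * y [MOD q] := hxy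
      have := Nat.ModEq.cancel_left_of_coprime (by simpa [Nat.coprime_comm] using hcop) this
      exact Nat.ModEq.eq_of_lt_of_lt this hx hy
    · apply Finset.surjOn_of_injOn_of_card_le
      · intro n _
        simpa using Nat.mod_lt _ hq
      · intro x hx y hy hxy
        simp only [coe_range, Set.mem_Iio] at hx hy
        have : a * x ≡ a * y [MOD q] := hxy
        have := Nat.ModEq.cancel_left_of_coprime (by simpa [Nat.coprime_comm] using hcop) this
        exact Nat.ModEq.eq_of_lt_of_lt this hx hy
      · exact le_rfl
    · intro n _
      rfl
  have h2 : ∑ n ∈ range q, f ((a * n) % q) = - ∑ n ∈ range q, f n := by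
    rw [← Finset.sum_neg_distrib]
    apply Finset.sum_congr rfl
    intro n _
    rw [hper.map_mod_nat, hmul, ha]; ring
  linarith

theorem abs_sum_range_le_of_periodic {f : ℕ → ℝ} {q : ℕ} (hq : 0 < q)
    (hper : Function.Periodic f q) (h0 : ∑ n ∈ range q, f n = 0) (hb : ∀ n, |f n| ≤ 1) (N : ℕ) :
    |∑ n ∈ range N, f n| ≤ q := by
  have hk : ∀ k, ∑ n ∈ range (q * k), f n = 0 := by
    intro k
    induction k with
    | zero => simp
    | succ k ih =>
      rw [Nat.mul_succ, Finset.sum_range_add, ih, zero_add, ← h0]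
      apply Finset.sum_congr rfl
      intro n _
      have := hper.nat_mul k n
      rw [add_comm, mul_comm]
      exact_mod_cast this
  rw [← Nat.div_add_mod N q, Finset.sum_range_add, hk, zero_add]
  calc _ ≤ ∑ n ∈ range (N % q), |f (q * (N / q) + n)| := Finset.abs_sum_le_sum_abs _ _
    _ ≤ ∑ n ∈ range (N % q), 1 := Finset.sum_le_sum fun _ _ => hb _
    _ = (N % q : ℕ) := by simp
    _ ≤ q := by exact_mod_cast (Nat.mod_lt _ hq).le

theorem abs_sum_mul_le_of_antitone {f w : ℕ → ℝ} {B : ℝ} (hw : Antitone w) (hw0 : ∀ n, 0 ≤ w n)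
    (hB : ∀ n, |∑ i ∈ range n, f i| ≤ B) (n : ℕ) :
    |∑ i ∈ range n, f i * w i| ≤ B * w 0 := by
  have key : ∀ n, ∑ i ∈ range n, f i * w i = (∑ i ∈ range n, f i) * w n
      + ∑ i ∈ range n, (∑ j ∈ range (i + 1), f j) * (w i - w (i + 1)) := by
    intro n
    induction n with
    | zero => simp
    | succ n ih =>
      rw [Finset.sum_range_succ, ih, Finset.sum_range_succ (fun i => _ * (w i - w (i + 1))) n,
        Finset.sum_range_succ f n]
      ring
  have hB0 : 0 ≤ B := (abs_nonneg _).trans (hB 0)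
  rw [key n]
  calc _ ≤ |(∑ i ∈ range n, f i) * w n|
        + |∑ i ∈ range n, (∑ j ∈ range (i + 1), f j) * (w i - w (i + 1))| := abs_add_le _ _
    _ ≤ B * w n + ∑ i ∈ range n, B * (w i - w (i + 1)) := by
        gcongr
        · rw [abs_mul, abs_of_nonneg (hw0 n)]
          exact mul_le_mul_of_nonneg_right (hB n) (hw0 n)
        · refine (Finset.abs_sum_le_sum_abs _ _).trans (Finset.sum_le_sum fun i _ => ?_)
          have : 0 ≤ w i - w (i + 1) := sub_nonneg.2 (hw (Nat.le_succ i))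
          rw [abs_mul, abs_of_nonneg this]
          exact mul_le_mul_of_nonneg_right (hB _) this
    _ = B * w 0 := by
        rw [← Finset.mul_sum, Finset.sum_range_sub']; ring

theorem jacobiSym_natCast_periodic (N : ℕ) :
    Function.Periodic (fun m : ℕ => (jacobiSym m N : ℝ)) N := by
  intro m
  simp only [Int.cast_inj]
  rw [jacobiSym.mod_left, jacobiSym.mod_left (m : ℤ)]
  push_cast
  rw [Int.add_emod_right]

theorem abs_jacobiSym_le_one (a : ℤ) (N : ℕ) : |(jacobiSym a N : ℝ)| ≤ 1 := by
  rcases jacobiSym.trichotomy a N with h | h | h <;> simp [h]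

theorem exists_jacobiSym_eq_neg_one {q M : ℕ} (hq : q.Prime) (hq2 : q ≠ 2) (hM : Odd M)
    (hqM : ¬ q ∣ M) : ∃ a : ℕ, jacobiSym a (q * M) = -1 ∧ a % 4 = 1 ∧ a.Coprime (4 * (q * M)) := by
  have := Fact.mk hq
  obtain ⟨b, hb⟩ := quadraticChar_exists_neg_one (F := ZMod q) (by rwa [ZMod.ringChar_zmod_n])
  have hcop : q.Coprime (4 * M) := by
    rw [Nat.Prime.coprime_iff_not_dvd hq, hq.dvd_mul]
    rintro (h | h)
    · have : q ∣ 2 := hq.dvd_of_dvd_pow (show q ∣ 2 ^ 2 by simpa using h)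
      exact hq2 ((Nat.prime_dvd_prime_iff_eq hq Nat.prime_two).1 this)
    · exact hqM h
  obtain ⟨a, ha1, ha2⟩ := Nat.chineseRemainder hcop b.val 1
  have haq : jacobiSym a q = -1 := by
    rw [← jacobiSym.legendreSym.to_jacobiSym, legendreSym]
    have : ((a : ℤ) : ZMod q) = b := by
      have := (ZMod.natCast_eq_natCast_iff a b.val q).2 ha1
      simpa using this
    rw [this]; exact hb
  have haM : jacobiSym a M = 1 := by
    have h1 : (a : ℤ) % M = 1 % M := by
      have : a ≡ 1 [MOD M] := ha2.of_mul_left 4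
      exact_mod_cast this
    rw [jacobiSym.mod_left, h1, ← jacobiSym.mod_left, jacobiSym.one_left]
  have hJ : jacobiSym a (q * M) = -1 := by
    have : NeZero q := ⟨hq.ne_zero⟩
    have : NeZero M := ⟨by rintro rfl; simp at hM⟩
    rw [jacobiSym.mul_right, haq, haM]; norm_num
  have h4 : a % 4 = 1 := ha2.of_mul_right M
  refine ⟨a, hJ, h4, ?_⟩
  have h1 : a.Coprime 4 := by
    rw [Nat.coprime_comm, Nat.coprime_iff_gcd_eq_one, Nat.gcd_rec, h4]; rfl
  have h2 : a.Coprime (q * M) := by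
    have : NeZero (q * M) := ⟨by rintro h; simp [h] at hJ⟩
    by_contra hc
    have := (jacobiSym.eq_zero_iff_not_coprime (a := a) (b := q * M)).2
      (by rwa [Int.gcd_natCast_natCast])
    rw [hJ] at this
    norm_num at this
  exact Nat.Coprime.mul_right h1 h2

theorem sum_Icc_divisorsAntidiagonal {M : Type*} [AddCommMonoid M] (F : ℕ → ℕ → M) (y : ℕ) :
    ∑ n ∈ Icc 1 y, ∑ x ∈ n.divisorsAntidiagonal, F x.1 x.2 =
      ∑ a ∈ Icc 1 y, ∑ b ∈ Icc 1 (y / a), F a b := by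
  rw [Finset.sum_sigma', Finset.sum_sigma']
  refine Finset.sum_bij' (fun x _ => ⟨x.2.1, x.2.2⟩) (fun x _ => ⟨x.1 * x.2, (x.1, x.2)⟩) ?_ ?_ ?_ ?_ ?_
  · rintro ⟨n, a, b⟩ h
    simp only [mem_sigma, mem_Icc, Nat.mem_divisorsAntidiagonal] at h ⊢
    obtain ⟨⟨h1, h2⟩, rfl, h3⟩ := h
    have ha : 0 < a := Nat.pos_of_ne_zero (by rintro rfl; simp at h3)
    have hb : 0 < b := Nat.pos_of_ne_zero (by rintro rfl; simp at h3)
    refine ⟨⟨ha, ?_⟩, hb, ?_⟩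
    · exact (Nat.le_mul_of_pos_right a hb).trans h2
    · rw [Nat.le_div_iff_mul_le ha, mul_comm]; exact h2
  · rintro ⟨a, b⟩ h
    simp only [mem_sigma, mem_Icc, Nat.mem_divisorsAntidiagonal] at h ⊢
    obtain ⟨⟨h1, h2⟩, h3, h4⟩ := h
    rw [Nat.le_div_iff_mul_le (by omega), mul_comm] at h4
    have : 0 < a * b := Nat.mul_pos h1 h3
    exact ⟨⟨this, h4⟩, trivial, this.ne'⟩
  · rintro ⟨n, a, b⟩ h
    simp only [mem_sigma, mem_Icc, Nat.mem_divisorsAntidiagonal] at h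
    obtain ⟨_, rfl, _⟩ := h
    rfl
  · rintro ⟨a, b⟩ h
    rfl
  · rintro ⟨n, a, b⟩ h
    rfl

theorem sum_Icc_one_div_le (y : ℕ) : ∑ n ∈ Icc 1 y, (1 / n : ℝ) ≤ 1 + Real.log y := by
  have := harmonic_le_one_add_log y
  rw [harmonic_eq_sum_Icc] at this
  push_cast at this
  simpa using this

theorem one_le_one_add_log (y : ℕ) : (1 : ℝ) ≤ 1 + Real.log y := by
  have := Real.log_natCast_nonneg y
  linarith

theorem one_add_log_mono {a b : ℕ} (h : a ≤ b) : 1 + Real.log a ≤ 1 + Real.log b := by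
  rcases Nat.eq_zero_or_pos a with rfl | ha
  · simpa using Real.log_natCast_nonneg b
  · have : Real.log a ≤ Real.log b := Real.log_le_log (by exact_mod_cast ha) (by exact_mod_cast h)
    linarith

theorem card_divisors_eq_sum (n : ℕ) :
    (n.divisors.card : ℝ) = ∑ _x ∈ n.divisorsAntidiagonal, (1 : ℝ) := by
  rw [Finset.sum_const, nsmul_eq_mul, mul_one, ← Nat.map_div_right_divisors, Finset.card_map]

theorem card_divisors_mul_le (a b : ℕ) :
    (a * b).divisors.card ≤ a.divisors.card * b.divisors.card := by
  rw [Nat.divisors_mul]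
  exact Finset.card_mul_le

theorem sum_card_divisors_le (y : ℕ) :
    ∑ n ∈ Icc 1 y, (n.divisors.card : ℝ) ≤ y * (1 + Real.log y) := by
  simp_rw [card_divisors_eq_sum]
  rw [sum_Icc_divisorsAntidiagonal (fun _ _ => (1 : ℝ))]
  calc _ ≤ ∑ a ∈ Icc 1 y, (y : ℝ) * (1 / a) := by
        apply Finset.sum_le_sum
        intro a _
        simp only [sum_const, Nat.card_Icc, add_tsub_cancel_right, nsmul_eq_mul, mul_one]
        rw [mul_one_div]
        exact Nat.cast_div_le
    _ ≤ _ := by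
        rw [← Finset.mul_sum]
        exact mul_le_mul_of_nonneg_left (sum_Icc_one_div_le y) (by positivity)

theorem sum_card_divisors_div_le (y : ℕ) :
    ∑ n ∈ Icc 1 y, (n.divisors.card : ℝ) * (1 / n) ≤ (1 + Real.log y) ^ 2 := by
  have h1 : ∀ n ∈ Icc 1 y, (n.divisors.card : ℝ) * (1 / n) =
      ∑ x ∈ n.divisorsAntidiagonal, ((1 : ℝ) / x.1 * (1 / x.2)) := by
    intro n _
    rw [card_divisors_eq_sum, Finset.sum_mul]
    apply Finset.sum_congr rfl
    intro x hx
    rw [Nat.mem_divisorsAntidiagonal] at hx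
    rw [← hx.1]
    push_cast
    rw [one_mul, one_div_mul_one_div]
  rw [Finset.sum_congr rfl h1, sum_Icc_divisorsAntidiagonal (fun a b => (1 : ℝ) / a * (1 / b))]
  calc _ ≤ ∑ a ∈ Icc 1 y, (1 / a : ℝ) * (1 + Real.log y) := by
        apply Finset.sum_le_sum
        intro a _
        rw [← Finset.mul_sum]
        apply mul_le_mul_of_nonneg_left _ (by positivity)
        exact (sum_Icc_one_div_le _).trans (one_add_log_mono (Nat.div_le_self _ _))
    _ ≤ _ := by
        rw [← Finset.sum_mul, sq]
        exact mul_le_mul_of_nonneg_right (sum_Icc_one_div_le y) (by linarith [one_le_one_add_log y])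

theorem sum_card_divisors_sq_le (y : ℕ) :
    ∑ n ∈ Icc 1 y, (n.divisors.card : ℝ) ^ 2 ≤ y * (1 + Real.log y) ^ 3 := by
  have hL := one_le_one_add_log y
  have h1 : ∀ n ∈ Icc 1 y, (n.divisors.card : ℝ) ^ 2 ≤
      ∑ x ∈ n.divisorsAntidiagonal, (x.1.divisors.card : ℝ) * x.2.divisors.card := by
    intro n _
    rw [sq]
    nth_rw 2 [card_divisors_eq_sum]
    rw [Finset.mul_sum]
    apply Finset.sum_le_sum
    intro x hx
    rw [Nat.mem_divisorsAntidiagonal] at hx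
    rw [← hx.1, mul_one]
    exact_mod_cast card_divisors_mul_le _ _
  refine (Finset.sum_le_sum h1).trans ?_
  rw [sum_Icc_divisorsAntidiagonal (fun a b => (a.divisors.card : ℝ) * b.divisors.card)]
  calc _ ≤ ∑ a ∈ Icc 1 y, ((a.divisors.card : ℝ) * (1 / a)) * (y * (1 + Real.log y)) := by
        apply Finset.sum_le_sum
        intro a _
        rw [← Finset.mul_sum, mul_assoc]
        apply mul_le_mul_of_nonneg_left _ (by positivity)
        refine (sum_card_divisors_le _).trans ?_
        rw [← mul_assoc, one_div_mul_eq_div]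
        apply mul_le_mul Nat.cast_div_le (one_add_log_mono (Nat.div_le_self _ _))
        · linarith [one_le_one_add_log (y / a)]
        · positivity
    _ ≤ (1 + Real.log y) ^ 2 * (y * (1 + Real.log y)) := by
        rw [← Finset.sum_mul]
        exact mul_le_mul_of_nonneg_right (sum_card_divisors_div_le y) (by positivity)
    _ = _ := by ring

/-- The number of factorizations `w = m₁ m₂ m₃` with all `mᵢ ≤ M`. -/
def tripleCount (M w : ℕ) : ℕ :=
  ((Icc 1 M ×ˢ Icc 1 M ×ˢ Icc 1 M).filter fun m => m.1 * m.2.1 * m.2.2 = w).card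

theorem tripleCount_le (M w : ℕ) : tripleCount M w ≤ w.divisors.card ^ 2 := by
  rw [sq, ← Finset.card_product]
  apply Finset.card_le_card_of_injOn (fun m => (m.1, m.2.1))
  · rintro ⟨a, b, c⟩ h
    simp only [coe_filter, mem_product, mem_Icc, Set.mem_ofPred_eq] at h
    obtain ⟨⟨h1, h2, h3⟩, rfl⟩ := h
    have : a * b * c ≠ 0 := by
      have : 0 < a * b * c := Nat.mul_pos (Nat.mul_pos h1.1 h2.1) h3.1
      exact this.ne'
    simp only [coe_product, Set.mem_prod, mem_coe, Nat.mem_divisors]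
    exact ⟨⟨⟨b * c, by ring⟩, this⟩, ⟨⟨a * c, by ring⟩, this⟩⟩
  · rintro ⟨a, b, c⟩ h ⟨a', b', c'⟩ h' heq
    simp only [coe_filter, mem_product, mem_Icc, Set.mem_ofPred_eq] at h h'
    simp only [Prod.mk.injEq] at heq
    obtain ⟨rfl, rfl⟩ := heq
    have : 0 < a * b := Nat.mul_pos h.1.1.1 h.1.2.1.1
    have := Nat.eq_of_mul_eq_mul_left this (h.2.trans h'.2.symm)
    rw [this]

theorem sum_triple_eq (M : ℕ) (F : ℕ → ℝ) :
    ∑ m ∈ Icc 1 M ×ˢ Icc 1 M ×ˢ Icc 1 M, F (m.1 * m.2.1 * m.2.2) =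
      ∑ w ∈ range (M ^ 3 + 1), tripleCount M w * F w := by
  have hmem : ∀ m ∈ Icc 1 M ×ˢ Icc 1 M ×ˢ Icc 1 M, m.1 * m.2.1 * m.2.2 ∈ range (M ^ 3 + 1) := by
    rintro ⟨a, b, c⟩ h
    simp only [mem_product, mem_Icc] at h
    simp only [mem_range, Nat.lt_succ_iff]
    calc a * b * c ≤ M * M * M := by
          apply Nat.mul_le_mul (Nat.mul_le_mul h.1.2 h.2.1.2) h.2.2.2
      _ = M ^ 3 := by ring
  rw [← Finset.sum_fiberwise_of_maps_to hmem]
  apply Finset.sum_congr rfl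
  intro w _
  rw [tripleCount, ← nsmul_eq_mul, ← Finset.sum_const]
  apply Finset.sum_congr rfl
  intro m hm
  rw [(Finset.mem_filter.1 hm).2]

theorem sum_tripleCount_sq_le (M : ℕ) :
    ∑ w ∈ range (M ^ 3 + 1), (tripleCount M w : ℝ) ^ 2 ≤ (M * (1 + Real.log M) ^ 3) ^ 3 := by
  have h1 : ∑ w ∈ range (M ^ 3 + 1), (tripleCount M w : ℝ) ^ 2 ≤
      ∑ w ∈ range (M ^ 3 + 1), tripleCount M w * (w.divisors.card : ℝ) ^ 2 := by
    apply Finset.sum_le_sum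
    intro w _
    rw [sq]
    exact mul_le_mul_of_nonneg_left (by exact_mod_cast tripleCount_le M w) (by positivity)
  refine h1.trans ?_
  rw [← sum_triple_eq M (fun w => (w.divisors.card : ℝ) ^ 2)]
  calc _ ≤ ∑ m ∈ Icc 1 M ×ˢ Icc 1 M ×ˢ Icc 1 M,
        ((m.1.divisors.card : ℝ) ^ 2 * ((m.2.1.divisors.card : ℝ) ^ 2 * (m.2.2.divisors.card : ℝ) ^ 2)) := by
        apply Finset.sum_le_sum
        intro m _
        rw [← mul_pow, ← mul_pow, ← mul_assoc]
        apply pow_le_pow_left₀ (by positivity)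
        exact_mod_cast (card_divisors_mul_le _ _).trans
          (Nat.mul_le_mul_right _ (card_divisors_mul_le _ _))
    _ = (∑ m ∈ Icc 1 M, (m.divisors.card : ℝ) ^ 2) ^ 3 := by
        rw [Finset.sum_product]
        simp_rw [← Finset.mul_sum, Finset.sum_product, ← Finset.mul_sum, ← Finset.sum_mul]
        ring
    _ ≤ _ := pow_le_pow_left₀ (by positivity) (sum_card_divisors_sq_le M) 3

theorem sum_sq_mul_le_sum_sum {ι κ : Type*} (s : Finset ι) (t : Finset κ) (c : ι → ℝ) (F : ι → κ → ℝ)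
    (hc : ∀ i ∈ s, |c i| ≤ 1) :
    ∑ w ∈ t, (∑ n ∈ s, c n * F n w) ^ 2 ≤ ∑ n ∈ s, ∑ n' ∈ s, |∑ w ∈ t, F n w * F n' w| := by
  calc _ = ∑ n ∈ s, ∑ n' ∈ s, c n * c n' * ∑ w ∈ t, F n w * F n' w := by
        simp_rw [sq, Finset.sum_mul_sum, Finset.mul_sum]
        rw [Finset.sum_comm]
        refine Finset.sum_congr rfl fun n _ => ?_
        rw [Finset.sum_comm]
        refine Finset.sum_congr rfl fun n' _ => Finset.sum_congr rfl fun w _ => ?_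
        ring
    _ ≤ _ := by
        refine Finset.sum_le_sum fun n hn => Finset.sum_le_sum fun n' hn' => ?_
        refine (le_abs_self _).trans ?_
        rw [abs_mul, abs_mul]
        have := mul_le_one₀ (hc n hn) (abs_nonneg _) (hc n' hn')
        exact mul_le_of_le_one_left (abs_nonneg _) this

theorem abs_sum_range_jacobiSym_mul_le {n n' : ℕ} (hn : Odd n) (hn' : Odd n') (hs : Squarefree n)
    (hs' : Squarefree n') (hne : n ≠ n') (K : ℕ) :
    |∑ w ∈ range K, (jacobiSym w n : ℝ) * jacobiSym w n'| ≤ n * n' := by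
  wlog h : ∃ q, q.Prime ∧ q ∣ n ∧ ¬ q ∣ n' generalizing n n'
  · have := this hn' hn hs' hs hne.symm (by
      by_contra hc
      push Not at h hc
      apply hne
      rw [← Nat.prod_primeFactors_of_squarefree hs, ← Nat.prod_primeFactors_of_squarefree hs']
      congr 1
      ext p
      simp only [Nat.mem_primeFactors]
      exact ⟨fun hp => ⟨hp.1, h p hp.1 hp.2.1, hs'.ne_zero⟩,
        fun hp => ⟨hp.1, hc p hp.1 hp.2.1, hs.ne_zero⟩⟩)
    simp_rw [mul_comm (jacobiSym _ n : ℝ), mul_comm (n : ℝ)]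
    exact this
  obtain ⟨q, hq, ⟨M, rfl⟩, hqn'⟩ := h
  have hq2 : q ≠ 2 := by
    rintro rfl
    exact (Nat.not_odd_iff_even.2 (even_two_mul M)) hn
  have hqM : ¬ q ∣ M := by
    rintro ⟨k, rfl⟩
    have := hs q ⟨k, by ring⟩
    exact hq.one_lt.ne' (Nat.isUnit_iff.1 this)
  have hMo : Odd M := (Nat.odd_mul.1 hn).2
  obtain ⟨a, ha, _, hcop⟩ := exists_jacobiSym_eq_neg_one (M := M * n') hq hq2 (hMo.mul hn')
    (by rw [hq.dvd_mul]; tauto)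
  have : NeZero (q * M) := ⟨hs.ne_zero⟩
  have : NeZero M := ⟨by rintro rfl; simp at hMo⟩
  have : NeZero n' := ⟨hs'.ne_zero⟩
  have key : ∀ w : ℕ, (jacobiSym w (q * M) : ℝ) * jacobiSym w n' = (jacobiSym w (q * M * n') : ℝ) := by
    intro w
    rw [jacobiSym.mul_right _ (q * M) n']; push_cast; rfl
  simp_rw [key]
  have hpos : 0 < q * M * n' := Nat.mul_pos (Nat.pos_of_ne_zero hs.ne_zero) (Nat.pos_of_ne_zero hs'.ne_zero)
  rw [← Nat.cast_mul]
  apply abs_sum_range_le_of_periodic hpos (jacobiSym_natCast_periodic _) _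
    (fun w => abs_jacobiSym_le_one _ _)
  apply sum_range_period_eq_zero hpos (jacobiSym_natCast_periodic _) (a := a)
  · intro m n
    simp only [Nat.cast_mul, jacobiSym.mul_left, Int.cast_mul]
  · simp only [mul_assoc, ha]; norm_num
  · rw [mul_assoc]; exact hcop.coprime_mul_left_right

theorem sum_sq_jacobiSym_le {N M : ℕ} (hN : 1 ≤ N) (hNM : N ≤ M) {s : Finset ℕ}
    (hs : ∀ n ∈ s, N ≤ n ∧ n < 2 * N ∧ Odd n ∧ Squarefree n) (c : ℕ → ℝ) (hc : ∀ n ∈ s, |c n| ≤ 1) :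
    ∑ w ∈ range (M ^ 3 + 1), (∑ n ∈ s, c n * (jacobiSym w n : ℝ)) ^ 2 ≤ 6 * M ^ 3 * N := by
  have hcard : (s.card : ℝ) ≤ N := by
    have : s ⊆ Ico N (2 * N) := fun n hn => by
      obtain ⟨h1, h2, _⟩ := hs n hn
      simp [h1, h2]
    have := Finset.card_le_card this
    simp only [Nat.card_Ico] at this
    exact_mod_cast (show s.card ≤ N by omega)
  refine (sum_sq_mul_le_sum_sum s _ c (fun n (w : ℕ) => (jacobiSym w n : ℝ)) hc).trans ?_
  have hNr : (1 : ℝ) ≤ N := by exact_mod_cast hN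
  have hMr : (N : ℝ) ≤ M := by exact_mod_cast hNM
  have h1 : ∀ n ∈ s, ∑ n' ∈ s, |∑ w ∈ range (M ^ 3 + 1), (jacobiSym w n : ℝ) * jacobiSym w n'| ≤
      6 * M ^ 3 := by
    intro n hn
    obtain ⟨hn1, hn2, hn3, hn4⟩ := hs n hn
    rw [← Finset.add_sum_erase _ _ hn]
    have hd : |∑ w ∈ range (M ^ 3 + 1), (jacobiSym w n : ℝ) * jacobiSym w n| ≤ M ^ 3 + 1 := by
      refine (Finset.abs_sum_le_sum_abs _ _).trans ?_
      calc _ ≤ ∑ w ∈ range (M ^ 3 + 1), (1 : ℝ) := by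
            refine Finset.sum_le_sum fun w _ => ?_
            rw [abs_mul]
            exact mul_le_one₀ (abs_jacobiSym_le_one _ _) (abs_nonneg _) (abs_jacobiSym_le_one _ _)
        _ = _ := by simp
    have ho : ∑ n' ∈ s.erase n, |∑ w ∈ range (M ^ 3 + 1), (jacobiSym w n : ℝ) * jacobiSym w n'| ≤
        N * (2 * N * (2 * N)) := by
      calc _ ≤ ∑ n' ∈ s.erase n, (2 * N * (2 * N) : ℝ) := by
            refine Finset.sum_le_sum fun n' hn' => ?_
            obtain ⟨hne, hn'⟩ := Finset.mem_erase.1 hn'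
            obtain ⟨hn1', hn2', hn3', hn4'⟩ := hs n' hn'
            refine (abs_sum_range_jacobiSym_mul_le hn3 hn3' hn4 hn4' hne.symm _).trans ?_
            have e1 : (n : ℝ) ≤ 2 * N := by exact_mod_cast hn2.le
            have e2 : (n' : ℝ) ≤ 2 * N := by exact_mod_cast hn2'.le
            exact mul_le_mul e1 e2 (by positivity) (by positivity)
        _ ≤ _ := by
            rw [Finset.sum_const, nsmul_eq_mul]
            have : ((s.erase n).card : ℝ) ≤ N :=
              le_trans (by exact_mod_cast Finset.card_le_card (Finset.erase_subset _ _)) hcard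
            gcongr
    have e3 : (N : ℝ) ^ 3 ≤ M ^ 3 := by gcongr
    have e4 : (1 : ℝ) ≤ M ^ 3 := one_le_pow₀ (hNr.trans hMr)
    linarith [show (N : ℝ) * (2 * N * (2 * N)) = 4 * N ^ 3 by ring]
  calc _ ≤ ∑ n ∈ s, (6 * M ^ 3 : ℝ) := Finset.sum_le_sum h1
    _ ≤ _ := by
      rw [Finset.sum_const, nsmul_eq_mul, mul_comm]
      gcongr

/-- The character sum over `n ∈ s` with `t * n ≤ Y`, twisted by `(w / n)`. -/
def cutoffSum (s : Finset ℕ) (Y t w : ℕ) : ℝ :=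
  |∑ n ∈ s with t * n ≤ Y, (jacobiSym (t * w : ℕ) n : ℝ)|

theorem sum_cutoffSum_sq_le {N M : ℕ} (hN : 1 ≤ N) (hNM : N ≤ M) {s : Finset ℕ}
    (hs : ∀ n ∈ s, N ≤ n ∧ n < 2 * N ∧ Odd n ∧ Squarefree n) (Y t : ℕ) :
    ∑ w ∈ range (M ^ 3 + 1), cutoffSum s Y t w ^ 2 ≤ 6 * M ^ 3 * N := by
  have := sum_sq_jacobiSym_le hN hNM (s := s.filter fun n => t * n ≤ Y)
    (fun n hn => hs n (Finset.mem_filter.1 hn).1) (fun n => (jacobiSym t n : ℝ))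
    (fun n _ => abs_jacobiSym_le_one _ _)
  refine le_of_eq_of_le (Finset.sum_congr rfl fun w _ => ?_) this
  rw [cutoffSum, sq_abs]
  congr 1
  refine Finset.sum_congr rfl fun n _ => ?_
  rw [Nat.cast_mul, jacobiSym.mul_left, Int.cast_mul]

theorem sum_sum_tripleCount_cutoffSum_le {N M : ℕ} (hN : 1 ≤ N) (hNM : N ≤ M) {s : Finset ℕ}
    (hs : ∀ n ∈ s, N ≤ n ∧ n < 2 * N ∧ Odd n ∧ Squarefree n) (Y : ℕ) :
    ∑ t ∈ Icc 1 M, ∑ w ∈ range (M ^ 3 + 1), tripleCount M w * cutoffSum s Y t w ≤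
      M ^ 4 * (1 + Real.log M) ^ 5 * √(6 * N) := by
  have hL := one_le_one_add_log M
  have h1 : ∀ t ∈ Icc 1 M, ∑ w ∈ range (M ^ 3 + 1), tripleCount M w * cutoffSum s Y t w ≤
      M ^ 3 * (1 + Real.log M) ^ 5 * √(6 * N) := by
    intro t _
    refine (Real.sum_mul_le_sqrt_mul_sqrt _ _ _).trans ?_
    have e1 := Real.sqrt_le_sqrt (sum_tripleCount_sq_le M)
    have e2 := Real.sqrt_le_sqrt (sum_cutoffSum_sq_le hN hNM hs Y t)
    refine (mul_le_mul e1 e2 (Real.sqrt_nonneg _) (Real.sqrt_nonneg _)).trans ?_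
    rw [← Real.sqrt_mul (by positivity)]
    apply Real.sqrt_le_iff.2 ⟨by positivity, ?_⟩
    rw [mul_pow, mul_pow, Real.sq_sqrt (by positivity)]
    have : (1 + Real.log M) ^ 9 ≤ ((1 + Real.log M) ^ 5) ^ 2 := by
      rw [← pow_mul]; exact pow_le_pow_right₀ hL (by norm_num)
    calc _ = (M : ℝ) ^ 6 * (1 + Real.log M) ^ 9 * (6 * N) := by ring
      _ ≤ (M : ℝ) ^ 6 * ((1 + Real.log M) ^ 5) ^ 2 * (6 * N) := by gcongr
      _ = _ := by ring
  calc _ ≤ ∑ t ∈ Icc 1 M, (M ^ 3 * (1 + Real.log M) ^ 5 * √(6 * N) : ℝ) := Finset.sum_le_sum h1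
    _ = _ := by
      rw [Finset.sum_const, nsmul_eq_mul, Nat.card_Icc, Nat.add_sub_cancel]; ring

theorem cutoffSum_nonneg (s : Finset ℕ) (Y t w : ℕ) : 0 ≤ cutoffSum s Y t w := abs_nonneg _

theorem abs_quadruple_sum_le (s : Finset ℕ) (Y a b c d : ℕ) :
    |∑ n ∈ s with a * n ≤ Y ∧ b * n ≤ Y ∧ c * n ≤ Y ∧ d * n ≤ Y, (jacobiSym (a * b * c * d : ℕ) n : ℝ)| ≤
      cutoffSum s Y a (b * c * d) + cutoffSum s Y b (a * c * d) + cutoffSum s Y c (a * b * d) +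
        cutoffSum s Y d (a * b * c) := by
  have key : ∀ t w, t * w = a * b * c * d → a ≤ t → b ≤ t → c ≤ t → d ≤ t →
      (t = a ∨ t = b ∨ t = c ∨ t = d) →
      |∑ n ∈ s with a * n ≤ Y ∧ b * n ≤ Y ∧ c * n ≤ Y ∧ d * n ≤ Y,
        (jacobiSym (a * b * c * d : ℕ) n : ℝ)| = cutoffSum s Y t w := by
    intro t w h ha hb hc hd ht
    rw [cutoffSum, h]
    congr 2
    apply Finset.filter_congr
    intro n _
    constructor
    · rintro ⟨h1, h2, h3, h4⟩
      rcases ht with rfl | rfl | rfl | rfl <;> assumption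
    · intro h
      exact ⟨(Nat.mul_le_mul_right n ha).trans h, (Nat.mul_le_mul_right n hb).trans h,
        (Nat.mul_le_mul_right n hc).trans h, (Nat.mul_le_mul_right n hd).trans h⟩
  have p1 := cutoffSum_nonneg s Y a (b * c * d)
  have p2 := cutoffSum_nonneg s Y b (a * c * d)
  have p3 := cutoffSum_nonneg s Y c (a * b * d)
  have p4 := cutoffSum_nonneg s Y d (a * b * c)
  by_cases h1 : b ≤ a ∧ c ≤ a ∧ d ≤ a
  · rw [key a (b * c * d) (by ring) le_rfl h1.1 h1.2.1 h1.2.2 (by tauto)]; linarith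
  by_cases h2 : a ≤ b ∧ c ≤ b ∧ d ≤ b
  · rw [key b (a * c * d) (by ring) h2.1 le_rfl h2.2.1 h2.2.2 (by tauto)]; linarith
  by_cases h3 : a ≤ c ∧ b ≤ c ∧ d ≤ c
  · rw [key c (a * b * d) (by ring) h3.1 h3.2.1 le_rfl h3.2.2 (by tauto)]; linarith
  · rw [key d (a * b * c) (by ring) (by omega) (by omega) (by omega) le_rfl (by tauto)]; linarith

theorem sum_quadruple_le {N M : ℕ} (hN : 1 ≤ N) (hNM : N ≤ M) {s : Finset ℕ}
    (hs : ∀ n ∈ s, N ≤ n ∧ n < 2 * N ∧ Odd n ∧ Squarefree n) (Y : ℕ) :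
    ∑ a ∈ Icc 1 M, ∑ b ∈ Icc 1 M, ∑ c ∈ Icc 1 M, ∑ d ∈ Icc 1 M,
      |∑ n ∈ s with a * n ≤ Y ∧ b * n ≤ Y ∧ c * n ≤ Y ∧ d * n ≤ Y,
        (jacobiSym (a * b * c * d : ℕ) n : ℝ)| ≤ 4 * (M ^ 4 * (1 + Real.log M) ^ 5 * √(6 * N)) := by
  have hT := sum_sum_tripleCount_cutoffSum_le hN hNM hs Y
  have hT' : ∑ t ∈ Icc 1 M, ∑ a ∈ Icc 1 M, ∑ b ∈ Icc 1 M, ∑ c ∈ Icc 1 M,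
      cutoffSum s Y t (a * b * c) ≤ M ^ 4 * (1 + Real.log M) ^ 5 * √(6 * N) := by
    refine le_of_eq_of_le (Finset.sum_congr rfl fun t _ => ?_) hT
    rw [← sum_triple_eq M (fun w => cutoffSum s Y t w), Finset.sum_product]
    refine Finset.sum_congr rfl fun a _ => ?_
    rw [Finset.sum_product]
  refine (Finset.sum_le_sum fun a _ => Finset.sum_le_sum fun b _ => Finset.sum_le_sum fun c _ =>
    Finset.sum_le_sum fun d _ => abs_quadruple_sum_le s Y a b c d).trans ?_
  simp only [Finset.sum_add_distrib]
  have e2 : ∑ a ∈ Icc 1 M, ∑ b ∈ Icc 1 M, ∑ c ∈ Icc 1 M, ∑ d ∈ Icc 1 M,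
      cutoffSum s Y b (a * c * d) = ∑ t ∈ Icc 1 M, ∑ a ∈ Icc 1 M, ∑ b ∈ Icc 1 M, ∑ c ∈ Icc 1 M,
      cutoffSum s Y t (a * b * c) := Finset.sum_comm
  have e3 : ∑ a ∈ Icc 1 M, ∑ b ∈ Icc 1 M, ∑ c ∈ Icc 1 M, ∑ d ∈ Icc 1 M,
      cutoffSum s Y c (a * b * d) = ∑ t ∈ Icc 1 M, ∑ a ∈ Icc 1 M, ∑ b ∈ Icc 1 M, ∑ c ∈ Icc 1 M,
      cutoffSum s Y t (a * b * c) := by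
    rw [Finset.sum_comm (s := Icc 1 M) (t := Icc 1 M)
      (f := fun t a => ∑ b ∈ Icc 1 M, ∑ c ∈ Icc 1 M, cutoffSum s Y t (a * b * c))]
    exact Finset.sum_congr rfl fun a _ => Finset.sum_comm
  have e4 : ∑ a ∈ Icc 1 M, ∑ b ∈ Icc 1 M, ∑ c ∈ Icc 1 M, ∑ d ∈ Icc 1 M,
      cutoffSum s Y d (a * b * c) = ∑ t ∈ Icc 1 M, ∑ a ∈ Icc 1 M, ∑ b ∈ Icc 1 M, ∑ c ∈ Icc 1 M,
      cutoffSum s Y t (a * b * c) := by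
    rw [Finset.sum_comm (s := Icc 1 M) (t := Icc 1 M)
      (f := fun t a => ∑ b ∈ Icc 1 M, ∑ c ∈ Icc 1 M, cutoffSum s Y t (a * b * c))]
    refine Finset.sum_congr rfl fun a _ => ?_
    rw [Finset.sum_comm (s := Icc 1 M) (t := Icc 1 M)
      (f := fun t b => ∑ c ∈ Icc 1 M, cutoffSum s Y t (a * b * c))]
    exact Finset.sum_congr rfl fun b _ => Finset.sum_comm
  rw [e2, e3, e4]
  linarith

theorem sum_pow_four_le {N M : ℕ} (hN : 1 ≤ N) (hNM : N ≤ M) {s : Finset ℕ}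
    (hs : ∀ n ∈ s, N ≤ n ∧ n < 2 * N ∧ Odd n ∧ Squarefree n) (Y : ℕ) (a : ℕ → ℝ)
    (ha : ∀ m, |a m| ≤ 1) :
    ∑ n ∈ s, (∑ m ∈ Icc 1 M with m * n ≤ Y, a m * (jacobiSym m n : ℝ)) ^ 4 ≤
      4 * (M ^ 4 * (1 + Real.log M) ^ 5 * √(6 * N)) := by
  refine le_trans ?_ (sum_quadruple_le hN hNM hs Y)
  set g : ℕ → ℕ → ℝ := fun m n => if m * n ≤ Y then a m * (jacobiSym m n : ℝ) else 0 with hg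
  have h1 : ∀ n ∈ s, (∑ m ∈ Icc 1 M with m * n ≤ Y, a m * (jacobiSym m n : ℝ)) ^ 4 =
      ∑ i ∈ Icc 1 M, ∑ j ∈ Icc 1 M, ∑ k ∈ Icc 1 M, ∑ l ∈ Icc 1 M, g i n * (g j n * (g k n * g l n)) := by
    intro n _
    rw [Finset.sum_filter]
    simp_rw [← Finset.mul_sum, ← Finset.sum_mul]
    ring
  rw [Finset.sum_congr rfl h1, Finset.sum_comm]
  refine Finset.sum_le_sum fun i _ => ?_
  rw [Finset.sum_comm]
  refine Finset.sum_le_sum fun j _ => ?_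
  rw [Finset.sum_comm]
  refine Finset.sum_le_sum fun k _ => ?_
  rw [Finset.sum_comm]
  refine Finset.sum_le_sum fun l _ => ?_
  have : ∑ n ∈ s, g i n * (g j n * (g k n * g l n)) = (a i * a j * a k * a l) *
      ∑ n ∈ s with i * n ≤ Y ∧ j * n ≤ Y ∧ k * n ≤ Y ∧ l * n ≤ Y,
        (jacobiSym (i * j * k * l : ℕ) n : ℝ) := by
    rw [Finset.sum_filter, Finset.mul_sum]
    refine Finset.sum_congr rfl fun n _ => ?_
    simp only [hg, Nat.cast_mul, jacobiSym.mul_left, Int.cast_mul]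
    by_cases h1 : i * n ≤ Y <;> by_cases h2 : j * n ≤ Y <;> by_cases h3 : k * n ≤ Y <;>
      by_cases h4 : l * n ≤ Y <;> simp [h1, h2, h3, h4]
    ring
  rw [this]
  refine (le_abs_self _).trans ?_
  rw [abs_mul]
  apply mul_le_of_le_one_left (abs_nonneg _)
  rw [abs_mul, abs_mul, abs_mul]
  exact mul_le_one₀ (mul_le_one₀ (mul_le_one₀ (ha _) (abs_nonneg _) (ha _)) (abs_nonneg _) (ha _))
    (abs_nonneg _) (ha _)

theorem abs_bilinear_block_le {N Y : ℕ} (hN : 1 ≤ N) (hNY : N * N ≤ Y) {s : Finset ℕ}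
    (hs : ∀ n ∈ s, N ≤ n ∧ n < 2 * N ∧ Odd n ∧ Squarefree n) (a b : ℕ → ℝ)
    (ha : ∀ m, |a m| ≤ 1) (hb : ∀ m, |b m| ≤ 1) :
    |∑ n ∈ s, ∑ m ∈ Icc 1 (Y / n), a m * b n * (jacobiSym m n : ℝ)| ≤
      2 * Y * (1 + Real.log Y) ^ 2 * (N : ℝ) ^ (-(1 / 8) : ℝ) := by
  set M := Y / N with hM
  have hNM : N ≤ M := (Nat.le_div_iff_mul_le (by omega)).2 hNY
  have hL := one_le_one_add_log Y
  have hNr : (1 : ℝ) ≤ N := by exact_mod_cast hN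
  have hMN : (M : ℝ) * N ≤ Y := by exact_mod_cast Nat.div_mul_le_self Y N
  have hcard : (s.card : ℝ) ≤ N := by
    have : s ⊆ Ico N (2 * N) := fun n hn => by
      obtain ⟨h1, h2, _⟩ := hs n hn
      simp [h1, h2]
    have := Finset.card_le_card this
    simp only [Nat.card_Ico] at this
    exact_mod_cast (show s.card ≤ N by omega)
  set S : ℕ → ℝ := fun n => ∑ m ∈ Icc 1 M with m * n ≤ Y, a m * (jacobiSym m n : ℝ) with hS
  have h1 : |∑ n ∈ s, ∑ m ∈ Icc 1 (Y / n), a m * b n * (jacobiSym m n : ℝ)| ≤ ∑ n ∈ s, |S n| := by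
    refine (Finset.abs_sum_le_sum_abs _ _).trans (Finset.sum_le_sum fun n hn => ?_)
    obtain ⟨hn1, hn2, _⟩ := hs n hn
    have : ∑ m ∈ Icc 1 (Y / n), a m * b n * (jacobiSym m n : ℝ) = b n * S n := by
      rw [hS, Finset.mul_sum]
      have : Icc 1 (Y / n) = (Icc 1 M).filter (fun m => m * n ≤ Y) := by
        ext m
        have hn0 : 0 < n := by omega
        have : Y / n ≤ M := Nat.div_le_div_left hn1 (by omega)
        simp only [Finset.mem_Icc, Finset.mem_filter, Nat.le_div_iff_mul_le hn0]
        constructor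
        · rintro ⟨h1, h2⟩
          exact ⟨⟨h1, ((Nat.le_div_iff_mul_le hn0).2 h2).trans this⟩, h2⟩
        · rintro ⟨⟨h1, _⟩, h2⟩
          exact ⟨h1, h2⟩
      rw [this]
      exact Finset.sum_congr rfl fun m _ => by ring
    rw [this, abs_mul]
    exact mul_le_of_le_one_left (abs_nonneg _) (hb n)
  have h2 : (∑ n ∈ s, |S n|) ^ 4 ≤ N ^ 3 * (4 * (M ^ 4 * (1 + Real.log M) ^ 5 * √(6 * N))) := by
    have h3 : (∑ n ∈ s, |S n|) ^ 4 ≤ s.card ^ 3 * ∑ n ∈ s, |S n| ^ 4 :=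
      pow_sum_le_card_mul_sum_pow (fun i _ => abs_nonneg _) 3
    refine h3.trans ?_
    have h4 : ∑ n ∈ s, |S n| ^ 4 = ∑ n ∈ s, S n ^ 4 :=
      Finset.sum_congr rfl fun n _ => by rw [Even.pow_abs (by decide)]
    rw [h4]
    have := sum_pow_four_le hN hNM hs Y a ha
    apply mul_le_mul (by gcongr) this (Finset.sum_nonneg fun n _ => by positivity) (by positivity)
  refine h1.trans ?_
  set x : ℝ := (N : ℝ) ^ (-(1 / 8) : ℝ) with hx
  have hx0 : 0 ≤ x := by positivity
  have hx4 : √(N : ℝ) * x ^ 4 = 1 := by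
    rw [hx, Real.sqrt_eq_rpow, ← Real.rpow_natCast, ← Real.rpow_mul (by positivity),
      ← Real.rpow_add (by positivity)]
    norm_num
  apply le_of_pow_le_pow_left₀ (n := 4) (by norm_num) (by positivity)
  refine h2.trans ?_
  have hsq : √(6 * N : ℝ) ≤ 5 / 2 * √N := by
    rw [Real.sqrt_mul (by norm_num)]
    apply mul_le_mul_of_nonneg_right _ (Real.sqrt_nonneg _)
    rw [Real.sqrt_le_iff]; norm_num
  have hlog : 1 + Real.log M ≤ 1 + Real.log Y := one_add_log_mono (Nat.div_le_self _ _)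
  have hM1 := one_le_one_add_log M
  have hs0 : 0 ≤ √(N : ℝ) := Real.sqrt_nonneg _
  have e1 : √(N : ℝ) * √(N : ℝ) = N := Real.mul_self_sqrt (by positivity)
  calc (N : ℝ) ^ 3 * (4 * (M ^ 4 * (1 + Real.log M) ^ 5 * √(6 * N)))
      ≤ (N : ℝ) ^ 3 * (4 * (M ^ 4 * (1 + Real.log Y) ^ 8 * (5 / 2 * √N))) := by
        have : (1 + Real.log M) ^ 5 ≤ (1 + Real.log Y) ^ 8 :=
          (pow_le_pow_left₀ (by linarith) hlog 5).trans (pow_le_pow_right₀ hL (by norm_num))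
        gcongr
    _ = 10 * (M * N) ^ 4 * (1 + Real.log Y) ^ 8 * x ^ 4 := by
        have e5 : (N : ℝ) ^ 3 * √N = N ^ 4 * x ^ 4 := by
          calc (N : ℝ) ^ 3 * √N = N ^ 3 * √N * (√N * x ^ 4) := by rw [hx4, mul_one]
            _ = N ^ 3 * (√N * √N) * x ^ 4 := by ring
            _ = _ := by rw [e1]; ring
        linear_combination (10 * (M : ℝ) ^ 4 * (1 + Real.log Y) ^ 8) * e5
    _ ≤ 16 * Y ^ 4 * (1 + Real.log Y) ^ 8 * x ^ 4 := by
        gcongr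
        norm_num
    _ = _ := by ring

/-- The sign `1` or `-1` of a natural number according to whether it is `1` modulo `4`. -/
def sgnFour (n : ℕ) : ℝ := if n % 4 = 1 then 1 else -1

theorem abs_sgnFour (n : ℕ) : |sgnFour n| = 1 := by
  rw [sgnFour]; split_ifs <;> simp

theorem jacobiSym_reciprocity {m n : ℕ} (hm : Odd m) (hn : Odd n) :
    (jacobiSym m n : ℝ) =
      (1 + sgnFour m + sgnFour n - sgnFour m * sgnFour n) / 2 * jacobiSym n m := by
  by_cases h1 : m % 4 = 1
  · rw [jacobiSym.quadratic_reciprocity_one_mod_four h1 hn]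
    simp [sgnFour, h1]
  · by_cases h2 : n % 4 = 1
    · rw [jacobiSym.quadratic_reciprocity_one_mod_four' hm h2]
      simp [sgnFour, h1, h2]
    · have h3 : m % 4 = 3 := by have := Nat.odd_iff.1 hm; omega
      have h4 : n % 4 = 3 := by have := Nat.odd_iff.1 hn; omega
      rw [jacobiSym.quadratic_reciprocity_three_mod_four h3 h4]
      simp [sgnFour, h1, h2]
      ring

theorem nat_log_two_add_one_le {Y : ℕ} : ((Nat.log 2 Y + 1 : ℕ) : ℝ) ≤ 2 * (1 + Real.log Y) := by
  have h2 : (Nat.log 2 Y : ℝ) ≤ Real.log Y / Real.log 2 := by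
    have := Real.natLog_le_logb Y 2
    simpa [Real.logb] using this
  have h3 : Real.log Y / Real.log 2 ≤ 2 * Real.log Y := by
    rw [div_le_iff₀ (by linarith [Real.log_two_gt_d9])]
    nlinarith [Real.log_natCast_nonneg Y, Real.log_two_gt_d9]
  push_cast
  linarith

theorem abs_bilinear_half_le {Y Z : ℕ} (hZ : 1 ≤ Z) (a b : ℕ → ℝ)
    (ha : ∀ m, |a m| ≤ 1) (hb : ∀ m, |b m| ≤ 1)
    (hbs : ∀ n, b n ≠ 0 → Odd n ∧ Squarefree n ∧ Z < n ∧ n * n ≤ Y) :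
    |∑ n ∈ Icc 1 Y, ∑ m ∈ Icc 1 (Y / n), a m * b n * (jacobiSym m n : ℝ)| ≤
      8 * Y * (1 + Real.log Y) ^ 3 * (Z : ℝ) ^ (-(1 / 8) : ℝ) := by
  set s := (Icc 1 Y).filter (fun n => b n ≠ 0) with hs
  have h1 : ∑ n ∈ Icc 1 Y, ∑ m ∈ Icc 1 (Y / n), a m * b n * (jacobiSym m n : ℝ) =
      ∑ n ∈ s, ∑ m ∈ Icc 1 (Y / n), a m * b n * (jacobiSym m n : ℝ) := by
    rw [hs, Finset.sum_filter]
    refine Finset.sum_congr rfl fun n _ => ?_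
    by_cases h : b n = 0 <;> simp [h]
  have hmaps : ∀ n ∈ s, Nat.log 2 n ∈ range (Nat.log 2 Y + 1) := by
    intro n hn
    rw [hs, Finset.mem_filter, Finset.mem_Icc] at hn
    rw [Finset.mem_range, Nat.lt_succ_iff]
    exact Nat.log_mono_right hn.1.2
  rw [h1, ← Finset.sum_fiberwise_of_maps_to hmaps]
  have hL := one_le_one_add_log Y
  have hZr : (1 : ℝ) ≤ Z := by exact_mod_cast hZ
  set z : ℝ := (Z : ℝ) ^ (-(1 / 8) : ℝ) with hz
  have hz0 : 0 ≤ z := by positivity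
  have h2 : ∀ k ∈ range (Nat.log 2 Y + 1), |∑ n ∈ s with Nat.log 2 n = k, ∑ m ∈ Icc 1 (Y / n),
      a m * b n * (jacobiSym m n : ℝ)| ≤ 4 * Y * (1 + Real.log Y) ^ 2 * z := by
    intro k _
    rcases Finset.eq_empty_or_nonempty (s.filter fun n => Nat.log 2 n = k) with he | ⟨n0, hn0⟩
    · rw [he]
      simp only [sum_empty, abs_zero]
      positivity
    have hmem : ∀ n ∈ s.filter (fun n => Nat.log 2 n = k), 2 ^ k ≤ n ∧ n < 2 * 2 ^ k ∧ b n ≠ 0 := by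
      intro n hn
      rw [hs, Finset.mem_filter, Finset.mem_filter, Finset.mem_Icc] at hn
      obtain ⟨⟨⟨hn1, _⟩, hn2⟩, rfl⟩ := hn
      refine ⟨Nat.pow_log_le_self 2 (by omega), ?_, hn2⟩
      rw [← pow_succ']
      exact Nat.lt_pow_succ_log_self (by norm_num) n
    obtain ⟨e1, e2, e3⟩ := hmem n0 hn0
    obtain ⟨_, _, e4, e5⟩ := hbs n0 e3
    have hblock := abs_bilinear_block_le (N := 2 ^ k) (Y := Y) (Nat.one_le_two_pow)
      ((Nat.mul_le_mul e1 e1).trans e5) (s := s.filter (fun n => Nat.log 2 n = k))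
      (fun n hn => ⟨(hmem n hn).1, (hmem n hn).2.1, (hbs n (hmem n hn).2.2).1,
        (hbs n (hmem n hn).2.2).2.1⟩) a b ha hb
    refine hblock.trans ?_
    have hN : (Z : ℝ) / 2 ≤ (2 ^ k : ℕ) := by
      have : Z < 2 * 2 ^ k := e4.trans e2
      have : (Z : ℝ) < 2 * (2 ^ k : ℕ) := by exact_mod_cast this
      linarith
    have e6 : ((2 ^ k : ℕ) : ℝ) ^ (-(1 / 8) : ℝ) ≤ 2 * z := by
      calc ((2 ^ k : ℕ) : ℝ) ^ (-(1 / 8) : ℝ) ≤ ((Z : ℝ) / 2) ^ (-(1 / 8) : ℝ) :=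
            Real.rpow_le_rpow_of_nonpos (by positivity) hN (by norm_num)
        _ = (1 / 2 : ℝ) ^ (-(1 / 8) : ℝ) * z := by
            rw [hz, ← Real.mul_rpow (by norm_num) (by positivity)]
            congr 1; ring
        _ ≤ 2 * z := by
            apply mul_le_mul_of_nonneg_right _ hz0
            rw [one_div, Real.inv_rpow (by norm_num), ← Real.rpow_neg (by norm_num)]
            calc (2 : ℝ) ^ (-(-(1 / 8)) : ℝ) ≤ 2 ^ (1 : ℝ) :=
                  Real.rpow_le_rpow_of_exponent_le (by norm_num) (by norm_num)
              _ = 2 := by norm_num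
    calc _ ≤ 2 * Y * (1 + Real.log Y) ^ 2 * (2 * z) := by gcongr
      _ = _ := by ring
  calc _ ≤ ∑ k ∈ range (Nat.log 2 Y + 1), 4 * Y * (1 + Real.log Y) ^ 2 * z :=
        (Finset.abs_sum_le_sum_abs _ _).trans (Finset.sum_le_sum h2)
    _ = ((Nat.log 2 Y + 1 : ℕ) : ℝ) * (4 * Y * (1 + Real.log Y) ^ 2 * z) := by
        rw [Finset.sum_const, Finset.card_range, nsmul_eq_mul]
    _ ≤ (2 * (1 + Real.log Y)) * (4 * Y * (1 + Real.log Y) ^ 2 * z) :=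
        mul_le_mul_of_nonneg_right nat_log_two_add_one_le (by positivity)
    _ = _ := by ring

theorem sum_hyperbola_comm (Y : ℕ) (F : ℕ → ℕ → ℝ) :
    ∑ n ∈ Icc 1 Y, ∑ m ∈ Icc 1 (Y / n), F m n = ∑ m ∈ Icc 1 Y, ∑ n ∈ Icc 1 (Y / m), F m n := by
  apply Finset.sum_comm'
  intro n m
  simp only [Finset.mem_Icc]
  constructor
  · rintro ⟨⟨h1, h2⟩, h3, h4⟩
    rw [Nat.le_div_iff_mul_le h1] at h4
    have := (Nat.le_mul_of_pos_right m h1).trans h4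
    exact ⟨⟨h1, (Nat.le_div_iff_mul_le h3).2 (by rwa [mul_comm])⟩, h3, this⟩
  · rintro ⟨⟨h1, h2⟩, h3, h4⟩
    rw [Nat.le_div_iff_mul_le h3] at h2
    have := (Nat.le_mul_of_pos_right n h3).trans h2
    exact ⟨⟨h1, this⟩, h3, (Nat.le_div_iff_mul_le h1).2 (by rwa [mul_comm])⟩

theorem abs_bilinear_le {Y Z : ℕ} (hZ : 1 ≤ Z) (a b : ℕ → ℝ)
    (ha : ∀ m, |a m| ≤ 1) (hb : ∀ m, |b m| ≤ 1)
    (has : ∀ n, a n ≠ 0 → Odd n ∧ Squarefree n ∧ Z < n)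
    (hbs : ∀ n, b n ≠ 0 → Odd n ∧ Squarefree n ∧ Z < n) :
    |∑ n ∈ Icc 1 Y, ∑ m ∈ Icc 1 (Y / n), a m * b n * (jacobiSym m n : ℝ)| ≤
      24 * Y * (1 + Real.log Y) ^ 3 * (Z : ℝ) ^ (-(1 / 8) : ℝ) := by
  set B : ℝ := 8 * Y * (1 + Real.log Y) ^ 3 * (Z : ℝ) ^ (-(1 / 8) : ℝ) with hB
  set b0 : ℕ → ℝ := fun n => if n * n ≤ Y then b n else 0 with hb0
  set b1 : ℕ → ℝ := fun n => if n * n ≤ Y then 0 else b n with hb1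
  set a0 : ℕ → ℝ := fun n => if n * n ≤ Y then a n else 0 with ha0
  have hb0' : ∀ n, |b0 n| ≤ 1 := fun n => by
    simp only [hb0]; split_ifs; exacts [hb n, by simp]
  have hb1' : ∀ n, |b1 n| ≤ 1 := fun n => by
    simp only [hb1]; split_ifs; exacts [by simp, hb n]
  have ha0' : ∀ n, |a0 n| ≤ 1 := fun n => by
    simp only [ha0]; split_ifs; exacts [ha n, by simp]
  have hsplit : ∑ n ∈ Icc 1 Y, ∑ m ∈ Icc 1 (Y / n), a m * b n * (jacobiSym m n : ℝ) =
      ∑ n ∈ Icc 1 Y, ∑ m ∈ Icc 1 (Y / n), a m * b0 n * (jacobiSym m n : ℝ) +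
      ∑ n ∈ Icc 1 Y, ∑ m ∈ Icc 1 (Y / n), a0 m * b1 n * (jacobiSym m n : ℝ) := by
    rw [← Finset.sum_add_distrib]
    refine Finset.sum_congr rfl fun n hn => ?_
    rw [← Finset.sum_add_distrib]
    refine Finset.sum_congr rfl fun m hm => ?_
    rw [Finset.mem_Icc] at hn hm
    by_cases h : n * n ≤ Y
    · simp [hb0, hb1, h]
    · have hm2 := (Nat.le_div_iff_mul_le hn.1).1 hm.2
      have : m < n := by
        by_contra hc
        exact h ((Nat.mul_le_mul_right n (not_lt.1 hc)).trans hm2)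
      have : m * m ≤ Y := (Nat.mul_le_mul_left m this.le).trans hm2
      simp [hb0, hb1, ha0, h, this]
  have h0 : |∑ n ∈ Icc 1 Y, ∑ m ∈ Icc 1 (Y / n), a m * b0 n * (jacobiSym m n : ℝ)| ≤ B := by
    apply abs_bilinear_half_le hZ a b0 ha hb0'
    intro n hn
    simp only [hb0, ne_eq, ite_eq_right_iff, Classical.not_imp] at hn
    obtain ⟨h1, h2, h3⟩ := hbs n hn.2
    exact ⟨h1, h2, h3, hn.1⟩
  have hflip : ∀ f g : ℕ → ℝ, (∀ n, |f n| ≤ 1) → (∀ n, |g n| ≤ 1) →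
      |∑ m ∈ Icc 1 Y, ∑ n ∈ Icc 1 (Y / m), (b1 n * g n) * (a0 m * f m) * (jacobiSym n m : ℝ)| ≤ B := by
    intro f g hf hg
    apply abs_bilinear_half_le hZ
    · intro n; rw [abs_mul]; exact mul_le_one₀ (hb1' n) (abs_nonneg _) (hg n)
    · intro n; rw [abs_mul]; exact mul_le_one₀ (ha0' n) (abs_nonneg _) (hf n)
    · intro n hn
      have hn := left_ne_zero_of_mul hn
      simp only [ha0, ne_eq, ite_eq_right_iff, Classical.not_imp] at hn
      obtain ⟨h1, h2, h3⟩ := has n hn.2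
      exact ⟨h1, h2, h3, hn.1⟩
  have hone : ∀ n : ℕ, |(fun _ : ℕ => (1 : ℝ)) n| ≤ 1 := by simp
  have hsg : ∀ n : ℕ, |sgnFour n| ≤ 1 := fun n => (abs_sgnFour n).le
  have f1 := hflip _ _ hone hone
  have f2 := hflip _ _ hsg hone
  have f3 := hflip _ _ hone hsg
  have f4 := hflip _ _ hsg hsg
  have hdec : ∑ n ∈ Icc 1 Y, ∑ m ∈ Icc 1 (Y / n), a0 m * b1 n * (jacobiSym m n : ℝ) =
      (∑ m ∈ Icc 1 Y, ∑ n ∈ Icc 1 (Y / m), (b1 n * 1) * (a0 m * 1) * (jacobiSym n m : ℝ) +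
      ∑ m ∈ Icc 1 Y, ∑ n ∈ Icc 1 (Y / m), (b1 n * 1) * (a0 m * sgnFour m) * (jacobiSym n m : ℝ) +
      ∑ m ∈ Icc 1 Y, ∑ n ∈ Icc 1 (Y / m), (b1 n * sgnFour n) * (a0 m * 1) * (jacobiSym n m : ℝ) -
      ∑ m ∈ Icc 1 Y, ∑ n ∈ Icc 1 (Y / m),
        (b1 n * sgnFour n) * (a0 m * sgnFour m) * (jacobiSym n m : ℝ)) / 2 := by
    rw [sum_hyperbola_comm]
    simp_rw [← Finset.sum_add_distrib, ← Finset.sum_sub_distrib, Finset.sum_div]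
    refine Finset.sum_congr rfl fun m _ => Finset.sum_congr rfl fun n _ => ?_
    by_cases hm : a0 m = 0
    · simp [hm]
    by_cases hn : b1 n = 0
    · simp [hn]
    have hm' : Odd m := by
      simp only [ha0, ite_eq_right_iff, Classical.not_imp] at hm
      exact (has m hm.2).1
    have hn' : Odd n := by
      simp only [hb1, ite_eq_left_iff, Classical.not_imp] at hn
      exact (hbs n hn.2).1
    rw [jacobiSym_reciprocity hm' hn']
    ring
  rw [hsplit, hdec]
  rw [abs_le] at *
  constructor <;> linarith [f1.1, f1.2, f2.1, f2.2, f3.1, f3.2, f4.1, f4.2, h0.1, h0.2]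

theorem summable_mul_rpow_neg {f : ℕ → ℝ} (hb : ∀ n, |f n| ≤ 1) {σ : ℝ} (hσ : 1 < σ) :
    Summable fun n : ℕ => f n * (n : ℝ) ^ (-σ) := by
  apply Summable.of_norm_bounded (g := fun n : ℕ => (n : ℝ) ^ (-σ))
  · exact Real.summable_nat_rpow.2 (by linarith)
  · intro n
    rw [Real.norm_eq_abs, abs_mul, abs_of_nonneg (by positivity : (0 : ℝ) ≤ (n : ℝ) ^ (-σ))]
    exact mul_le_of_le_one_left (by positivity) (hb n)

theorem summable_primes_mul_rpow_neg {f : ℕ → ℝ} (hb : ∀ n, |f n| ≤ 1) {σ : ℝ} (hσ : 1 < σ) :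
    Summable fun p : Nat.Primes => f p * ((p : ℕ) : ℝ) ^ (-σ) :=
  (summable_mul_rpow_neg hb hσ).comp_injective Subtype.val_injective

theorem hasProd_primes {f : ℕ → ℝ} (h0 : f 0 = 0) (h1 : f 1 = 1)
    (hm : ∀ m n, f (m * n) = f m * f n) (hb : ∀ n, |f n| ≤ 1) {σ : ℝ} (hσ : 1 < σ) :
    HasProd (fun p : Nat.Primes => (1 - f p * ((p : ℕ) : ℝ) ^ (-σ))⁻¹)
      (∑' n : ℕ, f n * (n : ℝ) ^ (-σ)) := by
  let F : ℕ →*₀ ℝ :=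
    { toFun := fun n => f n * (n : ℝ) ^ (-σ)
      map_zero' := by simp [h0]
      map_one' := by simp [h1]
      map_mul' := fun m n => by
        rw [hm, Nat.cast_mul, Real.mul_rpow (by positivity) (by positivity)]; ring }
  have := EulerProduct.eulerProduct_completely_multiplicative_hasProd (f := F)
    (summable_mul_rpow_neg hb hσ).norm
  exact this

theorem prime_rpow_neg_le_half {p : ℕ} (hp : p.Prime) {σ : ℝ} (hσ : 1 < σ) :
    (p : ℝ) ^ (-σ) ≤ 1 / 2 := by
  have h2 : (2 : ℝ) ≤ p := by exact_mod_cast hp.two_le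
  calc (p : ℝ) ^ (-σ) ≤ (p : ℝ) ^ (-1 : ℝ) :=
        Real.rpow_le_rpow_of_exponent_le (by linarith) (by linarith)
    _ = 1 / p := by rw [Real.rpow_neg_one, one_div]
    _ ≤ 1 / 2 := one_div_le_one_div_of_le (by norm_num) h2

theorem abs_mul_prime_rpow_neg_le_half {f : ℕ → ℝ} (hb : ∀ n, |f n| ≤ 1) {p : ℕ} (hp : p.Prime)
    {σ : ℝ} (hσ : 1 < σ) : |f p * (p : ℝ) ^ (-σ)| ≤ 1 / 2 := by
  rw [abs_mul, abs_of_nonneg (by positivity : (0 : ℝ) ≤ (p : ℝ) ^ (-σ))]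
  exact (mul_le_of_le_one_left (by positivity) (hb p)).trans (prime_rpow_neg_le_half hp hσ)

theorem exp_tsum_primes_le {f : ℕ → ℝ} (h0 : f 0 = 0) (h1 : f 1 = 1)
    (hm : ∀ m n, f (m * n) = f m * f n) (hb : ∀ n, |f n| ≤ 1) {σ : ℝ} (hσ : 1 < σ) :
    Real.exp (∑' p : Nat.Primes, f p * ((p : ℕ) : ℝ) ^ (-σ)) ≤ ∑' n : ℕ, f n * (n : ℝ) ^ (-σ) := by
  have hP := hasProd_primes h0 h1 hm hb hσ
  have hS := (summable_primes_mul_rpow_neg hb hσ).hasSum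
  have hE : Tendsto (fun s : Finset Nat.Primes => Real.exp (∑ p ∈ s, f p * ((p : ℕ) : ℝ) ^ (-σ)))
      atTop (nhds (Real.exp (∑' p : Nat.Primes, f p * ((p : ℕ) : ℝ) ^ (-σ)))) :=
    (Real.continuous_exp.tendsto _).comp hS
  refine le_of_tendsto_of_tendsto' hE hP fun s => ?_
  rw [Real.exp_sum]
  refine Finset.prod_le_prod (fun _ _ => (Real.exp_pos _).le) fun p _ => ?_
  have hy := abs_le.1 (abs_mul_prime_rpow_neg_le_half hb p.2 hσ)
  set y := f p * ((p : ℕ) : ℝ) ^ (-σ)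
  rw [le_inv_comm₀ (Real.exp_pos _) (by linarith), ← Real.exp_neg]
  linarith [Real.add_one_le_exp (-y)]

theorem inv_one_sub_le_exp {y : ℝ} (hy : |y| ≤ 1 / 2) : (1 - y)⁻¹ ≤ Real.exp (y + y ^ 2) := by
  obtain ⟨h1, h2⟩ := abs_le.1 hy
  have h3 : y + y ^ 2 + 1 ≤ Real.exp (y + y ^ 2) := Real.add_one_le_exp _
  rw [inv_le_iff_one_le_mul₀ (by linarith)]
  rcases le_or_gt 0 y with h | h
  · have := Real.quadratic_le_exp_of_nonneg (show 0 ≤ y + y ^ 2 by nlinarith)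
    have : 1 ≤ (1 + (y + y ^ 2) + (y + y ^ 2) ^ 2 / 2) * (1 - y) := by
      have e : (1 + (y + y ^ 2) + (y + y ^ 2) ^ 2 / 2) * (1 - y) = 1 + y ^ 2 * (1 - y * (1 + y + y ^ 2)) / 2 := by ring
      rw [e]
      have : y * (1 + y + y ^ 2) ≤ 1 := by nlinarith
      nlinarith [sq_nonneg y]
    nlinarith
  · nlinarith [sq_nonneg y, mul_nonneg (sq_nonneg y) (neg_nonneg.2 h.le)]

theorem tsum_le_exp_tsum_primes {f : ℕ → ℝ} (h0 : f 0 = 0) (h1 : f 1 = 1)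
    (hm : ∀ m n, f (m * n) = f m * f n) (hb : ∀ n, |f n| ≤ 1) {σ : ℝ} (hσ : 1 < σ) :
    ∑' n : ℕ, f n * (n : ℝ) ^ (-σ) ≤
      Real.exp (∑' p : Nat.Primes, f p * ((p : ℕ) : ℝ) ^ (-σ) + ∑' n : ℕ, (n : ℝ) ^ (-2 : ℝ)) := by
  have hP := hasProd_primes h0 h1 hm hb hσ
  have hS := (summable_primes_mul_rpow_neg hb hσ).hasSum
  have hE : Tendsto (fun s : Finset Nat.Primes =>
      Real.exp (∑ p ∈ s, f p * ((p : ℕ) : ℝ) ^ (-σ) + ∑' n : ℕ, (n : ℝ) ^ (-2 : ℝ)))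
      atTop (nhds (Real.exp (∑' p : Nat.Primes, f p * ((p : ℕ) : ℝ) ^ (-σ) + ∑' n : ℕ, (n : ℝ) ^ (-2 : ℝ)))) :=
    (Real.continuous_exp.tendsto _).comp (Tendsto.add_const _ hS)
  refine le_of_tendsto_of_tendsto' hP hE fun s => ?_
  have hs2 : Summable fun n : ℕ => (n : ℝ) ^ (-2 : ℝ) := Real.summable_nat_rpow.2 (by norm_num)
  have hs2' : Summable fun p : Nat.Primes => ((p : ℕ) : ℝ) ^ (-2 : ℝ) :=
    hs2.comp_injective Subtype.val_injective
  have h3 : ∑ p ∈ s, (f p * ((p : ℕ) : ℝ) ^ (-σ)) ^ 2 ≤ ∑' n : ℕ, (n : ℝ) ^ (-2 : ℝ) := by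
    calc _ ≤ ∑ p ∈ s, ((p : ℕ) : ℝ) ^ (-2 : ℝ) := by
          refine Finset.sum_le_sum fun p _ => ?_
          have hp1 : (1 : ℝ) ≤ (p : ℕ) := by exact_mod_cast p.2.one_lt.le
          rw [mul_pow, ← Real.rpow_natCast (((p : ℕ) : ℝ) ^ (-σ)), ← Real.rpow_mul (by positivity)]
          calc _ ≤ 1 * ((p : ℕ) : ℝ) ^ (-σ * (2 : ℕ)) := by
                apply mul_le_mul_of_nonneg_right _ (by positivity)
                rw [← sq_abs]; exact pow_le_one₀ (abs_nonneg _) (hb _)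
            _ ≤ _ := by
                rw [one_mul]
                apply Real.rpow_le_rpow_of_exponent_le hp1
                push_cast; linarith
      _ ≤ ∑' p : Nat.Primes, ((p : ℕ) : ℝ) ^ (-2 : ℝ) :=
          hs2'.sum_le_tsum s (fun _ _ => by positivity)
      _ ≤ _ := by
          exact Summable.tsum_subtype_le (fun n : ℕ => (n : ℝ) ^ (-2 : ℝ)) {p : ℕ | p.Prime} (fun n => by positivity) hs2
  calc _ ≤ ∏ p ∈ s, Real.exp (f p * ((p : ℕ) : ℝ) ^ (-σ) + (f p * ((p : ℕ) : ℝ) ^ (-σ)) ^ 2) := by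
        refine Finset.prod_le_prod (fun p _ => ?_) fun p _ => ?_
        · have hy := abs_le.1 (abs_mul_prime_rpow_neg_le_half hb p.2 hσ)
          rw [inv_nonneg]; linarith
        · exact inv_one_sub_le_exp (abs_mul_prime_rpow_neg_le_half hb p.2 hσ)
    _ ≤ _ := by
        rw [← Real.exp_sum, Finset.sum_add_distrib]
        apply Real.exp_le_exp.2
        linarith

theorem tsum_rpow_neg_le {σ : ℝ} (hσ : 1 < σ) :
    ∑' n : ℕ, (n : ℝ) ^ (-σ) ≤ 1 + 1 / (σ - 1) := by
  have hs : Summable fun n : ℕ => (n : ℝ) ^ (-σ) := Real.summable_nat_rpow.2 (by linarith)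
  apply hs.tsum_le_of_sum_range_le
  intro n
  have hant : AntitoneOn (fun x : ℝ => x ^ (-σ)) (Set.Icc (1 : ℝ) (1 + n)) := by
    intro x hx y hy hxy
    exact Real.rpow_le_rpow_of_nonpos (by linarith [hx.1]) hxy (by linarith)
  have h1 := hant.sum_le_integral
  rw [integral_rpow (Or.inr ⟨by linarith, by rw [Set.uIcc_of_le (by linarith [Nat.cast_nonneg (α := ℝ) n])]; rintro ⟨h, _⟩; linarith⟩)] at h1
  have h2 : ∑ i ∈ range (n + 2), (i : ℝ) ^ (-σ) =
      1 + ∑ i ∈ range n, ((1 : ℝ) + ((i + 1 : ℕ) : ℝ)) ^ (-σ) := by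
    rw [Finset.sum_range_succ', Finset.sum_range_succ']
    have : (0 : ℝ) ^ (-σ) = 0 := Real.zero_rpow (by linarith)
    simp only [Nat.cast_zero, this, Nat.cast_add, Nat.cast_one, zero_add, Real.one_rpow, add_zero]
    rw [add_comm]
    congr 1
    refine Finset.sum_congr rfl fun i _ => ?_
    congr 1; ring
  have h3 : ∑ i ∈ range n, (i : ℝ) ^ (-σ) ≤ ∑ i ∈ range (n + 2), (i : ℝ) ^ (-σ) :=
    Finset.sum_le_sum_of_subset_of_nonneg (Finset.range_mono (by omega)) (fun _ _ _ => by positivity)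
  have h4 : ((1 + n : ℝ) ^ (-σ + 1) - 1 ^ (-σ + 1)) / (-σ + 1) ≤ 1 / (σ - 1) := by
    have : (0 : ℝ) ≤ (1 + n : ℝ) ^ (-σ + 1) := by positivity
    rw [Real.one_rpow, ← neg_div_neg_eq, neg_sub, neg_add, neg_neg, ← sub_eq_add_neg]
    apply div_le_div_of_nonneg_right _ (by linarith)
    linarith
  linarith

theorem tsum_mul_rpow_neg_le_of_periodic {f : ℕ → ℝ} {q : ℕ} (hq : 0 < q)
    (hper : Function.Periodic f q) (hz : ∑ n ∈ range q, f n = 0) (hb : ∀ n, |f n| ≤ 1)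
    {σ : ℝ} (hσ : 1 < σ) : ∑' n : ℕ, f n * (n : ℝ) ^ (-σ) ≤ 2 + Real.log q := by
  have hs := summable_mul_rpow_neg hb hσ
  have hqr : (1 : ℝ) ≤ q := by exact_mod_cast hq
  rw [← hs.sum_add_tsum_nat_add q]
  have h1 : ∑ n ∈ range q, f n * (n : ℝ) ^ (-σ) ≤ 1 + Real.log q := by
    refine le_trans ?_ (sum_Icc_one_div_le q)
    calc _ ≤ ∑ n ∈ range q, (1 / n : ℝ) := by
          refine Finset.sum_le_sum fun n _ => ?_
          rcases Nat.eq_zero_or_pos n with rfl | hn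
          · simp [Real.zero_rpow (show -σ ≠ 0 by linarith)]
          · have hn1 : (1 : ℝ) ≤ n := by exact_mod_cast hn
            calc _ ≤ 1 * (n : ℝ) ^ (-σ) :=
                  mul_le_mul_of_nonneg_right ((le_abs_self _).trans (hb n)) (by positivity)
              _ ≤ (n : ℝ) ^ (-1 : ℝ) := by
                  rw [one_mul]
                  exact Real.rpow_le_rpow_of_exponent_le hn1 (by linarith)
              _ = _ := by rw [Real.rpow_neg_one, one_div]
      _ ≤ ∑ n ∈ insert 0 (Icc 1 q), (1 / n : ℝ) := by
          apply Finset.sum_le_sum_of_subset_of_nonneg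
          · intro n hn
            simp only [Finset.mem_range] at hn
            simp only [Finset.mem_insert, Finset.mem_Icc]; omega
          · intros; positivity
      _ = _ := by rw [Finset.sum_insert (by simp)]; simp
  have hs' : Summable fun n : ℕ => f (n + q) * ((n + q : ℕ) : ℝ) ^ (-σ) :=
    (summable_nat_add_iff q).2 hs
  have h2 : ∑' n : ℕ, f (n + q) * ((n + q : ℕ) : ℝ) ^ (-σ) ≤ 1 := by
    apply le_of_tendsto' hs'.hasSum.tendsto_sum_nat
    intro n
    have hper' : ∀ n, f (n + q) = f n := hper
    simp_rw [hper']
    have := abs_sum_mul_le_of_antitone (f := f) (w := fun n : ℕ => ((n + q : ℕ) : ℝ) ^ (-σ)) (B := q)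
      (by
        intro a b hab
        apply Real.rpow_le_rpow_of_nonpos _ _ (by linarith)
        · exact_mod_cast (by omega : 0 < a + q)
        · exact_mod_cast (by omega : a + q ≤ b + q))
      (fun n => by positivity)
      (fun n => abs_sum_range_le_of_periodic hq hper hz hb n) n
    refine (le_abs_self _).trans (this.trans ?_)
    rw [zero_add]
    calc (q : ℝ) * (q : ℝ) ^ (-σ) ≤ q * (q : ℝ) ^ (-1 : ℝ) := by
          apply mul_le_mul_of_nonneg_left _ (by positivity)
          exact Real.rpow_le_rpow_of_exponent_le hqr (by linarith)
      _ = 1 := by rw [Real.rpow_neg_one]; field_simp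
  linarith

/-- The nontrivial character modulo `4`, real-valued. -/
def chiFour (n : ℕ) : ℝ := ((ZMod.χ₄ n : ℤ) : ℝ)

theorem chiFour_eq (n : ℕ) : chiFour n = if n % 2 = 0 then 0 else if n % 4 = 1 then 1 else -1 := by
  rw [chiFour, ZMod.χ₄_nat_eq_if_mod_four]
  split_ifs <;> simp

theorem chiFour_mul (m n : ℕ) : chiFour (m * n) = chiFour m * chiFour n := by
  rw [chiFour, chiFour, chiFour, Nat.cast_mul, map_mul, Int.cast_mul]

theorem abs_chiFour_le (n : ℕ) : |chiFour n| ≤ 1 := by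
  rw [chiFour_eq]; split_ifs <;> simp

theorem chiFour_periodic : Function.Periodic chiFour 4 := by
  intro n
  rw [chiFour_eq, chiFour_eq, Nat.add_mod_right,
    show (n + 4) % 2 = n % 2 by omega]

theorem sum_range_chiFour (n : ℕ) :
    ∑ i ∈ range n, chiFour i = if n % 4 = 2 ∨ n % 4 = 3 then 1 else 0 := by
  induction n with
  | zero => simp
  | succ n ih =>
    rw [Finset.sum_range_succ, ih, chiFour_eq]
    have h : n % 4 = 0 ∨ n % 4 = 1 ∨ n % 4 = 2 ∨ n % 4 = 3 := by omega
    rcases h with h | h | h | h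
    · have h2 : n % 2 = 0 := by omega
      have h3 : (n + 1) % 4 = 1 := by omega
      simp [h, h2, h3]
    · have h2 : n % 2 = 1 := by omega
      have h3 : (n + 1) % 4 = 2 := by omega
      simp [h, h2, h3]
    · have h2 : n % 2 = 0 := by omega
      have h3 : (n + 1) % 4 = 3 := by omega
      simp [h, h2, h3]
    · have h2 : n % 2 = 1 := by omega
      have h3 : (n + 1) % 4 = 0 := by omega
      simp [h, h2, h3]

theorem half_le_tsum_chiFour {σ : ℝ} (hσ : 1 < σ) :
    1 / 2 ≤ ∑' n : ℕ, chiFour n * (n : ℝ) ^ (-σ) := by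
  have hs := summable_mul_rpow_neg abs_chiFour_le hσ
  rw [← hs.sum_add_tsum_nat_add 2]
  have h1 : ∑ n ∈ range 2, chiFour n * (n : ℝ) ^ (-σ) = 1 := by
    simp [Finset.sum_range_succ, chiFour]
  have hs' : Summable fun n : ℕ => chiFour (n + 2) * ((n + 2 : ℕ) : ℝ) ^ (-σ) :=
    (summable_nat_add_iff 2).2 hs
  have h2 : -(1 / 2) ≤ ∑' n : ℕ, chiFour (n + 2) * ((n + 2 : ℕ) : ℝ) ^ (-σ) := by
    apply ge_of_tendsto' hs'.hasSum.tendsto_sum_nat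
    intro n
    have hp : ∀ n, |∑ i ∈ range n, chiFour (i + 2)| ≤ 1 := by
      intro n
      have e := Finset.sum_range_add chiFour 2 n
      have e1 : ∑ i ∈ range 2, chiFour i = 1 := by simp [Finset.sum_range_succ, chiFour]
      simp_rw [add_comm 2] at e
      rw [e1, sum_range_chiFour] at e
      have : ∑ i ∈ range n, chiFour (i + 2) = (if (n + 2) % 4 = 2 ∨ (n + 2) % 4 = 3 then 1 else 0) - 1 := by
        linarith
      rw [this]
      split_ifs <;> simp
    have := abs_sum_mul_le_of_antitone (f := fun i => chiFour (i + 2))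
      (w := fun n : ℕ => ((n + 2 : ℕ) : ℝ) ^ (-σ)) (B := 1)
      (by
        intro a b hab
        apply Real.rpow_le_rpow_of_nonpos _ _ (by linarith)
        · exact_mod_cast (by omega : 0 < a + 2)
        · exact_mod_cast (by omega : a + 2 ≤ b + 2))
      (fun n => by positivity) hp n
    have h3 := (abs_le.1 this).1
    have h4 := prime_rpow_neg_le_half Nat.prime_two hσ
    rw [zero_add, one_mul] at h3
    push_cast at h3 h4 ⊢
    linarith
  linarith

/-- The multiplicative function supported on squarefree numbers with value `h p` at `p`. -/
def sqfProd (h : ℕ → ℝ) (n : ℕ) : ℝ := if Squarefree n then ∏ p ∈ n.primeFactors, h p else 0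

theorem sqfProd_nonneg {h : ℕ → ℝ} (h0 : ∀ p, p.Prime → 0 ≤ h p) (n : ℕ) : 0 ≤ sqfProd h n := by
  rw [sqfProd]; split_ifs
  · exact Finset.prod_nonneg fun p hp => h0 p (Nat.prime_of_mem_primeFactors hp)
  · exact le_rfl

theorem sqfProd_le_of_dvd {h : ℕ → ℝ} (h0 : ∀ p, p.Prime → 0 ≤ h p) (h1 : ∀ p, p.Prime → h p ≤ 1)
    {a n : ℕ} (ha : a ∣ n) : sqfProd h n ≤ sqfProd h a := by
  by_cases hn : Squarefree n
  · have hsa := hn.squarefree_of_dvd ha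
    rw [sqfProd, sqfProd, if_pos hn, if_pos hsa]
    rw [← Finset.prod_sdiff (Nat.primeFactors_mono ha hn.ne_zero)]
    apply mul_le_of_le_one_left
    · exact Finset.prod_nonneg fun p hp => h0 p (Nat.prime_of_mem_primeFactors hp)
    · apply Finset.prod_le_one
      · intro p hp
        exact h0 p (Nat.prime_of_mem_primeFactors (Finset.mem_sdiff.1 hp).1)
      · intro p hp
        exact h1 p (Nat.prime_of_mem_primeFactors (Finset.mem_sdiff.1 hp).1)
  · have : sqfProd h n = 0 := by rw [sqfProd, if_neg hn]
    rw [this]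
    exact sqfProd_nonneg h0 a

theorem sum_vonMangoldt_Icc_le (n : ℕ) :
    ∑ b ∈ Icc 1 n, ArithmeticFunction.vonMangoldt b ≤ (Real.log 4 + 4) * n := by
  have h := Chebyshev.psi_le_const_mul_self (x := (n : ℝ)) (by positivity)
  rw [Chebyshev.psi, Nat.floor_natCast] at h
  exact h

theorem sum_sqfProd_le {h : ℕ → ℝ} (h0 : ∀ p, p.Prime → 0 ≤ h p) (h1 : ∀ p, p.Prime → h p ≤ 1)
    (y : ℕ) : (1 + Real.log y) * ∑ n ∈ Icc 1 y, sqfProd h n ≤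
      8 * (y * ∑ n ∈ Icc 1 y, sqfProd h n * (1 / n)) := by
  have hlog : ∑ n ∈ Icc 1 y, sqfProd h n * Real.log n ≤
      (Real.log 4 + 4) * (y * ∑ n ∈ Icc 1 y, sqfProd h n * (1 / n)) := by
    calc _ ≤ ∑ n ∈ Icc 1 y, ∑ x ∈ n.divisorsAntidiagonal,
          sqfProd h x.1 * ArithmeticFunction.vonMangoldt x.2 := by
          refine Finset.sum_le_sum fun n _ => ?_
          rw [← ArithmeticFunction.vonMangoldt_sum,
            ← Nat.sum_divisorsAntidiagonal' (fun _ b => ArithmeticFunction.vonMangoldt b), Finset.mul_sum]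
          refine Finset.sum_le_sum fun x hx => ?_
          apply mul_le_mul_of_nonneg_right _ ArithmeticFunction.vonMangoldt_nonneg
          apply sqfProd_le_of_dvd h0 h1
          exact ⟨x.2, (Nat.mem_divisorsAntidiagonal.1 hx).1.symm⟩
      _ = ∑ a ∈ Icc 1 y, ∑ b ∈ Icc 1 (y / a), sqfProd h a * ArithmeticFunction.vonMangoldt b :=
          sum_Icc_divisorsAntidiagonal (fun a b => sqfProd h a * ArithmeticFunction.vonMangoldt b) y
      _ ≤ ∑ a ∈ Icc 1 y, sqfProd h a * ((Real.log 4 + 4) * (y / a)) := by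
          refine Finset.sum_le_sum fun a _ => ?_
          rw [← Finset.mul_sum]
          apply mul_le_mul_of_nonneg_left _ (sqfProd_nonneg h0 a)
          refine (sum_vonMangoldt_Icc_le _).trans ?_
          have : 0 ≤ Real.log 4 := Real.log_nonneg (by norm_num)
          exact mul_le_mul_of_nonneg_left Nat.cast_div_le (by linarith)
      _ = _ := by
          rw [Finset.mul_sum, Finset.mul_sum]
          refine Finset.sum_congr rfl fun a _ => ?_
          ring
  have hl4 : Real.log 4 ≤ 2 := by
    have : Real.log 4 = 2 * Real.log 2 := by
      rw [show (4 : ℝ) = 2 ^ 2 by norm_num, Real.log_pow]; norm_num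
    linarith [Real.log_two_lt_d9]
  have hrest : ∑ n ∈ Icc 1 y, sqfProd h n * (1 + (Real.log y - Real.log n)) ≤
      y * ∑ n ∈ Icc 1 y, sqfProd h n * (1 / n) := by
    rw [Finset.mul_sum]
    refine Finset.sum_le_sum fun n hn => ?_
    rw [Finset.mem_Icc] at hn
    have hn0 : (0 : ℝ) < n := by exact_mod_cast hn.1
    have hy0 : (0 : ℝ) < y := by exact_mod_cast (show 0 < y by omega)
    have : 1 + (Real.log y - Real.log n) ≤ y / n := by
      rw [← Real.log_div hy0.ne' hn0.ne']
      linarith [Real.log_le_sub_one_of_pos (div_pos hy0 hn0)]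
    calc _ ≤ sqfProd h n * (y / n) := mul_le_mul_of_nonneg_left this (sqfProd_nonneg h0 n)
      _ = _ := by ring
  have hS : 0 ≤ y * ∑ n ∈ Icc 1 y, sqfProd h n * (1 / n) :=
    mul_nonneg (by positivity) (Finset.sum_nonneg fun n _ =>
      mul_nonneg (sqfProd_nonneg h0 n) (by positivity))
  have e : (1 + Real.log y) * ∑ n ∈ Icc 1 y, sqfProd h n =
      ∑ n ∈ Icc 1 y, sqfProd h n * Real.log n +
      ∑ n ∈ Icc 1 y, sqfProd h n * (1 + (Real.log y - Real.log n)) := by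
    rw [← Finset.sum_add_distrib, Finset.mul_sum]
    refine Finset.sum_congr rfl fun n _ => ?_
    ring
  rw [e]
  nlinarith

theorem one_div_le_rpow {n y : ℕ} (hn : 1 ≤ n) (hny : n ≤ y) :
    (1 / n : ℝ) ≤ Real.exp 1 * (n : ℝ) ^ (-(1 + 1 / (1 + Real.log y))) := by
  have hL := one_le_one_add_log y
  have hn0 : (0 : ℝ) < n := by exact_mod_cast hn
  have hl : Real.log n ≤ 1 + Real.log y := by
    have := one_add_log_mono hny; linarith
  rw [neg_add, Real.rpow_add hn0, Real.rpow_neg_one, one_div]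
  have : 1 ≤ Real.exp 1 * (n : ℝ) ^ (-(1 / (1 + Real.log y))) := by
    rw [Real.rpow_def_of_pos hn0, ← Real.exp_add]
    apply Real.one_le_exp
    have : Real.log n * (1 / (1 + Real.log y)) ≤ 1 := by
      rw [mul_one_div, div_le_one (by linarith)]; exact hl
    linarith
  calc (n : ℝ)⁻¹ = (n : ℝ)⁻¹ * 1 := by ring
    _ ≤ (n : ℝ)⁻¹ * (Real.exp 1 * (n : ℝ) ^ (-(1 / (1 + Real.log y)))) := by gcongr
    _ = _ := by ring

theorem sum_sqfProd_div_le {h : ℕ → ℝ} (h0 : ∀ p, p.Prime → 0 ≤ h p) (y : ℕ)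
    (hs : Summable fun p : Nat.Primes => h p * ((p : ℕ) : ℝ) ^ (-(1 + 1 / (1 + Real.log y)))) :
    ∑ n ∈ Icc 1 y, sqfProd h n * (1 / n) ≤ Real.exp 1 *
      Real.exp (∑' p : Nat.Primes, h p * ((p : ℕ) : ℝ) ^ (-(1 + 1 / (1 + Real.log y)))) := by
  set σ := 1 + 1 / (1 + Real.log y) with hσ
  set g : ℕ → ℝ := fun p => h p * (p : ℝ) ^ (-σ) with hg
  have hg0 : ∀ p, p.Prime → 0 ≤ g p := fun p hp => mul_nonneg (h0 p hp) (by positivity)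
  set P := (Icc 1 y).filter Nat.Prime with hP
  have hPg : ∀ p ∈ P, 0 ≤ g p := fun p hp => hg0 p (Finset.mem_filter.1 hp).2
  have hstep : ∑ n ∈ Icc 1 y, sqfProd h n * (1 / n) ≤
      Real.exp 1 * ∑ n ∈ (Icc 1 y).filter Squarefree, ∏ p ∈ n.primeFactors, g p := by
    rw [Finset.sum_filter, Finset.mul_sum]
    refine Finset.sum_le_sum fun n hn => ?_
    rw [Finset.mem_Icc] at hn
    rw [sqfProd]
    split_ifs with hsq
    · rw [hg, Finset.prod_mul_distrib]
      have : ∏ p ∈ n.primeFactors, (p : ℝ) ^ (-σ) = (n : ℝ) ^ (-σ) := by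
        rw [Real.finsetProd_rpow _ _ (fun i _ => by positivity), ← Nat.cast_prod,
          Nat.prod_primeFactors_of_squarefree hsq]
      rw [this]
      have := one_div_le_rpow hn.1 hn.2
      have h2 : 0 ≤ ∏ p ∈ n.primeFactors, h p :=
        Finset.prod_nonneg fun p hp => h0 p (Nat.prime_of_mem_primeFactors hp)
      calc _ ≤ (∏ p ∈ n.primeFactors, h p) * (Real.exp 1 * (n : ℝ) ^ (-σ)) := by gcongr
        _ = _ := by ring
    · simp
  refine hstep.trans (mul_le_mul_of_nonneg_left ?_ (Real.exp_pos _).le)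
  calc ∑ n ∈ (Icc 1 y).filter Squarefree, ∏ p ∈ n.primeFactors, g p
      = ∑ S ∈ ((Icc 1 y).filter Squarefree).image Nat.primeFactors, ∏ p ∈ S, g p := by
        rw [Finset.sum_image]
        intro a ha b hb hab
        have ha := (Finset.mem_filter.1 ha).2
        have hb := (Finset.mem_filter.1 hb).2
        rw [← Nat.prod_primeFactors_of_squarefree ha, ← Nat.prod_primeFactors_of_squarefree hb, hab]
    _ ≤ ∑ S ∈ P.powerset, ∏ p ∈ S, g p := by
        apply Finset.sum_le_sum_of_subset_of_nonneg
        · intro S hS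
          obtain ⟨n, hn, rfl⟩ := Finset.mem_image.1 hS
          rw [Finset.mem_filter, Finset.mem_Icc] at hn
          rw [Finset.mem_powerset]
          intro p hp
          rw [hP, Finset.mem_filter, Finset.mem_Icc]
          have := Nat.prime_of_mem_primeFactors hp
          exact ⟨⟨this.one_lt.le, (Nat.le_of_mem_primeFactors hp).trans hn.1.2⟩, this⟩
        · intro S hS _
          exact Finset.prod_nonneg fun p hp => hPg p (Finset.mem_powerset.1 hS hp)
    _ = ∏ p ∈ P, (1 + g p) := (Finset.prod_one_add P).symm
    _ ≤ ∏ p ∈ P, Real.exp (g p) := by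
        refine Finset.prod_le_prod (fun p hp => by linarith [hPg p hp]) fun p _ => ?_
        linarith [Real.add_one_le_exp (g p)]
    _ = Real.exp (∑ p ∈ P, g p) := (Real.exp_sum _ _).symm
    _ ≤ _ := by
        apply Real.exp_le_exp.2
        have hsub : ∑ p ∈ P, g p = ∑ p ∈ P.subtype Nat.Prime, g p := by
          rw [Finset.sum_subtype_of_mem (p := Nat.Prime) g (fun p hp => (Finset.mem_filter.1 hp).2)]
        rw [hsub]
        have key : ∀ s : Finset Nat.Primes, ∑ p ∈ s, g p ≤ ∑' p : Nat.Primes, g p := fun s =>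
          hs.sum_le_tsum s (fun p _ => hg0 p p.2)
        exact key _

theorem sum_sqfProd_le_exp {h : ℕ → ℝ} (h0 : ∀ p, p.Prime → 0 ≤ h p)
    (h1 : ∀ p, p.Prime → h p ≤ 1) (y : ℕ)
    (hs : Summable fun p : Nat.Primes => h p * ((p : ℕ) : ℝ) ^ (-(1 + 1 / (1 + Real.log y)))) :
    (1 + Real.log y) * ∑ n ∈ Icc 1 y, sqfProd h n ≤ 24 * y *
      Real.exp (∑' p : Nat.Primes, h p * ((p : ℕ) : ℝ) ^ (-(1 + 1 / (1 + Real.log y)))) := by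
  refine (sum_sqfProd_le h0 h1 y).trans ?_
  have := sum_sqfProd_div_le h0 y hs
  have he : Real.exp 1 ≤ 3 := by linarith [Real.exp_one_lt_d9]
  calc _ ≤ 8 * (y * (3 * Real.exp (∑' p : Nat.Primes, h p * ((p : ℕ) : ℝ) ^ (-(1 + 1 / (1 + Real.log y)))))) := by
        have := this.trans (mul_le_mul_of_nonneg_right he (Real.exp_pos _).le)
        gcongr
    _ = _ := by ring

theorem one_lt_one_add_one_div (y : ℕ) : (1 : ℝ) < 1 + 1 / (1 + Real.log y) := by
  have := one_le_one_add_log y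
  have : 0 < 1 / (1 + Real.log y) := by positivity
  linarith

theorem summable_primes_rpow_neg (y : ℕ) :
    Summable fun p : Nat.Primes => ((p : ℕ) : ℝ) ^ (-(1 + 1 / (1 + Real.log y))) := by
  simpa using summable_primes_mul_rpow_neg (f := fun _ => 1) (by simp) (one_lt_one_add_one_div y)

theorem exp_tsum_primes_rpow_neg_le (y : ℕ) :
    Real.exp (∑' p : Nat.Primes, ((p : ℕ) : ℝ) ^ (-(1 + 1 / (1 + Real.log y)))) ≤
      2 * (1 + Real.log y) := by
  have hσ := one_lt_one_add_one_div y
  have hL := one_le_one_add_log y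
  have h := exp_tsum_primes_le (f := fun n => if n = 0 then 0 else 1) (by simp) (by simp)
    (by intro m n; by_cases h1 : m = 0 <;> by_cases h2 : n = 0 <;> simp [h1, h2])
    (by intro n; split_ifs <;> simp) hσ
  have e1 : ∀ p : Nat.Primes, (if (p : ℕ) = 0 then (0 : ℝ) else 1) * ((p : ℕ) : ℝ) ^
      (-(1 + 1 / (1 + Real.log y))) = ((p : ℕ) : ℝ) ^ (-(1 + 1 / (1 + Real.log y))) := by
    intro p
    rw [if_neg p.2.ne_zero, one_mul]
  simp only [e1] at h
  refine h.trans ?_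
  have e2 : ∀ n : ℕ, (if n = 0 then (0 : ℝ) else 1) * (n : ℝ) ^
      (-(1 + 1 / (1 + Real.log y))) = (n : ℝ) ^ (-(1 + 1 / (1 + Real.log y))) := by
    intro n
    by_cases h : n = 0
    · rw [if_pos h, h, zero_mul, Nat.cast_zero, Real.zero_rpow (by linarith)]
    · rw [if_neg h, one_mul]
  simp only [e2]
  refine (tsum_rpow_neg_le hσ).trans ?_
  rw [add_sub_cancel_left, one_div_one_div]
  linarith

theorem exp_mul_tsum_primes_le {θ : ℝ} (h0 : 0 ≤ θ) (y : ℕ) :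
    Real.exp (θ * ∑' p : Nat.Primes, ((p : ℕ) : ℝ) ^ (-(1 + 1 / (1 + Real.log y)))) ≤
      (2 * (1 + Real.log y)) ^ θ := by
  rw [mul_comm, Real.exp_mul]
  exact Real.rpow_le_rpow (Real.exp_pos _).le (exp_tsum_primes_rpow_neg_le y) h0

theorem le_of_mul_le_rpow {L S A θ : ℝ} (hL : 1 ≤ L) (h : L * S ≤ A * (2 * L) ^ θ) (hθ : θ ≤ 1)
    (hA : 0 ≤ A) : S ≤ 2 * A * L ^ (θ - 1) := by
  have hL0 : 0 < L := by linarith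
  rw [Real.rpow_sub_one hL0.ne']
  rw [Real.mul_rpow (by norm_num) hL0.le] at h
  have h2 : (2 : ℝ) ^ θ ≤ 2 := by
    calc (2 : ℝ) ^ θ ≤ 2 ^ (1 : ℝ) := Real.rpow_le_rpow_of_exponent_le (by norm_num) hθ
      _ = 2 := by norm_num
  have hp : 0 ≤ L ^ θ := by positivity
  rw [mul_div_assoc', le_div_iff₀ hL0, mul_comm S L]
  refine h.trans ?_
  have : 2 ^ θ * L ^ θ ≤ 2 * L ^ θ := mul_le_mul_of_nonneg_right h2 hp
  nlinarith

theorem sum_sqfProd_const_le {θ : ℝ} (h0 : 0 ≤ θ) (h1 : θ ≤ 1) (y : ℕ) :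
    ∑ n ∈ Icc 1 y, sqfProd (fun _ => θ) n ≤ 48 * y * (1 + Real.log y) ^ (θ - 1) := by
  have hs := summable_primes_rpow_neg y
  have h := sum_sqfProd_le_exp (fun _ _ => h0) (fun _ _ => h1) y (hs.mul_left _)
  rw [tsum_mul_left] at h
  have := le_of_mul_le_rpow (one_le_one_add_log y) (h.trans (mul_le_mul_of_nonneg_left
    (exp_mul_tsum_primes_le h0 y) (by positivity))) h1 (by positivity)
  calc _ ≤ _ := this
    _ = _ := by ring

theorem exists_abs_tsum_chiFour_le : ∃ C : ℝ, 0 ≤ C ∧ ∀ σ : ℝ, 1 < σ →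
    |∑' p : Nat.Primes, chiFour p * ((p : ℕ) : ℝ) ^ (-σ)| ≤ C := by
  refine ⟨4 + ∑' n : ℕ, (n : ℝ) ^ (-2 : ℝ), add_nonneg (by norm_num) (tsum_nonneg fun _ => by positivity), ?_⟩
  intro σ hσ
  have hz : (0 : ℝ) ≤ ∑' n : ℕ, (n : ℝ) ^ (-2 : ℝ) := tsum_nonneg fun _ => by positivity
  have h0 : chiFour 0 = 0 := by simp [chiFour]
  have h1 : chiFour 1 = 1 := by simp [chiFour]
  have hU := exp_tsum_primes_le h0 h1 chiFour_mul abs_chiFour_le hσ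
  have hU2 := tsum_mul_rpow_neg_le_of_periodic (by norm_num) chiFour_periodic
    (by rw [sum_range_chiFour]; simp) abs_chiFour_le hσ
  have hLo := tsum_le_exp_tsum_primes h0 h1 chiFour_mul abs_chiFour_le hσ
  have hLo2 := half_le_tsum_chiFour hσ
  set P := ∑' p : Nat.Primes, chiFour p * ((p : ℕ) : ℝ) ^ (-σ)
  have hl4 : Real.log (4 : ℕ) ≤ 2 := by
    have : Real.log 4 = 2 * Real.log 2 := by
      rw [show (4 : ℝ) = 2 ^ 2 by norm_num, Real.log_pow]; norm_num
    push_cast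
    linarith [Real.log_two_lt_d9]
  rw [abs_le]
  constructor
  · have : Real.log (1 / 2) ≤ P + ∑' n : ℕ, (n : ℝ) ^ (-2 : ℝ) := by
      rw [Real.log_le_iff_le_exp (by norm_num)]
      exact hLo2.trans hLo
    rw [one_div, Real.log_inv] at this
    linarith [Real.log_two_lt_d9]
  · have := Real.add_one_le_exp P
    linarith

theorem abs_add_chiFour_div_le {p : ℕ} : 0 ≤ (2 + chiFour p) / 3 ∧ (2 + chiFour p) / 3 ≤ 1 := by
  have := abs_le.1 (abs_chiFour_le p)
  constructor <;> linarith

theorem exists_sum_sqfProd_chiFour_le : ∃ C : ℝ, 0 ≤ C ∧ ∀ y : ℕ,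
    ∑ n ∈ Icc 1 y, sqfProd (fun p => (2 + chiFour p) / 3) n ≤
      C * y * (1 + Real.log y) ^ (-(1 / 3) : ℝ) := by
  obtain ⟨C, hC, h⟩ := exists_abs_tsum_chiFour_le
  refine ⟨48 * Real.exp C, by positivity, fun y => ?_⟩
  have hσ := one_lt_one_add_one_div y
  have hs := summable_primes_rpow_neg y
  have hs4 := summable_primes_mul_rpow_neg abs_chiFour_le hσ
  have hC' := h _ hσ
  set σ := 1 + 1 / (1 + Real.log y) with hσd
  have e : ∀ p : Nat.Primes, (2 + chiFour p) / 3 * ((p : ℕ) : ℝ) ^ (-σ) =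
      2 / 3 * ((p : ℕ) : ℝ) ^ (-σ) + 1 / 3 * (chiFour p * ((p : ℕ) : ℝ) ^ (-σ)) := fun p => by ring
  have hss : Summable fun p : Nat.Primes => (2 + chiFour p) / 3 * ((p : ℕ) : ℝ) ^ (-σ) := by
    simp_rw [e]
    exact (hs.mul_left _).add (hs4.mul_left _)
  have hmv := sum_sqfProd_le_exp (h := fun p => (2 + chiFour p) / 3)
    (fun p _ => abs_add_chiFour_div_le.1) (fun p _ => abs_add_chiFour_div_le.2) y hss
  rw [← hσd] at hmv
  simp_rw [e] at hmv
  rw [(hs.mul_left _).tsum_add (hs4.mul_left _), tsum_mul_left, tsum_mul_left, Real.exp_add] at hmv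
  have h3 : Real.exp (1 / 3 * ∑' p : Nat.Primes, chiFour p * ((p : ℕ) : ℝ) ^ (-σ)) ≤ Real.exp C := by
    apply Real.exp_le_exp.2
    have := (abs_le.1 hC').2
    linarith
  have h4 := exp_mul_tsum_primes_le (show (0 : ℝ) ≤ 2 / 3 by norm_num) y
  rw [← hσd] at h4
  have := le_of_mul_le_rpow (A := 24 * y * Real.exp C) (θ := 2 / 3) (one_le_one_add_log y)
    (hmv.trans (by
      calc _ ≤ 24 * (y : ℝ) * ((2 * (1 + Real.log y)) ^ (2 / 3 : ℝ) * Real.exp C) := by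
            gcongr
        _ = _ := by ring)) (by norm_num) (by positivity)
  calc _ ≤ _ := this
    _ = _ := by
      rw [show (2 / 3 - 1 : ℝ) = -(1 / 3) by norm_num]; ring

/-- The local factor `1 - (1 + χ₄(p)) (1 - (p / e)) / 18`. -/
def detectFactor (e p : ℕ) : ℝ := 1 - (1 + chiFour p) * (1 - (jacobiSym p e : ℝ)) / 18

theorem detectFactor_nonneg (e p : ℕ) : 0 ≤ detectFactor e p := by
  have h1 := abs_le.1 (abs_chiFour_le p)
  have h2 := abs_le.1 (abs_jacobiSym_le_one p e)
  rw [detectFactor]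
  nlinarith

theorem detectFactor_le_one (e p : ℕ) : detectFactor e p ≤ 1 := by
  have h1 := abs_le.1 (abs_chiFour_le p)
  have h2 := abs_le.1 (abs_jacobiSym_le_one p e)
  rw [detectFactor]
  nlinarith

theorem exists_sum_sqfProd_detectFactor_le : ∃ C : ℝ, 0 ≤ C ∧ ∀ y e : ℕ, 1 < e → Odd e →
    Squarefree e → ∑ n ∈ Icc 1 y, sqfProd (detectFactor e) n ≤
      C * y * (1 + Real.log y) ^ (-(1 / 18) : ℝ) * (4 + Real.log e) := by
  obtain ⟨C, hC, h⟩ := exists_abs_tsum_chiFour_le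
  refine ⟨48 * Real.exp C, by positivity, fun y e he1 heo hes => ?_⟩
  have hσ := one_lt_one_add_one_div y
  have hs := summable_primes_rpow_neg y
  have hs4 := summable_primes_mul_rpow_neg abs_chiFour_le hσ
  have hC' := h _ hσ
  set ψ : ℕ → ℝ := fun n => (jacobiSym n e : ℝ) with hψ
  have hψb : ∀ n, |ψ n| ≤ 1 := fun n => abs_jacobiSym_le_one n e
  have hψ4b : ∀ n, |chiFour n * ψ n| ≤ 1 := fun n => by
    rw [abs_mul]; exact mul_le_one₀ (abs_chiFour_le n) (abs_nonneg _) (hψb n)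
  have hsψ := summable_primes_mul_rpow_neg hψb hσ
  have hsψ4 := summable_primes_mul_rpow_neg hψ4b hσ
  obtain ⟨q, hq, M, rfl⟩ := Nat.exists_prime_and_dvd he1.ne'
  have hq2 : q ≠ 2 := by
    rintro rfl
    exact (Nat.not_odd_iff_even.2 (even_two_mul M)) heo
  have hqM : ¬ q ∣ M := by
    rintro ⟨k, rfl⟩
    have := hes q ⟨k, by ring⟩
    exact hq.one_lt.ne' (Nat.isUnit_iff.1 this)
  have hMo : Odd M := (Nat.odd_mul.1 heo).2
  obtain ⟨a, ha, ha4, hcop⟩ := exists_jacobiSym_eq_neg_one hq hq2 hMo hqM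
  set e := q * M with he
  have he0 : 0 < e := by omega
  have hψ0 : ψ 0 = 0 := by
    have : NeZero e := ⟨he0.ne'⟩
    simp only [hψ, Nat.cast_zero, jacobiSym.zero_left he1, Int.cast_zero]
  have hψ1 : ψ 1 = 1 := by simp [hψ]
  have hψm : ∀ m n, ψ (m * n) = ψ m * ψ n := by
    intro m n
    simp only [hψ, Nat.cast_mul, jacobiSym.mul_left, Int.cast_mul]
  have hψp : Function.Periodic ψ e := jacobiSym_natCast_periodic e
  have hψa : ψ a = -1 := by simp only [hψ]; rw [ha]; norm_num
  have h4a : chiFour a = 1 := by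
    rw [chiFour_eq, if_neg (by omega), if_pos ha4]
  have hψz : ∑ n ∈ range e, ψ n = 0 :=
    sum_range_period_eq_zero he0 hψp hψm hψa hcop.coprime_mul_left_right
  have hψ4m : ∀ m n, chiFour (m * n) * ψ (m * n) = chiFour m * ψ m * (chiFour n * ψ n) := by
    intro m n
    rw [hψm, chiFour_mul]; ring
  have hψ4p : Function.Periodic (fun n => chiFour n * ψ n) (4 * e) := by
    have p1 : Function.Periodic chiFour (4 * e) := by
      have := chiFour_periodic.nat_mul e
      rwa [mul_comm] at this
    exact p1.mul (by simpa using hψp.nat_mul 4)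
  have hψ4z : ∑ n ∈ range (4 * e), chiFour n * ψ n = 0 :=
    sum_range_period_eq_zero (f := fun n => chiFour n * ψ n) (by omega) hψ4p hψ4m
      (by simp only [hψa, h4a]; norm_num) hcop
  have b1 := (exp_tsum_primes_le hψ0 hψ1 hψm hψb hσ).trans
    (tsum_mul_rpow_neg_le_of_periodic he0 hψp hψz hψb hσ)
  have b2 := (exp_tsum_primes_le (f := fun n => chiFour n * ψ n) (by simp [hψ0])
    (by simp [hψ1, chiFour]) hψ4m hψ4b hσ).trans
    (tsum_mul_rpow_neg_le_of_periodic (by omega) hψ4p hψ4z hψ4b hσ)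
  have hl4 : Real.log 4 ≤ 2 := by
    have : Real.log 4 = 2 * Real.log 2 := by
      rw [show (4 : ℝ) = 2 ^ 2 by norm_num, Real.log_pow]; norm_num
    linarith [Real.log_two_lt_d9]
  have her : (0 : ℝ) < e := by exact_mod_cast he0
  have b3 : 2 + Real.log (4 * e : ℕ) ≤ 4 + Real.log e := by
    push_cast
    rw [Real.log_mul (by norm_num) her.ne']; linarith
  replace b2 := b2.trans b3
  have b4 : Real.exp (∑' p : Nat.Primes, ψ p * ((p : ℕ) : ℝ) ^ (-(1 + 1 / (1 + Real.log y)))) ≤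
    4 + Real.log e := by linarith
  set σ := 1 + 1 / (1 + Real.log y) with hσd
  set P1 := ∑' p : Nat.Primes, ((p : ℕ) : ℝ) ^ (-σ) with hP1
  set P4 := ∑' p : Nat.Primes, chiFour p * ((p : ℕ) : ℝ) ^ (-σ) with hP4
  set Pψ := ∑' p : Nat.Primes, ψ p * ((p : ℕ) : ℝ) ^ (-σ) with hPψ
  set Pψ4 := ∑' p : Nat.Primes, chiFour p * ψ p * ((p : ℕ) : ℝ) ^ (-σ) with hPψ4
  have hsum : HasSum (fun p : Nat.Primes => detectFactor e p * ((p : ℕ) : ℝ) ^ (-σ))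
      (17 / 18 * P1 - 1 / 18 * P4 + 1 / 18 * Pψ + 1 / 18 * Pψ4) := by
    have := (((hs.hasSum.mul_left (17 / 18)).sub (hs4.hasSum.mul_left (1 / 18))).add
      (hsψ.hasSum.mul_left (1 / 18))).add (hsψ4.hasSum.mul_left (1 / 18))
    refine this.congr_fun ?_ |> fun h => h
    intro p
    simp only [detectFactor, hψ]
    ring
  have hmv := sum_sqfProd_le_exp (h := detectFactor e)
    (fun p _ => detectFactor_nonneg e p) (fun p _ => detectFactor_le_one e p) y hsum.summable
  rw [← hσd, hsum.tsum_eq] at hmv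
  have hl : 0 ≤ Real.log e := Real.log_natCast_nonneg e
  have hPle : 1 / 18 * Pψ + 1 / 18 * Pψ4 ≤ Real.log (4 + Real.log e) := by
    have c1 : Pψ ≤ Real.log (4 + Real.log e) := (Real.le_log_iff_exp_le (by linarith)).2 b4
    have c2 : Pψ4 ≤ Real.log (4 + Real.log e) := (Real.le_log_iff_exp_le (by linarith)).2 b2
    have c3 : 0 ≤ Real.log (4 + Real.log e) := Real.log_nonneg (by linarith)
    linarith
  have hexp : Real.exp (17 / 18 * P1 - 1 / 18 * P4 + 1 / 18 * Pψ + 1 / 18 * Pψ4) ≤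
      (2 * (1 + Real.log y)) ^ (17 / 18 : ℝ) * (Real.exp C * (4 + Real.log e)) := by
    calc _ ≤ Real.exp (17 / 18 * P1 + (C + Real.log (4 + Real.log e))) := by
          apply Real.exp_le_exp.2
          have := abs_le.1 hC'
          linarith
      _ = Real.exp (17 / 18 * P1) * (Real.exp C * (4 + Real.log e)) := by
          rw [Real.exp_add, Real.exp_add, Real.exp_log (by linarith)]
      _ ≤ _ := by
          have := exp_mul_tsum_primes_le (show (0 : ℝ) ≤ 17 / 18 by norm_num) y
          gcongr
  have := le_of_mul_le_rpow (A := 24 * y * (Real.exp C * (4 + Real.log e))) (θ := 17 / 18)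
    (one_le_one_add_log y)
    (hmv.trans (by
      calc _ ≤ 24 * (y : ℝ) * ((2 * (1 + Real.log y)) ^ (17 / 18 : ℝ) * (Real.exp C * (4 + Real.log e))) := by
            gcongr
        _ = _ := by ring)) (by norm_num) (by positivity)
  calc _ ≤ _ := this
    _ = _ := by
      rw [show (17 / 18 - 1 : ℝ) = -(1 / 18) by norm_num]; ring

theorem mulSingle_apply_of_ne {K : Type*} [DecidableEq K] {u k : K} (h : k ≠ u) (p : ℕ) :
    (Pi.mulSingle u p : K → ℕ) k = 1 :=
  Pi.mulSingle_eq_of_ne (M := fun _ => ℕ) h p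

section Factorizations

variable {K : Type*} [Fintype K] [DecidableEq K]

/-- The factorizations `n = ∏ k, D k` with `D k = 1` for `k` outside `U`. -/
def factTuples (U : Finset K) (n : ℕ) : Finset (K → ℕ) :=
  (Fintype.piFinset fun _ => n.divisors).filter fun D => (∀ k ∉ U, D k = 1) ∧ ∏ k, D k = n

theorem mem_factTuples {U : Finset K} {n : ℕ} (hn : n ≠ 0) {D : K → ℕ} :
    D ∈ factTuples U n ↔ (∀ k ∉ U, D k = 1) ∧ ∏ k, D k = n := by
  rw [factTuples, mem_filter, Fintype.mem_piFinset]
  refine ⟨fun h => h.2, fun h => ⟨fun k => ?_, h⟩⟩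
  rw [Nat.mem_divisors]
  exact ⟨h.2 ▸ Finset.dvd_prod_of_mem D (mem_univ k), hn⟩

theorem prod_mulSingle_mul (u : K) (p : ℕ) (D : K → ℕ) :
    ∏ k, (Pi.mulSingle u p * D : K → ℕ) k = p * ∏ k, D k := by
  simp only [Pi.mul_apply, prod_mul_distrib]
  congr 1
  rw [Fintype.prod_eq_single u (fun k hk => by simp [hk]), Pi.mulSingle_eq_same]

theorem factTuples_one (U : Finset K) : factTuples U 1 = {1} := by
  ext D
  rw [mem_factTuples one_ne_zero, mem_singleton]
  constructor
  · rintro ⟨-, h⟩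
    ext k
    exact Nat.dvd_one.1 (h ▸ Finset.dvd_prod_of_mem D (mem_univ k))
  · rintro rfl
    simp

theorem sum_factTuples_prime_mul {M : Type*} [AddCommMonoid M] (U : Finset K) {p n : ℕ}
    (hp : p.Prime) (hpn : ¬ p ∣ n) (F : (K → ℕ) → M) :
    ∑ D ∈ factTuples U (p * n), F D =
      ∑ u ∈ U, ∑ D ∈ factTuples U n, F (Pi.mulSingle u p * D) := by
  have hn : n ≠ 0 := by rintro rfl; exact hpn (dvd_zero p)
  have hpn0 : p * n ≠ 0 := mul_ne_zero hp.ne_zero hn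
  have hinj : ∀ u : K, Function.Injective fun D : K → ℕ => (Pi.mulSingle u p * D : K → ℕ) := by
    intro u D D' h
    ext k
    have := congrFun h k
    simp only [Pi.mul_apply] at this
    rcases eq_or_ne k u with rfl | hk
    · simpa [Pi.mulSingle_eq_same, hp.ne_zero] using this
    · simpa [Pi.mulSingle_eq_of_ne hk] using this
  have hset : factTuples U (p * n) =
      U.biUnion fun u => (factTuples U n).image fun D => (Pi.mulSingle u p * D : K → ℕ) := by
    ext D
    simp only [mem_biUnion, mem_image, mem_factTuples hn, mem_factTuples hpn0]
    constructor
    · rintro ⟨h1, h2⟩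
      obtain ⟨u, -, hu⟩ := (hp.prime.dvd_finsetProd_iff D).1 (h2 ▸ Dvd.intro n rfl : p ∣ ∏ k, D k)
      obtain ⟨m, hm⟩ := hu
      have huU : u ∈ U := by
        by_contra h
        rw [h1 u h] at hm
        exact hp.one_lt.ne' (Nat.eq_one_of_mul_eq_one_right hm.symm)
      have hD : (Pi.mulSingle u p * Function.update D u m : K → ℕ) = D := by
        ext k
        rcases eq_or_ne k u with rfl | hk
        · simp [hm]
        · simp [hk]
      refine ⟨u, huU, Function.update D u m, ⟨fun k hk => ?_, ?_⟩, hD⟩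
      · have : k ≠ u := by rintro rfl; exact hk huU
        simp [this, h1 k hk]
      · have := prod_mulSingle_mul u p (Function.update D u m)
        rw [hD, h2] at this
        exact (Nat.eq_of_mul_eq_mul_left hp.pos this).symm
    · rintro ⟨u, hu, D', ⟨h1, h2⟩, rfl⟩
      refine ⟨fun k hk => ?_, by rw [prod_mulSingle_mul, h2]⟩
      have : k ≠ u := by rintro rfl; exact hk hu
      simp [this, h1 k hk]
  rw [hset, sum_biUnion]
  · refine sum_congr rfl fun u _ => ?_
    rw [sum_image fun a _ b _ h => hinj u h]
  · intro u _ v _ huv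
    rw [Function.onFun, Finset.disjoint_left]
    intro D hD hD'
    simp only [mem_image, mem_factTuples hn] at hD hD'
    obtain ⟨E, ⟨-, hE⟩, rfl⟩ := hD
    obtain ⟨E', ⟨-, hE'⟩, h⟩ := hD'
    have := congrFun h v
    simp [huv.symm] at this
    apply hpn
    rw [← hE]
    exact (Dvd.intro _ this).trans (Finset.dvd_prod_of_mem E (mem_univ v))

end Factorizations

theorem squarefree_induction {P : ℕ → Prop} (h1 : P 1)
    (hmul : ∀ p n, p.Prime → ¬ p ∣ n → Squarefree n → P n → P (p * n)) :
    ∀ n, Squarefree n → P n := by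
  intro n
  induction n using Nat.strong_induction_on with
  | _ n ih =>
    intro hn
    rcases eq_or_ne n 1 with rfl | hn1
    · exact h1
    · obtain ⟨m, hm⟩ := Nat.minFac_dvd n
      have hp := Nat.minFac_prime hn1
      have hsq : Squarefree (n.minFac * m) := hm ▸ hn
      have hm0 : m ≠ 0 := by rintro rfl; rw [mul_zero] at hm; exact hn.ne_zero hm
      have hmsq : Squarefree m := hsq.of_mul_right
      rw [hm]
      refine hmul _ m hp ?_ hmsq (ih m ?_ hmsq)
      · have := Nat.coprime_of_squarefree_mul hsq
        exact (Nat.Prime.coprime_iff_not_dvd hp).1 this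
      · rw [hm]
        nlinarith [hp.two_le, Nat.pos_of_ne_zero hm0, hm]

theorem prod_primeFactors_prime_mul {M : Type*} [CommMonoid M] {p n : ℕ} (hp : p.Prime)
    (hpn : ¬ p ∣ n) (f : ℕ → M) :
    ∏ q ∈ (p * n).primeFactors, f q = f p * ∏ q ∈ n.primeFactors, f q := by
  have hn : n ≠ 0 := by rintro rfl; exact hpn (dvd_zero p)
  rw [Nat.primeFactors_mul hp.ne_zero hn, hp.primeFactors, singleton_union, prod_insert]
  exact fun h => hpn (Nat.dvd_of_mem_primeFactors h)

theorem card_primeFactors_prime_mul {p n : ℕ} (hp : p.Prime) (hpn : ¬ p ∣ n) :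
    (p * n).primeFactors.card = n.primeFactors.card + 1 := by
  have hn : n ≠ 0 := by rintro rfl; exact hpn (dvd_zero p)
  rw [Nat.primeFactors_mul hp.ne_zero hn, hp.primeFactors, singleton_union, card_insert_of_notMem]
  exact fun h => hpn (Nat.dvd_of_mem_primeFactors h)

section Factorizations

variable {K L : Type*} [Fintype K] [DecidableEq K] [Fintype L] [DecidableEq L]

theorem sum_factTuples_prod {U : Finset K} (f : K → ℕ → ℝ) (h1 : ∀ k, f k 1 = 1)
    (hmul : ∀ k m n, f k (m * n) = f k m * f k n) :
    ∀ n, Squarefree n → ∑ D ∈ factTuples U n, ∏ k, f k (D k) =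
      ∏ p ∈ n.primeFactors, ∑ u ∈ U, f u p := by
  apply squarefree_induction
  · simp [factTuples_one, h1]
  · intro p n hp hpn hn ih
    rw [sum_factTuples_prime_mul U hp hpn, prod_primeFactors_prime_mul hp hpn, ← ih, sum_mul]
    refine sum_congr rfl fun u _ => ?_
    rw [mul_sum]
    refine sum_congr rfl fun D _ => ?_
    simp only [Pi.mul_apply, hmul, prod_mul_distrib]
    congr 1
    rw [Fintype.prod_eq_single u, Pi.mulSingle_eq_same]
    intro k hk
    rw [Pi.mulSingle_eq_of_ne hk, h1]

theorem card_factTuples (U : Finset K) {n : ℕ} (hn : Squarefree n) :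
    (factTuples U n).card = U.card ^ n.primeFactors.card := by
  have := sum_factTuples_prod (U := U) (fun _ _ => 1) (fun _ => rfl) (by simp) n hn
  simp at this
  exact_mod_cast this

/-- Pairs of factorizations of a squarefree `n` correspond to their common refinements. -/
theorem sum_factTuples_mul_sum {M : Type*} [AddCommMonoid M] (U : Finset K) (V : Finset L) :
    ∀ n, Squarefree n → ∀ F : (K → ℕ) → (L → ℕ) → M,
      ∑ D ∈ factTuples U n, ∑ D' ∈ factTuples V n, F D D' =
        ∑ E ∈ factTuples (U ×ˢ V) n, F (fun k => ∏ l, E (k, l)) (fun l => ∏ k, E (k, l)) := by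
  apply squarefree_induction
  · intro F
    simp only [factTuples_one, sum_singleton]
    congr 1 <;> (ext; simp)
  · intro p n hp hpn hn ih F
    rw [sum_factTuples_prime_mul _ hp hpn, sum_factTuples_prime_mul _ hp hpn, sum_product]
    refine sum_congr rfl fun u _ => ?_
    simp only [sum_factTuples_prime_mul _ hp hpn]
    rw [sum_comm]
    refine sum_congr rfl fun v _ => ?_
    rw [ih fun D D' => F ((Pi.mulSingle u p : K → ℕ) * D) ((Pi.mulSingle v p : L → ℕ) * D')]
    refine sum_congr rfl fun E _ => ?_
    congr 1
    · ext k
      simp only [Pi.mul_apply, prod_mul_distrib]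
      congr 1
      rcases eq_or_ne k u with rfl | hk
      · rw [Fintype.prod_eq_single v]
        · simp
        · intro l hl
          exact mulSingle_apply_of_ne (by simp [hl]) p
      · rw [Pi.mulSingle_eq_of_ne hk]
        exact (prod_eq_one fun l _ => mulSingle_apply_of_ne (by simp [hk]) p).symm
    · ext l
      simp only [Pi.mul_apply, prod_mul_distrib]
      congr 1
      rcases eq_or_ne l v with rfl | hl
      · rw [Fintype.prod_eq_single u]
        · simp
        · intro k hk
          exact mulSingle_apply_of_ne (by simp [hk]) p
      · rw [Pi.mulSingle_eq_of_ne hl]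
        exact (prod_eq_one fun k _ => mulSingle_apply_of_ne (by simp [hl]) p).symm

end Factorizations

/-- The product of all the symbols `(D k / D l)` over the pairs selected by `Φ`. -/
def symProd {K : Type*} [Fintype K] (Φ : K → K → Bool) (D : K → ℕ) : ℝ :=
  ∏ k, ∏ l, if Φ k l then (jacobiSym (D k) (D l) : ℝ) else 1

/-- The pairs of classes whose symbols occur in the expansion of `ftilde`: a class `(i, b)`
collects the primes dividing `dᵢ`, with `b` recording whether the prime was selected in the
expansion of `∏ (1 + ·)`. -/
def classRel (u v : Fin 3 × Bool) : Bool := u.2 && decide (u.1 ≠ v.1)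

/-- The integer `± n` that is `1` modulo `4`, for odd `n`. -/
def discOf (n : ℕ) : ℤ := if n % 4 = 1 then n else -n

theorem natAbs_discOf (n : ℕ) : (discOf n).natAbs = n := by
  unfold discOf; split_ifs <;> simp

theorem discOf_mod {n : ℕ} (hn : Odd n) : discOf n % 4 = 1 := by
  rw [Nat.odd_iff] at hn
  unfold discOf; split_ifs <;> omega

theorem discOf_natAbs {m : ℤ} (hm : m % 4 = 1) : discOf m.natAbs = m := by
  unfold discOf; split_ifs <;> omega

theorem isFundDisc_discOf {n : ℕ} (hn : Odd n) (hs : Squarefree n) : IsFundDisc (discOf n) := by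
  refine Or.inl ⟨discOf_mod hn, ?_⟩
  rw [← Int.squarefree_natAbs, natAbs_discOf]
  exact hs

theorem IsFundDisc.of_odd {m : ℤ} (h : IsFundDisc m) (hm : Odd m) : m % 4 = 1 ∧ Squarefree m := by
  rcases h with h | ⟨k, hk, -⟩
  · exact h
  · exfalso
    rw [Int.odd_iff] at hm
    omega

theorem mul_mod_four_eq_one {a b : ℤ} (ha : a % 4 = 1) (hb : b % 4 = 1) : a * b % 4 = 1 := by
  rw [Int.mul_emod, ha, hb]; rfl

theorem kron_eq_jacobiSym {m : ℤ} (hm : m % 4 = 1) {p : ℕ} (hp : Odd p) :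
    kron m p = jacobiSym p m.natAbs := by
  have h2 : p ≠ 2 := by rintro rfl; exact absurd hp (by decide)
  have hmo : Odd m.natAbs := by rw [Nat.odd_iff]; omega
  rw [kron, if_neg h2]
  rcases Int.natAbs_eq m with h | h
  · have h1 : m.natAbs % 4 = 1 := by omega
    conv_lhs => rw [h]
    exact (jacobiSym.quadratic_reciprocity_one_mod_four h1 hp)
  · have h3 : m.natAbs % 4 = 3 := by omega
    conv_lhs => rw [h, jacobiSym.neg _ hp]
    rcases Nat.odd_mod_four_iff.1 (Nat.odd_iff.1 hp) with h1 | h1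
    · rw [ZMod.χ₄_nat_one_mod_four h1, one_mul]
      exact (jacobiSym.quadratic_reciprocity_one_mod_four h1 hmo).symm
    · rw [ZMod.χ₄_nat_three_mod_four h1, jacobiSym.quadratic_reciprocity_three_mod_four h3 h1]
      ring

/-- The product of the local factors of an ordered factorization into three parts. -/
def partTerm (D : Fin 3 → ℕ) : ℝ :=
  (∏ p ∈ (D 2).primeFactors, (1 + (jacobiSym p (D 0 * D 1) : ℝ))) *
    (∏ p ∈ (D 1).primeFactors, (1 + (jacobiSym p (D 0 * D 2) : ℝ))) *
    (∏ p ∈ (D 0).primeFactors, (1 + (jacobiSym p (D 1 * D 2) : ℝ)))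

theorem tripleTerm_eq {a b c : ℤ} (ha : a % 4 = 1) (hb : b % 4 = 1) (hc : c % 4 = 1) :
    (tripleTerm (a, b, c) : ℝ) = partTerm ![a.natAbs, b.natAbs, c.natAbs] := by
  have key : ∀ x y : ℤ, x % 4 = 1 → y % 4 = 1 →
      ∀ p ∈ x.natAbs.primeFactors, kron y p = jacobiSym p y.natAbs := by
    intro x y hx hy p hp
    refine kron_eq_jacobiSym hy ?_
    have : Odd x.natAbs := by rw [Nat.odd_iff]; omega
    exact this.of_dvd_nat (Nat.dvd_of_mem_primeFactors hp)
  simp only [tripleTerm, partTerm]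
  push_cast
  congr 1
  · congr 1
    · refine prod_congr rfl fun p hp => ?_
      rw [key c (a * b) hc (mul_mod_four_eq_one ha hb) p hp, Int.natAbs_mul]
    · refine prod_congr rfl fun p hp => ?_
      rw [key b (a * c) hb (mul_mod_four_eq_one ha hc) p hp, Int.natAbs_mul]
  · refine prod_congr rfl fun p hp => ?_
    rw [key a (b * c) ha (mul_mod_four_eq_one hb hc) p hp, Int.natAbs_mul]

/-- All the parts of the factorization `D` are nontrivial. -/
def NoUnitPart {K : Type*} (D : K → ℕ) : Prop := ∀ k, D k ≠ 1

theorem sum_fdTriples_eq {d : ℕ} (hd : Squarefree d) (h4 : d % 4 = 1) :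
    ∑ t ∈ fdTriples d, (tripleTerm t : ℝ) =
      ∑ D ∈ (factTuples (univ : Finset (Fin 3)) d).filter NoUnitPart, partTerm D := by
  have hd0 : d ≠ 0 := hd.ne_zero
  have hodd : Odd (d : ℤ) := by rw [Int.odd_iff]; omega
  have hmem : ∀ t ∈ fdTriples d, (t.1 % 4 = 1 ∧ t.2.1 % 4 = 1 ∧ t.2.2 % 4 = 1) ∧
      (t.1 ≠ 1 ∧ t.2.1 ≠ 1 ∧ t.2.2 ≠ 1) ∧ t.1 * t.2.1 * t.2.2 = d := by
    rintro ⟨a, b, c⟩ ht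
    simp only [fdTriples, mem_filter] at ht
    obtain ⟨-, ha, hb, hc, ha1, hb1, hc1, -, -, -, h⟩ := ht
    have o : Odd (a * b * c) := h ▸ hodd
    rw [Int.odd_mul, Int.odd_mul] at o
    exact ⟨⟨(ha.of_odd o.1.1).1, (hb.of_odd o.1.2).1, (hc.of_odd o.2).1⟩, ⟨ha1, hb1, hc1⟩, h⟩
  refine sum_bij' (fun t _ => ![t.1.natAbs, t.2.1.natAbs, t.2.2.natAbs])
    (fun D _ => (discOf (D 0), discOf (D 1), discOf (D 2))) ?_ ?_ ?_ ?_ ?_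
  · intro t ht
    obtain ⟨⟨ha, hb, hc⟩, ⟨ha1, hb1, hc1⟩, h⟩ := hmem t ht
    rw [mem_filter, mem_factTuples hd0]
    refine ⟨⟨by simp, ?_⟩, ?_⟩
    · rw [Fin.prod_univ_three]
      have := congrArg Int.natAbs h
      rw [Int.natAbs_mul, Int.natAbs_mul, Int.natAbs_natCast] at this
      simpa using this
    · intro i
      fin_cases i <;> simp <;> omega
  · intro D hD
    rw [mem_filter, mem_factTuples hd0, Fin.prod_univ_three] at hD
    obtain ⟨⟨-, h⟩, h1⟩ := hD
    have hsq : Squarefree (D 0 * D 1 * D 2) := h ▸ hd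
    have hoddn : Odd (D 0 * D 1 * D 2) := by rw [h, Nat.odd_iff]; omega
    rw [Nat.odd_mul, Nat.odd_mul] at hoddn
    obtain ⟨⟨o0, o1⟩, o2⟩ := hoddn
    have c2 := Nat.coprime_of_squarefree_mul hsq
    have hsq01 := hsq.of_mul_left
    have c01 := Nat.coprime_of_squarefree_mul hsq01
    rw [Nat.coprime_mul_iff_left] at c2
    have hle : ∀ i, D i ∣ d := by
      intro i
      rw [← h, ← Fin.prod_univ_three]
      exact Finset.dvd_prod_of_mem D (mem_univ i)
    have hbox : ∀ i, -((d : ℤ).natAbs : ℤ) ≤ discOf (D i) ∧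
        discOf (D i) ≤ ((d : ℤ).natAbs : ℤ) := by
      intro i
      have h1 := Nat.le_of_dvd (Nat.pos_of_ne_zero hd0) (hle i)
      have h2 := natAbs_discOf (D i)
      omega
    have hne : ∀ i, Odd (D i) → discOf (D i) ≠ 1 := by
      intro i _ h
      have := natAbs_discOf (D i)
      rw [h] at this
      exact h1 i this.symm
    have hcop : ∀ i j, (D i).Coprime (D j) → IsCoprime (discOf (D i)) (discOf (D j)) := by
      intro i j hij
      rw [Int.isCoprime_iff_gcd_eq_one, Int.gcd, natAbs_discOf, natAbs_discOf]
      exact hij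
    simp only [fdTriples, mem_filter, mem_product, mem_Icc]
    refine ⟨⟨hbox 0, hbox 1, hbox 2⟩, isFundDisc_discOf o0 hsq01.of_mul_left,
      isFundDisc_discOf o1 hsq01.of_mul_right, isFundDisc_discOf o2 hsq.of_mul_right,
      hne 0 o0, hne 1 o1, hne 2 o2, hcop 0 1 c01, hcop 0 2 c2.1, hcop 1 2 c2.2, ?_⟩
    have hm : discOf (D 0) * discOf (D 1) * discOf (D 2) % 4 = 1 :=
      mul_mod_four_eq_one (mul_mod_four_eq_one (discOf_mod o0) (discOf_mod o1)) (discOf_mod o2)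
    have hab : (discOf (D 0) * discOf (D 1) * discOf (D 2)).natAbs = d := by
      rw [Int.natAbs_mul, Int.natAbs_mul, natAbs_discOf, natAbs_discOf, natAbs_discOf, h]
    rw [← discOf_natAbs hm, hab, discOf, if_pos h4]
  · rintro ⟨a, b, c⟩ ht
    obtain ⟨⟨ha, hb, hc⟩, -, -⟩ := hmem _ ht
    simp only [Matrix.cons_val]
    rw [discOf_natAbs ha, discOf_natAbs hb, discOf_natAbs hc]
  · intro D _
    ext i
    fin_cases i <;> simp [natAbs_discOf]
  · rintro ⟨a, b, c⟩ ht
    obtain ⟨⟨ha, hb, hc⟩, -, -⟩ := hmem _ ht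
    exact tripleTerm_eq ha hb hc

/-- Factorizations of the parts of a factorization are factorizations indexed by a product. -/
theorem sum_factTuples_refine {K : Type*} [Fintype K] [DecidableEq K] {n : ℕ} (hn : n ≠ 0)
    (F : (K × Bool → ℕ) → ℝ) (P : (K → ℕ) → Prop) :
    ∑ D ∈ (factTuples (univ : Finset K) n).filter P,
      ∑ B ∈ Fintype.piFinset (fun k => factTuples (univ : Finset Bool) (D k)), F (fun u => B u.1 u.2) =
      ∑ E ∈ (factTuples (univ : Finset (K × Bool)) n).filter
        (fun E => P fun k => ∏ b, E (k, b)), F E := by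
  rw [sum_sigma']
  refine sum_bij' (fun t _ u => t.2 u.1 u.2)
    (fun E _ => ⟨fun k => ∏ b, E (k, b), fun k b => E (k, b)⟩) ?_ ?_ ?_ ?_ ?_
  · rintro ⟨D, B⟩ h
    simp only [mem_sigma, mem_filter, Fintype.mem_piFinset, mem_factTuples hn] at h
    obtain ⟨⟨⟨-, h1⟩, h2⟩, h3⟩ := h
    have hD : ∀ k, ∏ b, B k b = D k := fun k => by
      have : D k ≠ 0 := fun h => hn (by rw [← h1]; exact prod_eq_zero (mem_univ k) h)
      exact ((mem_factTuples this).1 (h3 k)).2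
    rw [mem_filter, mem_factTuples hn]
    refine ⟨⟨by simp, ?_⟩, ?_⟩
    · rw [Fintype.prod_prod_type]
      simp only [hD, h1]
    · simpa only [hD] using h2
  · intro E h
    simp only [mem_filter, mem_factTuples hn] at h
    obtain ⟨⟨-, h1⟩, h2⟩ := h
    rw [Fintype.prod_prod_type] at h1
    simp only [mem_sigma, mem_filter, Fintype.mem_piFinset, mem_factTuples hn]
    refine ⟨⟨⟨by simp, h1⟩, h2⟩, fun k => ?_⟩
    have : ∏ b, E (k, b) ≠ 0 := fun h => hn (by rw [← h1]; exact prod_eq_zero (mem_univ k) h)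
    rw [mem_factTuples this]
    exact ⟨by simp, rfl⟩
  · rintro ⟨D, B⟩ h
    simp only [mem_sigma, mem_filter, Fintype.mem_piFinset, mem_factTuples hn] at h
    obtain ⟨⟨⟨-, h1⟩, h2⟩, h3⟩ := h
    have hD : ∀ k, ∏ b, B k b = D k := fun k => by
      have : D k ≠ 0 := fun h => hn (by rw [← h1]; exact prod_eq_zero (mem_univ k) h)
      exact ((mem_factTuples this).1 (h3 k)).2
    simp only [hD]
  · intro E _
    rfl
  · intro t _
    rfl

theorem prod_one_add_jacobiSym {n : ℕ} (hn : Squarefree n) (m : ℕ) :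
    ∏ p ∈ n.primeFactors, (1 + (jacobiSym p m : ℝ)) =
      ∑ B ∈ factTuples (univ : Finset Bool) n, (jacobiSym (B true) m : ℝ) := by
  have := sum_factTuples_prod (U := (univ : Finset Bool))
    (fun b x => if b then (jacobiSym x m : ℝ) else 1) (by intro k; simp [jacobiSym.one_left])
    (by
      intro k a b
      split_ifs
      · push_cast
        rw [jacobiSym.mul_left]
        push_cast
        rfl
      · simp) n hn
  simp only [Fintype.sum_bool, Fintype.prod_bool, if_true, Bool.false_eq_true, if_false,
    mul_one] at this
  rw [this]
  exact prod_congr rfl fun p _ => add_comm _ _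

theorem partTerm_eq {D : Fin 3 → ℕ} (hD : Squarefree (∏ i, D i)) :
    partTerm D = ∑ B ∈ Fintype.piFinset (fun i => factTuples (univ : Finset Bool) (D i)),
      symProd classRel (fun u : Fin 3 × Bool => B u.1 u.2) := by
  have hs : ∀ i, Squarefree (D i) := fun i =>
    hD.squarefree_of_dvd (Finset.dvd_prod_of_mem D (mem_univ i))
  have h := prod_univ_sum (fun i : Fin 3 => factTuples (univ : Finset Bool) (D i))
    (fun i B => (jacobiSym (B true) (![D 1 * D 2, D 0 * D 2, D 0 * D 1] i) : ℝ))
  simp only [← prod_one_add_jacobiSym (hs _)] at h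
  rw [Fin.prod_univ_three] at h
  have h' : partTerm D = (∏ p ∈ (D 0).primeFactors,
      (1 + (jacobiSym p (![D 1 * D 2, D 0 * D 2, D 0 * D 1] 0) : ℝ))) *
    (∏ p ∈ (D 1).primeFactors, (1 + (jacobiSym p (![D 1 * D 2, D 0 * D 2, D 0 * D 1] 1) : ℝ))) *
    (∏ p ∈ (D 2).primeFactors, (1 + (jacobiSym p (![D 1 * D 2, D 0 * D 2, D 0 * D 1] 2) : ℝ))) := by
    simp only [partTerm, Matrix.cons_val]
    ring
  rw [h', h]
  refine sum_congr rfl fun B hB => ?_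
  have hne : ∀ i, D i ≠ 0 := fun i => (hs i).ne_zero
  have hB' : ∀ i, D i = B i true * B i false := fun i => by
    have := ((mem_factTuples (hne i)).1 (Fintype.mem_piFinset.1 hB i)).2
    rw [← this, Fintype.prod_bool]
  have hb : ∀ i b, NeZero (B i b) := fun i b => ⟨fun h0 => hne i (by
    rw [hB' i]; cases b <;> simp [h0])⟩
  simp only [Fin.prod_univ_three, symProd, Fintype.prod_prod_type, Fintype.prod_bool, classRel,
    Matrix.cons_val, hB']
  have hjm : ∀ (a : ℤ) (i j : Fin 3) (b c : Bool) , jacobiSym a (B i b * B j c) =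
    jacobiSym a (B i b) * jacobiSym a (B j c) := fun a i j b c => by
      have := hb i b; have := hb j c
      exact jacobiSym.mul_right a _ _
  have hjm' : ∀ (a : ℤ) (i j : Fin 3), jacobiSym a (B i true * B i false * (B j true * B j false)) =
    jacobiSym a (B i true) * jacobiSym a (B i false) * (jacobiSym a (B j true) *
      jacobiSym a (B j false)) := fun a i j => by
      have := hb i true; have := hb j true; have := hb i false; have := hb j false
      rw [jacobiSym.mul_right, hjm, hjm]
  simp only [hjm']
  push_cast
  simp

/-- The expansion of the sum defining `ftilde` into products of Jacobi symbols. -/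
theorem sum_fdTriples_eq_symProd {d : ℕ} (hd : Squarefree d) (h4 : d % 4 = 1) :
    ∑ t ∈ fdTriples d, (tripleTerm t : ℝ) =
      ∑ E ∈ (factTuples (univ : Finset (Fin 3 × Bool)) d).filter
        (fun E => NoUnitPart fun i => ∏ b, E (i, b)), symProd classRel E := by
  rw [sum_fdTriples_eq hd h4]
  refine Eq.trans ?_ (sum_factTuples_refine hd.ne_zero (symProd classRel) NoUnitPart)
  refine sum_congr rfl fun D hD => partTerm_eq ?_
  rw [((mem_factTuples hd.ne_zero).1 (mem_filter.1 hD).1).2]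
  exact hd

theorem abs_symProd_le_one {K : Type*} [Fintype K] (Φ : K → K → Bool) (D : K → ℕ) :
    |symProd Φ D| ≤ 1 := by
  rw [symProd, abs_prod]
  refine prod_le_one (fun _ _ => abs_nonneg _) fun k _ => ?_
  rw [abs_prod]
  refine prod_le_one (fun _ _ => abs_nonneg _) fun l _ => ?_
  split_ifs
  · exact abs_jacobiSym_le_one _ _
  · simp

theorem chiFour_eq_sgnFour {n : ℕ} (hn : Odd n) : chiFour n = sgnFour n := by
  rw [Nat.odd_iff] at hn
  rw [chiFour_eq, sgnFour, if_neg (by omega)]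

theorem jacobiSym_mul_swap {m n : ℕ} (hm : Odd m) (hn : Odd n) (h : m.Coprime n) :
    (jacobiSym m n : ℝ) * jacobiSym n m =
      (1 + chiFour m + chiFour n - chiFour m * chiFour n) / 2 := by
  rw [jacobiSym_reciprocity hm hn, chiFour_eq_sgnFour hm, chiFour_eq_sgnFour hn]
  have : (jacobiSym n m : ℝ) * jacobiSym n m = 1 := by
    have := jacobiSym.sq_one (a := n) (b := m) (by
      rw [Int.gcd_natCast_natCast]; exact h.symm)
    rw [← sq]
    exact_mod_cast this
  rw [mul_assoc, this, mul_one]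

/-- The classes whose second coordinate is `b`. -/
def classHalf (b : Bool) : Finset (Fin 3 × Bool) := univ.filter fun u => u.2 = b

theorem mem_classHalf {b : Bool} {u : Fin 3 × Bool} : u ∈ classHalf b ↔ u.2 = b := by
  simp [classHalf]

theorem card_classHalf (b : Bool) : (classHalf b).card = 3 := by
  cases b <;> decide +kernel

theorem card_classHalf_erase (i : Fin 3) (b : Bool) : ((classHalf b).erase (i, b)).card = 2 := by
  have : (i, b) ∈ classHalf b := mem_classHalf.2 rfl
  rw [card_erase_of_mem this, card_classHalf]

/-- The factorization has three nontrivial parts and uses both kinds of classes. -/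
def MixedTuple (E : Fin 3 × Bool → ℕ) : Prop :=
  NoUnitPart (fun i => ∏ b, E (i, b)) ∧ ∀ b, ∃ u, u.2 = b ∧ E u ≠ 1

theorem abs_sum_half_sub_le {d : ℕ} (hd : Squarefree d) (b : Bool) :
    |(∑ E ∈ (factTuples (classHalf b) d).filter (fun E => NoUnitPart fun i => ∏ b, E (i, b)),
        symProd classRel E) - ∑ E ∈ factTuples (classHalf b) d, symProd classRel E| ≤
      3 * 2 ^ d.primeFactors.card := by
  rw [← sum_filter_add_sum_filter_not (factTuples (classHalf b) d)
    (fun E => NoUnitPart fun i => ∏ b, E (i, b)), sub_add_cancel_left, abs_neg]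
  refine (abs_sum_le_sum_abs _ _).trans ((sum_le_card_nsmul _ _ 1 fun E _ =>
    abs_symProd_le_one _ _).trans ?_)
  rw [nsmul_eq_mul, mul_one]
  have hsub : (factTuples (classHalf b) d).filter (fun E => ¬ NoUnitPart fun i => ∏ b, E (i, b)) ⊆
      (univ : Finset (Fin 3)).biUnion fun i => factTuples ((classHalf b).erase (i, b)) d := by
    intro E hE
    rw [mem_filter, mem_factTuples hd.ne_zero, NoUnitPart] at hE
    obtain ⟨⟨h1, h2⟩, h3⟩ := hE
    push Not at h3
    obtain ⟨i, hi⟩ := h3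
    rw [mem_biUnion]
    refine ⟨i, mem_univ i, (mem_factTuples hd.ne_zero).2 ⟨fun k hk => ?_, h2⟩⟩
    rw [mem_erase, not_and_or, not_not] at hk
    rcases hk with rfl | hk
    · exact Nat.dvd_one.1 (hi ▸ Finset.dvd_prod_of_mem (fun b => E (i, b)) (mem_univ b))
    · exact h1 k hk
  have := (card_le_card hsub).trans card_biUnion_le
  have hc : ∀ i : Fin 3, (factTuples ((classHalf b).erase (i, b)) d).card =
      2 ^ d.primeFactors.card := by
    intro i
    rw [card_factTuples _ hd, card_classHalf_erase]
  simp only [hc, sum_const, card_univ, Fintype.card_fin, smul_eq_mul] at this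
  exact_mod_cast this

theorem sum_half_false {d : ℕ} (hd : Squarefree d) :
    ∑ E ∈ factTuples (classHalf false) d, symProd classRel E = 3 ^ d.primeFactors.card := by
  have : ∀ E ∈ factTuples (classHalf false) d, symProd classRel E = 1 := by
    intro E hE
    have h1 := ((mem_factTuples hd.ne_zero).1 hE).1
    refine prod_eq_one fun u _ => prod_eq_one fun v _ => ?_
    by_cases h : u ∈ classHalf false
    · rw [mem_classHalf] at h
      simp [classRel, h]
    · rw [h1 u h]
      simp [jacobiSym.one_left]
  rw [sum_congr rfl this, sum_const, card_factTuples _ hd, card_classHalf]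
  simp

theorem symProd_half_true {d : ℕ} (hd : Squarefree d) (h4 : d % 4 = 1) {E : Fin 3 × Bool → ℕ}
    (hE : E ∈ factTuples (classHalf true) d) :
    symProd classRel E = ((∑ i, chiFour (E (i, true))) - 1) / 2 := by
  obtain ⟨h1, h2⟩ := (mem_factTuples hd.ne_zero).1 hE
  have hf : ∀ i, E (i, false) = 1 := fun i => h1 _ (by simp [mem_classHalf])
  simp only [Fintype.prod_prod_type, Fintype.prod_bool, hf, mul_one, Fin.prod_univ_three] at h2
  have hsq : Squarefree (E (0, true) * E (1, true) * E (2, true)) := h2 ▸ hd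
  have hoddn : Odd (E (0, true) * E (1, true) * E (2, true)) := by rw [h2, Nat.odd_iff]; omega
  have hchi : chiFour (E (0, true) * E (1, true) * E (2, true)) = 1 := by
    rw [h2, chiFour_eq, if_neg (by omega), if_pos h4]
  rw [Nat.odd_mul, Nat.odd_mul] at hoddn
  obtain ⟨⟨o0, o1⟩, o2⟩ := hoddn
  have c2 := Nat.coprime_of_squarefree_mul hsq
  have c01 := Nat.coprime_of_squarefree_mul hsq.of_mul_left
  rw [Nat.coprime_mul_iff_left] at c2
  have r01 := jacobiSym_mul_swap o0 o1 c01
  have r02 := jacobiSym_mul_swap o0 o2 c2.1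
  have r12 := jacobiSym_mul_swap o1 o2 c2.2
  have hG : symProd classRel E =
      ((jacobiSym (E (0, true)) (E (1, true)) : ℝ) * jacobiSym (E (1, true)) (E (0, true))) *
      ((jacobiSym (E (0, true)) (E (2, true)) : ℝ) * jacobiSym (E (2, true)) (E (0, true))) *
      ((jacobiSym (E (1, true)) (E (2, true)) : ℝ) * jacobiSym (E (2, true)) (E (1, true))) := by
    simp [symProd, Fintype.prod_prod_type, Fin.prod_univ_three, classRel, hf,
      jacobiSym.one_right]
    ring
  rw [hG, r01, r02, r12, Fin.sum_univ_three]
  rw [chiFour_mul, chiFour_mul] at hchi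
  have hv : ∀ n, Odd n → chiFour n = 1 ∨ chiFour n = -1 := by
    intro n hn
    rw [chiFour_eq_sgnFour hn, sgnFour]
    split_ifs <;> simp
  rcases hv _ o0 with h0 | h0 <;> rcases hv _ o1 with h1 | h1 <;> rcases hv _ o2 with h2 | h2 <;>
    rw [h0, h1, h2] at hchi ⊢ <;> first | (norm_num; done) | norm_num at hchi

theorem sum_half_true {d : ℕ} (hd : Squarefree d) (h4 : d % 4 = 1) :
    ∑ E ∈ factTuples (classHalf true) d, symProd classRel E =
      3 / 2 * ∏ p ∈ d.primeFactors, (2 + chiFour p) - 3 ^ d.primeFactors.card / 2 := by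
  rw [sum_congr rfl fun E hE => symProd_half_true hd h4 hE, ← sum_div, sum_sub_distrib, sum_comm]
  have : ∀ i : Fin 3, ∑ E ∈ factTuples (classHalf true) d, chiFour (E (i, true)) =
      ∏ p ∈ d.primeFactors, (2 + chiFour p) := by
    intro i
    have h := sum_factTuples_prod (U := classHalf true)
      (fun u n => if u = (i, true) then chiFour n else 1)
      (by intro k; split_ifs <;> simp [chiFour_eq])
      (by intro k m n; split_ifs <;> simp [chiFour_mul]) d hd
    have e : ∀ p, ∑ u ∈ classHalf true, (if u = (i, true) then chiFour p else (1 : ℝ)) =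
        2 + chiFour p := by
      intro p
      rw [← add_sum_erase _ _ (mem_classHalf.2 rfl : (i, true) ∈ classHalf true), if_pos rfl,
        sum_congr rfl fun u hu => if_neg (ne_of_mem_erase hu), sum_const,
        card_classHalf_erase]
      norm_num
      ring
    simp only [e] at h
    rw [← h]
    refine sum_congr rfl fun E _ => ?_
    rw [Fintype.prod_eq_single (i, true) fun u hu => if_neg hu, if_pos rfl]
  simp only [this, sum_const, card_factTuples _ hd, card_classHalf, card_univ, Fintype.card_fin]
  simp
  ring

theorem abs_sum_fdTriples_sub_le {d : ℕ} (hd : Squarefree d) (h4 : d % 4 = 1) (h1 : d ≠ 1) :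
    |(∑ t ∈ fdTriples d, (tripleTerm t : ℝ)) - 3 ^ d.primeFactors.card / 2| ≤
      |∑ E ∈ (factTuples univ d).filter MixedTuple, symProd classRel E| +
        3 / 2 * ∏ p ∈ d.primeFactors, (2 + chiFour p) + 6 * 2 ^ d.primeFactors.card := by
  have hsplit : ∑ t ∈ fdTriples d, (tripleTerm t : ℝ) =
      ∑ E ∈ (factTuples univ d).filter MixedTuple, symProd classRel E +
      (∑ E ∈ (factTuples (classHalf false) d).filter
        (fun E => NoUnitPart fun i => ∏ b, E (i, b)), symProd classRel E +
      ∑ E ∈ (factTuples (classHalf true) d).filter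
        (fun E => NoUnitPart fun i => ∏ b, E (i, b)), symProd classRel E) := by
    rw [sum_fdTriples_eq_symProd hd h4, ← sum_union, ← sum_union]
    · refine sum_congr ?_ fun _ _ => rfl
      ext E
      simp only [mem_union, mem_filter, mem_factTuples hd.ne_zero, MixedTuple, mem_classHalf]
      constructor
      · rintro ⟨⟨-, h2⟩, h3⟩
        by_cases hf : ∃ u : Fin 3 × Bool, u.2 = false ∧ E u ≠ 1
        · by_cases ht : ∃ u : Fin 3 × Bool, u.2 = true ∧ E u ≠ 1
          · exact Or.inl ⟨⟨by simp, h2⟩, h3, fun b => by cases b <;> assumption⟩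
          · push Not at ht
            exact Or.inr (Or.inl ⟨⟨fun k hk => ht k (by simpa using hk), h2⟩, h3⟩)
        · push Not at hf
          exact Or.inr (Or.inr ⟨⟨fun k hk => hf k (by simpa using hk), h2⟩, h3⟩)
      · rintro (h | h | h)
        · exact ⟨h.1, h.2.1⟩
        · exact ⟨⟨by simp, h.1.2⟩, h.2⟩
        · exact ⟨⟨by simp, h.1.2⟩, h.2⟩
    · rw [Finset.disjoint_left]
      intro E hE hE'
      rw [mem_filter, MixedTuple] at hE
      rw [mem_union, mem_filter, mem_filter, mem_factTuples hd.ne_zero,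
        mem_factTuples hd.ne_zero] at hE'
      rcases hE' with h | h
      · obtain ⟨u, hu, hE1⟩ := hE.2.2 true
        exact hE1 (h.1.1 u (by simp [mem_classHalf, hu]))
      · obtain ⟨u, hu, hE1⟩ := hE.2.2 false
        exact hE1 (h.1.1 u (by simp [mem_classHalf, hu]))
    · rw [Finset.disjoint_left]
      intro E hE hE'
      rw [mem_filter, mem_factTuples hd.ne_zero] at hE hE'
      refine h1 ?_
      rw [← hE.1.2]
      refine prod_eq_one fun u _ => ?_
      cases hu : u.2
      · exact hE'.1.1 u (by simp [mem_classHalf, hu])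
      · exact hE.1.1 u (by simp [mem_classHalf, hu])
  have hf := abs_sum_half_sub_le hd false
  have ht := abs_sum_half_sub_le hd true
  rw [sum_half_false hd] at hf
  rw [sum_half_true hd h4] at ht
  rw [hsplit]
  set A := ∑ E ∈ (factTuples univ d).filter MixedTuple, symProd classRel E
  have hA := le_abs_self A
  have hA' := neg_abs_le A
  have hP : 0 ≤ ∏ p ∈ d.primeFactors, (2 + chiFour p) := prod_nonneg fun p _ => by
    have := abs_le.1 (abs_chiFour_le p)
    linarith
  rw [abs_le] at hf ht ⊢
  constructor <;> linarith

/-- Exactly one of the two symbols between the classes `u` and `v` occurs. -/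
def linkRel {K : Type*} (Φ : K → K → Bool) (u v : K) : Bool := xor (Φ u v) (Φ v u)

/-- The relation on pairs of classes describing the product of two expansions. -/
def pairRel (k l : (Fin 3 × Bool) × (Fin 3 × Bool)) : Bool :=
  xor (classRel k.1 l.1) (classRel k.2 l.2)

theorem linkRel_pairRel (k l : (Fin 3 × Bool) × (Fin 3 × Bool)) :
    linkRel pairRel k l = xor (linkRel classRel k.1 l.1) (linkRel classRel k.2 l.2) := by
  simp only [linkRel, pairRel]
  cases classRel k.1 l.1 <;> cases classRel k.2 l.2 <;> cases classRel l.1 k.1 <;>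
    cases classRel l.2 k.2 <;> rfl

theorem card_le_of_unlinked : ∀ S : Finset (Fin 3 × Bool),
    (∀ w ∈ S, ∀ w' ∈ S, linkRel classRel w w' = false) →
      S.card ≤ 3 ∧ (S.card = 3 → S = {(0, false), (1, false), (2, false)} ∨
        S = {(0, true), (1, true), (2, true)}) := by
  decide +kernel

theorem eq_of_common_links : ∀ w w' : Fin 3 × Bool,
    2 ≤ (univ.filter fun x => linkRel classRel w x = true ∧ linkRel classRel w' x = true).card →
      w = w' := by
  decide +kernel

theorem card_links_le : ∀ w : Fin 3 × Bool,
    (univ.filter fun x => linkRel classRel w x = true).card ≤ 2 := by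
  decide +kernel

theorem linkRel_classRel_comm : ∀ w w' : Fin 3 × Bool,
    linkRel classRel w w' = linkRel classRel w' w := by
  decide +kernel

theorem linkRel_classRel_iff : ∀ w w' : Fin 3 × Bool,
    linkRel classRel w w' = true ↔ w.1 ≠ w'.1 ∧ w.2 ≠ w'.2 := by
  decide +kernel

theorem exists_separating : ∀ a b : Bool, ∀ v : (Fin 3 × Bool) × (Fin 3 × Bool),
    ¬ (v.1.2 = a ∧ v.2.2 = b) → ∃ i j i' j' : Fin 3,
      linkRel pairRel v ((i, a), (j, b)) ≠ linkRel pairRel v ((i', a), (j', b)) := by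
  decide +kernel

theorem classHalf_eq (b : Bool) : classHalf b = {(0, b), (1, b), (2, b)} := by
  cases b <;> decide +kernel

/-- The section of `U` at `u`. -/
def sectionAt (U : Finset ((Fin 3 × Bool) × (Fin 3 × Bool))) (u : Fin 3 × Bool) :
    Finset (Fin 3 × Bool) := univ.filter fun w => (u, w) ∈ U

theorem mem_sectionAt {U : Finset ((Fin 3 × Bool) × (Fin 3 × Bool))} {u w : Fin 3 × Bool} :
    w ∈ sectionAt U u ↔ (u, w) ∈ U := by
  simp [sectionAt]

theorem card_eq_sum_sectionAt (U : Finset ((Fin 3 × Bool) × (Fin 3 × Bool))) :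
    U.card = ∑ u, (sectionAt U u).card := by
  rw [← Finset.card_sigma]
  refine Finset.card_bij' (fun k _ => ⟨k.1, k.2⟩) (fun t _ => (t.1, t.2)) ?_ ?_ ?_ ?_ <;>
    simp [mem_sectionAt]

section Unlinked

variable {U : Finset ((Fin 3 × Bool) × (Fin 3 × Bool))}

theorem linkRel_sectionAt
    (hU : ∀ k ∈ U, ∀ l ∈ U, linkRel pairRel k l = false)
    {u v w w' : Fin 3 × Bool} (hw : w ∈ sectionAt U u)
    (hw' : w' ∈ sectionAt U v) : linkRel classRel w w' = linkRel classRel u v := by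
  have := hU _ (mem_sectionAt.1 hw) _ (mem_sectionAt.1 hw')
  rw [linkRel_pairRel] at this
  simp only at this
  revert this
  cases linkRel classRel u v <;> cases linkRel classRel w w' <;> simp

theorem linkRel_self_sectionAt
    (hU : ∀ k ∈ U, ∀ l ∈ U, linkRel pairRel k l = false)
    {u w w' : Fin 3 × Bool} (hw : w ∈ sectionAt U u)
    (hw' : w' ∈ sectionAt U u) : linkRel classRel w w' = false := by
  rw [linkRel_sectionAt hU hw hw', linkRel, Bool.xor_self]

theorem card_sectionAt_le
    (hU : ∀ k ∈ U, ∀ l ∈ U, linkRel pairRel k l = false)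
    (u : Fin 3 × Bool) : (sectionAt U u).card ≤ 3 :=
  (card_le_of_unlinked _ fun _ h _ h' => linkRel_self_sectionAt hU h h').1

theorem card_sectionAt_add_le
    (hU : ∀ k ∈ U, ∀ l ∈ U, linkRel pairRel k l = false)
    {i j : Fin 3} (hij : i ≠ j) (b : Bool) :
    (sectionAt U (i, b)).card + (sectionAt U (j, !b)).card ≤ 3 := by
  have hl : linkRel classRel (i, b) (j, !b) = true :=
    (linkRel_classRel_iff _ _).2 ⟨hij, by cases b <;> simp⟩
  have hl' : linkRel classRel (j, !b) (i, b) = true := by rw [linkRel_classRel_comm, hl]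
  have key : ∀ u v, linkRel classRel u v = true → ∀ w ∈ sectionAt U u,
      (sectionAt U v).card ≤ 2 := by
    intro u v h w hw
    refine (card_le_card fun x hx => ?_).trans (card_links_le w)
    rw [mem_filter]
    exact ⟨mem_univ x, by rw [linkRel_sectionAt hU hw hx, h]⟩
  have hi := card_sectionAt_le hU (i, b)
  have hj := card_sectionAt_le hU (j, !b)
  rcases (sectionAt U (i, b)).eq_empty_or_nonempty with h | ⟨w, hw⟩
  · rw [h, card_empty]; omega
  rcases (sectionAt U (j, !b)).eq_empty_or_nonempty with h | ⟨w', hw'⟩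
  · rw [h, card_empty]; omega
  have h1 := key _ _ hl w hw
  have h2 := key _ _ hl' w' hw'
  by_contra hcon
  obtain ⟨x, hx, y, hy, hxy⟩ := one_lt_card.1 (by omega : 1 < (sectionAt U (i, b)).card)
  refine hxy (eq_of_common_links x y ?_)
  refine (show 2 ≤ (sectionAt U (j, !b)).card by omega).trans (card_le_card fun z hz => ?_)
  rw [mem_filter]
  exact ⟨mem_univ z, by rw [linkRel_sectionAt hU hx hz, hl], by rw [linkRel_sectionAt hU hy hz, hl]⟩

theorem sectionAt_card_one_false
    (hU : ∀ k ∈ U, ∀ l ∈ U, linkRel pairRel k l = false)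
    (b : Bool) (h1 : ∀ i, (sectionAt U (i, b)).card = 1)
    (h2 : ∀ i, (sectionAt U (i, !b)).card = 2) : False := by
  have hw : ∀ i, ∃ w, sectionAt U (i, b) = {w} := fun i => card_eq_one.1 (h1 i)
  choose w hw using hw
  have hwm : ∀ i, w i ∈ sectionAt U (i, b) := fun i => by rw [hw i]; exact mem_singleton_self _
  have heq : ∀ i j k : Fin 3, i ≠ k → j ≠ k → w i = w j := by
    intro i j k hik hjk
    refine eq_of_common_links _ _ ((h2 k).symm.le.trans (card_le_card fun z hz => ?_))
    rw [mem_filter]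
    refine ⟨mem_univ z, ?_, ?_⟩
    · rw [linkRel_sectionAt hU (hwm i) hz, linkRel_classRel_iff]
      exact ⟨hik, by cases b <;> simp⟩
    · rw [linkRel_sectionAt hU (hwm j) hz, linkRel_classRel_iff]
      exact ⟨hjk, by cases b <;> simp⟩
  have h01 : w 0 = w 1 := heq 0 1 2 (by decide) (by decide)
  obtain ⟨z, hz⟩ := card_pos.1 (by rw [h2 0]; norm_num : 0 < (sectionAt U (0, !b)).card)
  have e1 := linkRel_sectionAt hU (hwm 0) hz
  have e2 := linkRel_sectionAt hU (hwm 1) hz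
  rw [h01, e2] at e1
  have e3 : linkRel classRel (1, b) (0, !b) = true :=
    (linkRel_classRel_iff _ _).2 ⟨by simp, by cases b <;> simp⟩
  rw [e3] at e1
  exact ((linkRel_classRel_iff _ _).1 e1.symm).1 rfl

theorem eq_product_of_card_three
    (hU : ∀ k ∈ U, ∀ l ∈ U, linkRel pairRel k l = false)
    (b : Bool) (h3 : ∀ i, (sectionAt U (i, b)).card = 3)
    (h0 : ∀ i, (sectionAt U (i, !b)).card = 0) : ∃ c, U = classHalf b ×ˢ classHalf c := by
  have hhalf : ∀ i, ∃ c, sectionAt U (i, b) = classHalf c := by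
    intro i
    rcases (card_le_of_unlinked _ fun _ h _ h' => linkRel_self_sectionAt hU h h').2 (h3 i) with h | h
    · exact ⟨false, by rw [h, classHalf_eq]⟩
    · exact ⟨true, by rw [h, classHalf_eq]⟩
  choose c hc using hhalf
  have hcc : ∀ i j, c i = c j := by
    intro i j
    by_contra hne
    have := linkRel_sectionAt hU (u := (i, b)) (v := (j, b)) (w := (0, c i)) (w' := (1, c j))
      (by rw [hc, mem_classHalf]) (by rw [hc, mem_classHalf])
    have e1 : linkRel classRel (0, c i) (1, c j) = true :=
      (linkRel_classRel_iff _ _).2 ⟨by simp, hne⟩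
    rw [e1] at this
    exact ((linkRel_classRel_iff _ _).1 this.symm).2 rfl
  refine ⟨c 0, ?_⟩
  ext ⟨⟨i, a⟩, v⟩
  rw [mem_product, mem_classHalf, ← mem_sectionAt]
  simp only
  by_cases ha : a = b
  · subst ha
    rw [hc, hcc i 0]
    simp
  · have : a = !b := by cases a <;> cases b <;> simp_all
    subst this
    rw [card_eq_zero.1 (h0 i)]
    simp [ha]

theorem card_le_nine_of_unlinked
    (hU : ∀ k ∈ U, ∀ l ∈ U, linkRel pairRel k l = false) : U.card ≤ 9 := by
  rw [card_eq_sum_sectionAt, Fintype.sum_prod_type]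
  simp only [Fintype.sum_bool, Fin.sum_univ_three]
  have h01 := card_sectionAt_add_le hU (i := 0) (j := 1) (by decide) true
  have h12 := card_sectionAt_add_le hU (i := 1) (j := 2) (by decide) true
  have h20 := card_sectionAt_add_le hU (i := 2) (j := 0) (by decide) true
  simp only [Bool.not_true] at h01 h12 h20
  omega

theorem eq_product_of_card_nine
    (hU : ∀ k ∈ U, ∀ l ∈ U, linkRel pairRel k l = false)
    (h9 : U.card = 9) : ∃ a b, U = classHalf a ×ˢ classHalf b := by
  rw [card_eq_sum_sectionAt, Fintype.sum_prod_type] at h9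
  simp only [Fintype.sum_bool, Fin.sum_univ_three] at h9
  have h01 := card_sectionAt_add_le hU (i := 0) (j := 1) (by decide) true
  have h12 := card_sectionAt_add_le hU (i := 1) (j := 2) (by decide) true
  have h20 := card_sectionAt_add_le hU (i := 2) (j := 0) (by decide) true
  have h10 := card_sectionAt_add_le hU (i := 1) (j := 0) (by decide) true
  have h21 := card_sectionAt_add_le hU (i := 2) (j := 1) (by decide) true
  have h02 := card_sectionAt_add_le hU (i := 0) (j := 2) (by decide) true
  simp only [Bool.not_true] at h01 h12 h20 h10 h21 h02
  have heq : ∃ n ≤ 3, (∀ i, (sectionAt U (i, true)).card = n) ∧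
      ∀ i, (sectionAt U (i, false)).card = 3 - n := by
    refine ⟨(sectionAt U (0, true)).card, by omega, fun i => ?_, fun i => ?_⟩ <;>
      fin_cases i <;> simp only [Fin.zero_eta, Fin.mk_one, Fin.reduceFinMk] <;> omega
  obtain ⟨n, hn, ht, hf⟩ := heq
  interval_cases n
  · obtain ⟨c, hc⟩ := eq_product_of_card_three hU false hf ht
    exact ⟨_, c, hc⟩
  · exact (sectionAt_card_one_false hU true ht hf).elim
  · exact (sectionAt_card_one_false hU false hf ht).elim
  · obtain ⟨c, hc⟩ := eq_product_of_card_three hU true ht hf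
    exact ⟨_, c, hc⟩

end Unlinked

section Boxes

variable {K : Type*} [Fintype K] [DecidableEq K]

theorem sum_piFinset_split {M : Type*} [AddCommMonoid M] (t : K → Finset ℕ) (U : Finset K)
    (F : (K → ℕ) → M) :
    ∑ E ∈ Fintype.piFinset t, F E =
      ∑ E ∈ Fintype.piFinset (fun k => if k ∈ U then {1} else t k),
        ∑ D ∈ Fintype.piFinset (fun k => if k ∈ U then t k else {1}), F (E * D) := by
  rw [← sum_product']
  refine sum_bij' (fun E _ => (fun k => if k ∈ U then 1 else E k, fun k => if k ∈ U then E k else 1))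
    (fun P _ => P.1 * P.2) ?_ ?_ ?_ ?_ ?_
  · intro E hE
    rw [Fintype.mem_piFinset] at hE
    simp only [mem_product, Fintype.mem_piFinset]
    refine ⟨fun k => ?_, fun k => ?_⟩ <;> split_ifs <;> simp [hE k]
  · rintro ⟨E, D⟩ h
    simp only [mem_product, Fintype.mem_piFinset] at h
    rw [Fintype.mem_piFinset]
    intro k
    have h1 := h.1 k
    have h2 := h.2 k
    simp only [Pi.mul_apply]
    split_ifs at h1 h2
    · rw [mem_singleton] at h1
      rwa [h1, one_mul]
    · rw [mem_singleton] at h2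
      rwa [h2, mul_one]
  · intro E _
    ext k
    simp only [Pi.mul_apply]
    split_ifs <;> simp
  · rintro ⟨E, D⟩ h
    simp only [mem_product, Fintype.mem_piFinset] at h
    refine Prod.ext ?_ ?_ <;> ext k <;> have h1 := h.1 k <;> have h2 := h.2 k <;>
      simp only [Pi.mul_apply] <;> split_ifs at h1 h2 ⊢ <;> simp_all
  · intro E _
    congr 1
    ext k
    simp only [Pi.mul_apply]
    split_ifs <;> simp

theorem sum_piFinset_single {M : Type*} [AddCommMonoid M] (s : Finset ℕ) (u : K)
    (F : (K → ℕ) → M) :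
    ∑ D ∈ Fintype.piFinset (fun k => if k = u then s else {1}), F D =
      ∑ m ∈ s, F (Pi.mulSingle u m) := by
  refine sum_bij' (fun D _ => D u) (fun m _ => Pi.mulSingle u m) ?_ ?_ ?_ ?_ ?_
  · intro D hD
    have := Fintype.mem_piFinset.1 hD u
    rwa [if_pos rfl] at this
  · intro m hm
    rw [Fintype.mem_piFinset]
    intro k
    split_ifs with h
    · subst h
      simpa using hm
    · simp [h]
  · intro D hD
    ext k
    rcases eq_or_ne k u with rfl | hk
    · simp
    · have := Fintype.mem_piFinset.1 hD k
      rw [if_neg hk, mem_singleton] at this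
      simp [hk, this]
  · intro m _
    simp
  · intro D hD
    congr 1
    ext k
    rcases eq_or_ne k u with rfl | hk
    · simp
    · have := Fintype.mem_piFinset.1 hD k
      rw [if_neg hk, mem_singleton] at this
      simp [hk, this]

theorem sum_piFinset_pair {M : Type*} [AddCommMonoid M] (s : Finset ℕ) {u v : K} (huv : u ≠ v)
    (F : (K → ℕ) → M) :
    ∑ D ∈ Fintype.piFinset (fun k => if k ∈ ({u, v} : Finset K) then s else {1}), F D =
      ∑ m ∈ s, ∑ n ∈ s, F (Pi.mulSingle u m * Pi.mulSingle v n) := by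
  rw [sum_piFinset_split _ {v}]
  have h1 : (fun k => if k ∈ ({v} : Finset K) then ({1} : Finset ℕ) else
      if k ∈ ({u, v} : Finset K) then s else {1}) = fun k => if k = u then s else {1} := by
    ext1 k
    simp only [mem_singleton, mem_insert]
    split_ifs <;> simp_all
  have h2 : (fun k => if k ∈ ({v} : Finset K) then
      (if k ∈ ({u, v} : Finset K) then s else {1}) else ({1} : Finset ℕ)) =
      fun k => if k = v then s else {1} := by
    ext1 k
    simp only [mem_singleton, mem_insert]
    split_ifs <;> simp_all
  rw [h1, h2, sum_piFinset_single]
  exact sum_congr rfl fun m _ => sum_piFinset_single _ _ _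

theorem sum_piFinset_prod_le {M : Type*} [AddCommMonoid M] (U : Finset K) {x y : ℕ} (hyx : y ≤ x)
    (F : (K → ℕ) → M) :
    ∑ D ∈ Fintype.piFinset (fun k => if k ∈ U then Icc 1 x else {1}),
      (if ∏ k, D k ≤ y then F D else 0) = ∑ n ∈ Icc 1 y, ∑ D ∈ factTuples U n, F D := by
  rw [← sum_filter, ← sum_fiberwise_of_maps_to (t := Icc 1 y) (g := fun D => ∏ k, D k)]
  · refine sum_congr rfl fun n hn => sum_congr ?_ fun _ _ => rfl
    rw [mem_Icc] at hn
    have hn0 : n ≠ 0 := by omega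
    ext D
    rw [mem_filter, mem_filter, Fintype.mem_piFinset, mem_factTuples hn0]
    constructor
    · rintro ⟨⟨h1, -⟩, h3⟩
      refine ⟨fun k hk => ?_, h3⟩
      have := h1 k
      rwa [if_neg hk, mem_singleton] at this
    · rintro ⟨h1, h2⟩
      refine ⟨⟨fun k => ?_, by rw [h2]; exact hn.2⟩, h2⟩
      have hd : D k ∣ n := h2 ▸ Finset.dvd_prod_of_mem D (mem_univ k)
      have := Nat.le_of_dvd (by omega) hd
      have := Nat.pos_of_dvd_of_pos hd (by omega)
      split_ifs with hk
      · rw [mem_Icc]; omega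
      · rw [mem_singleton]; exact h1 k hk
  · intro D hD
    rw [mem_filter, Fintype.mem_piFinset] at hD
    rw [mem_Icc]
    refine ⟨Nat.one_le_iff_ne_zero.2 (prod_ne_zero_iff.2 fun k _ => ?_), hD.2⟩
    have := hD.1 k
    split_ifs at this
    · rw [mem_Icc] at this; omega
    · rw [mem_singleton] at this; omega

theorem sum_piFinset_inv_le (t : K → Finset ℕ) (y : ℕ) (ht : ∀ k, t k = {1} ∨ t k = Icc 1 y) :
    ∑ E ∈ Fintype.piFinset t, (1 / (∏ k, E k : ℕ) : ℝ) ≤ (1 + Real.log y) ^ Fintype.card K := by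
  have h := prod_univ_sum t (fun _ n => (1 / n : ℝ))
  have e : ∀ E ∈ Fintype.piFinset t, (1 / (∏ k, E k : ℕ) : ℝ) = ∏ k, (1 / (E k : ℝ)) := by
    intro E _
    push_cast
    simp
  rw [sum_congr rfl e, ← h, ← Finset.card_univ, ← prod_const]
  refine prod_le_prod (fun k _ => sum_nonneg fun n _ => by positivity) fun k _ => ?_
  rcases ht k with h | h
  · rw [h, sum_singleton]
    simpa using one_le_one_add_log y
  · rw [h]
    exact sum_Icc_one_div_le y

end Boxes

section Symbols

variable {K : Type*} [Fintype K] [DecidableEq K]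

/-- The product of all symbols between `m`, placed in the class `u`, and the parts of `E`. -/
def crossProd (Φ : K → K → Bool) (u : K) (m : ℕ) (E : K → ℕ) : ℝ :=
  (∏ l, if Φ u l then (jacobiSym m (E l) : ℝ) else 1) *
    ∏ l, if Φ l u then (jacobiSym (E l) m : ℝ) else 1

theorem abs_crossProd_le_one {K : Type*} [Fintype K]
    (Φ : K → K → Bool) (u : K) (m : ℕ) (E : K → ℕ) :
    |crossProd Φ u m E| ≤ 1 := by
  rw [crossProd, abs_mul, abs_prod, abs_prod]
  refine mul_le_one₀ (prod_le_one (fun _ _ => abs_nonneg _) fun l _ => ?_)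
    (prod_nonneg fun _ _ => abs_nonneg _) (prod_le_one (fun _ _ => abs_nonneg _) fun l _ => ?_) <;>
  · split_ifs
    · exact abs_jacobiSym_le_one _ _
    · simp

theorem symProd_mul_mulSingle {Φ : K → K → Bool} {u : K} (hu : Φ u u = false) {m : ℕ} (hm : m ≠ 0)
    {E : K → ℕ} (hE : ∀ k, E k ≠ 0) :
    symProd Φ (E * Pi.mulSingle u m) = symProd Φ E * crossProd Φ u m E := by
  have hs : ∀ l, (Pi.mulSingle u m : K → ℕ) l ≠ 0 := by
    intro l
    rcases eq_or_ne l u with rfl | h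
    · simpa using hm
    · simp [h]
  have e : ∀ k l, (if Φ k l then (jacobiSym ((E * Pi.mulSingle u m : K → ℕ) k)
      ((E * Pi.mulSingle u m : K → ℕ) l) : ℝ) else 1) =
      (if Φ k l then (jacobiSym (E k) (E l) : ℝ) else 1) *
      ((if Φ k l then (jacobiSym ((Pi.mulSingle u m : K → ℕ) k) (E l) : ℝ) else 1) *
      (if Φ k l then (jacobiSym (E k) ((Pi.mulSingle u m : K → ℕ) l) : ℝ) else 1)) := by
    intro k l
    by_cases h : Φ k l = true
    · simp only [h, if_true, Pi.mul_apply]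
      have : NeZero (E l) := ⟨hE l⟩
      have : NeZero ((Pi.mulSingle u m : K → ℕ) l) := ⟨hs l⟩
      have h3 : jacobiSym ((Pi.mulSingle u m : K → ℕ) k) ((Pi.mulSingle u m : K → ℕ) l) = 1 := by
        rcases eq_or_ne k u with rfl | hk
        · rcases eq_or_ne l k with rfl | hl
          · rw [hu] at h; exact absurd h (by simp)
          · rw [mulSingle_apply_of_ne hl]; exact jacobiSym.one_right _
        · rw [mulSingle_apply_of_ne hk]; exact_mod_cast jacobiSym.one_left _
      rw [Nat.cast_mul, jacobiSym.mul_left, jacobiSym.mul_right, jacobiSym.mul_right, h3]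
      push_cast
      ring
    · simp [h]
  simp only [symProd, e, prod_mul_distrib, crossProd]
  congr 2
  · rw [Fintype.prod_eq_single u]
    · simp
    · intro k hk
      refine prod_eq_one fun l _ => ?_
      rw [mulSingle_apply_of_ne hk]
      simp [jacobiSym.one_left]
  · refine (Finset.prod_comm).trans ?_
    rw [Fintype.prod_eq_single u]
    · simp
    · intro l hl
      refine prod_eq_one fun k _ => ?_
      rw [mulSingle_apply_of_ne hl]
      simp [jacobiSym.one_right]

theorem crossProd_mul_mulSingle {Φ : K → K → Bool} {u v : K} (huv : Φ u v = true)
    (hvu : Φ v u = false) (m n : ℕ) (E : K → ℕ) (hE : E u = 1) :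
    crossProd Φ v n (E * Pi.mulSingle u m) = crossProd Φ v n E * jacobiSym m n := by
  unfold crossProd
  rw [mul_assoc]
  congr 1
  · refine prod_congr rfl fun l _ => ?_
    rcases eq_or_ne l u with rfl | hl
    · simp [hvu]
    · simp [hl]
  · rw [← mul_prod_erase _ _ (mem_univ u), ← mul_prod_erase _ (fun l => if Φ l v = true then
      (jacobiSym (E l) n : ℝ) else 1) (mem_univ u), mul_comm, mul_comm (ite _ _ _), mul_assoc]
    congr 1
    · refine prod_congr rfl fun l hl => ?_
      simp [ne_of_mem_erase hl]
    · simp [huv, hE, jacobiSym.one_left]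

end Symbols

section Weights

/-- The weight `χ₄(n)^j / 9^ω(n)`. -/
def wt (j n : ℕ) : ℝ := chiFour n ^ j / 9 ^ n.primeFactors.card

theorem wt_mul (j : ℕ) {m n : ℕ} (h : m.Coprime n) : wt j (m * n) = wt j m * wt j n := by
  rw [wt, wt, wt, chiFour_mul, h.primeFactors_mul, card_union_of_disjoint h.disjoint_primeFactors,
    pow_add, mul_pow]
  field_simp

theorem abs_wt_le (j n : ℕ) : |wt j n| ≤ 1 / 9 ^ n.primeFactors.card := by
  rw [wt, abs_div, abs_pow, abs_of_nonneg (a := (9 : ℝ) ^ _) (by positivity)]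
  gcongr
  exact pow_le_one₀ (abs_nonneg _) (abs_chiFour_le n)

theorem abs_wt_le_one (j n : ℕ) : |wt j n| ≤ 1 := by
  refine (abs_wt_le j n).trans ?_
  rw [div_le_one (by positivity)]
  exact one_le_pow₀ (by norm_num)

theorem odd_of_wt_ne_zero {j n : ℕ} (hj : j ≠ 0) (h : wt j n ≠ 0) : Odd n := by
  rw [← Nat.not_even_iff_odd, Nat.even_iff]
  intro h2
  refine h ?_
  rw [wt, chiFour_eq, if_pos h2, zero_pow hj, zero_div]

end Weights

section Linked

variable {K : Type*} [Fintype K] [DecidableEq K]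

/-- The weighted symbol product attached to a tuple with squarefree product. -/
def qTerm (Φ : K → K → Bool) (j : ℕ) (E : K → ℕ) : ℝ :=
  if Squarefree (∏ k, E k) then wt j (∏ k, E k) * symProd Φ E else 0

theorem abs_qTerm_le {K : Type*} [Fintype K] (Φ : K → K → Bool) (j : ℕ) (E : K → ℕ) :
    |qTerm Φ j E| ≤ if Squarefree (∏ k, E k) then 1 / 9 ^ (∏ k, E k).primeFactors.card else 0 := by
  rw [qTerm]
  split_ifs
  · rw [abs_mul]
    exact (mul_le_of_le_one_right (abs_nonneg _) (abs_symProd_le_one _ _)).trans (abs_wt_le _ _)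
  · simp

theorem sum_sum_mul_le_eq {x r : ℕ} (hr : 0 < r) (f : ℕ → ℕ → ℝ) :
    ∑ m ∈ Icc 1 x, ∑ n ∈ Icc 1 x, (if r * (m * n) ≤ x then f m n else 0) =
      ∑ n ∈ Icc 1 (x / r), ∑ m ∈ Icc 1 (x / r / n), f m n := by
  rw [Finset.sum_comm]
  have h1 : Icc 1 (x / r) ⊆ Icc 1 x := Icc_subset_Icc le_rfl (Nat.div_le_self _ _)
  rw [← sum_subset h1]
  · refine sum_congr rfl fun n hn => ?_
    rw [mem_Icc] at hn
    rw [← sum_filter]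
    refine sum_congr ?_ fun _ _ => rfl
    ext m
    rw [mem_filter, mem_Icc, mem_Icc, Nat.le_div_iff_mul_le (by omega), Nat.le_div_iff_mul_le hr,
      mul_comm r]
    refine ⟨fun h => ⟨h.1.1, h.2⟩, fun h => ⟨⟨h.1, ?_⟩, h.2⟩⟩
    have : 1 ≤ n * r := Nat.mul_pos (by omega) hr
    nlinarith [h.2]
  · intro n hn hn'
    rw [mem_Icc] at hn hn'
    refine sum_eq_zero fun m hm => if_neg fun h => hn' ⟨hn.1, ?_⟩
    rw [mem_Icc] at hm
    rw [Nat.le_div_iff_mul_le hr]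
    nlinarith [Nat.mul_le_mul hm.1 (le_refl (n * r))]

theorem prod_mul_mulSingle (E : K → ℕ) (u : K) (m : ℕ) :
    ∏ k, (E * Pi.mulSingle u m : K → ℕ) k = (∏ k, E k) * m := by
  rw [mul_comm E, prod_mulSingle_mul, mul_comm]

theorem qTerm_mul_mulSingle_pair {Φ : K → K → Bool} {u v : K} (huv : Φ u v = true)
    (hvu : Φ v u = false) (hu : Φ u u = false) (hv : Φ v v = false) (j : ℕ) {E : K → ℕ}
    (hE : ∀ k, E k ≠ 0) (hEu : E u = 1) {m n : ℕ} (hm : m ≠ 0) (hn : n ≠ 0) :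
    qTerm Φ j (E * (Pi.mulSingle u m * Pi.mulSingle v n)) =
      qTerm Φ j E *
        ((if Squarefree m ∧ (∏ k, E k).Coprime m then wt j m * crossProd Φ u m E else 0) *
          (if Squarefree n ∧ (∏ k, E k).Coprime n then wt j n * crossProd Φ v n E else 0) *
            jacobiSym m n) := by
  rw [← mul_assoc]
  have hE' : ∀ k, (E * Pi.mulSingle u m : K → ℕ) k ≠ 0 := by
    intro k
    rcases eq_or_ne k u with rfl | h
    · simpa using ⟨hE k, hm⟩
    · simpa [h] using hE k
  have h0 : ∀ (E' : K → ℕ), qTerm Φ j E' = if Squarefree (∏ k, E' k) then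
      wt j (∏ k, E' k) * symProd Φ E' else 0 := fun _ => rfl
  rw [h0, h0, prod_mul_mulSingle, prod_mul_mulSingle, symProd_mul_mulSingle hv hn hE',
    symProd_mul_mulSingle hu hm hE, crossProd_mul_mulSingle huv hvu m n E hEu]
  by_cases hc : m.Coprime n
  · by_cases h1 : Squarefree (∏ k, E k)
    swap
    · rw [if_neg h1, zero_mul, if_neg]
      exact fun h => h1 (h.of_mul_left.of_mul_left)
    by_cases h2 : Squarefree m ∧ (∏ k, E k).Coprime m
    swap
    · rw [if_neg h2, zero_mul, zero_mul, mul_zero, if_neg]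
      intro h
      rw [Nat.squarefree_mul_iff, Nat.squarefree_mul_iff] at h
      exact h2 ⟨h.2.1.2.2, h.2.1.1⟩
    by_cases h3 : Squarefree n ∧ (∏ k, E k).Coprime n
    swap
    · rw [if_neg h3, mul_zero, zero_mul, mul_zero, if_neg]
      intro h
      rw [Nat.squarefree_mul_iff, Nat.coprime_mul_iff_left] at h
      exact h3 ⟨h.2.2, h.1.1⟩
    rw [if_pos h1, if_pos h2, if_pos h3, if_pos, wt_mul, wt_mul j h2.2]
    · ring
    · exact Nat.coprime_mul_iff_left.2 ⟨h3.2, hc⟩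
    · rw [Nat.squarefree_mul_iff, Nat.squarefree_mul_iff, Nat.coprime_mul_iff_left]
      exact ⟨⟨h3.2, hc⟩, ⟨h2.2, h1, h2.1⟩, h3.1⟩
  · have : NeZero n := ⟨hn⟩
    have hj : jacobiSym m n = 0 := by
      rw [jacobiSym.eq_zero_iff_not_coprime]
      simpa using hc
    rw [hj]
    simp

theorem abs_sum_linked_le (Φ : K → K → Bool) {u v : K} (hne : u ≠ v) (huv : Φ u v = true)
    (hvu : Φ v u = false) (hu : Φ u u = false) (hv : Φ v v = false) {j : ℕ} (hj : j ≠ 0)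
    {Z : ℕ} (hZ : 1 ≤ Z) (x : ℕ) (c : (K → ℕ) → ℝ) (hc1 : ∀ E, |c E| ≤ 1)
    (hcZ : ∀ E, c E ≠ 0 → Z < E u ∧ Z < E v)
    (hcc : ∀ E : K → ℕ, E u = 1 → E v = 1 → ∀ m n, Z < m → Z < n →
      c (E * (Pi.mulSingle u m * Pi.mulSingle v n)) =
        c (E * (Pi.mulSingle u (Z + 1) * Pi.mulSingle v (Z + 1)))) :
    |∑ E ∈ Fintype.piFinset (fun _ : K => Icc 1 x),
      (if ∏ k, E k ≤ x then c E * qTerm Φ j E else 0)| ≤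
      24 * x * (1 + Real.log x) ^ (Fintype.card K + 3) * (Z : ℝ) ^ (-(1 / 8) : ℝ) := by
  rw [sum_piFinset_split _ {u, v}]
  have hin : ∀ E ∈ Fintype.piFinset (fun k => if k ∈ ({u, v} : Finset K) then {1} else Icc 1 x),
      |∑ D ∈ Fintype.piFinset (fun k => if k ∈ ({u, v} : Finset K) then Icc 1 x else {1}),
        (if ∏ k, (E * D) k ≤ x then c (E * D) * qTerm Φ j (E * D) else 0)| ≤
      24 * x * (1 + Real.log x) ^ 3 * (Z : ℝ) ^ (-(1 / 8) : ℝ) * (1 / (∏ k, E k : ℕ) : ℝ) := by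
    intro E hE
    rw [Fintype.mem_piFinset] at hE
    have hEu : E u = 1 := by simpa using hE u
    have hEv : E v = 1 := by simpa using hE v
    have hE0 : ∀ k, E k ≠ 0 := by
      intro k
      have := hE k
      split_ifs at this
      · rw [mem_singleton] at this; omega
      · rw [mem_Icc] at this; omega
    have hr : 0 < ∏ k, E k := Nat.pos_of_ne_zero (prod_ne_zero_iff.2 fun k _ => hE0 k)
    set r := ∏ k, E k with hrdef
    rw [sum_piFinset_pair _ hne]
    set c0 := c (E * (Pi.mulSingle u (Z + 1) * Pi.mulSingle v (Z + 1))) with hc0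
    set a : ℕ → ℝ := fun m => if Z < m then
      (if Squarefree m ∧ r.Coprime m then wt j m * crossProd Φ u m E else 0) else 0 with ha
    set b : ℕ → ℝ := fun n => if Z < n then
      (if Squarefree n ∧ r.Coprime n then wt j n * crossProd Φ v n E else 0) else 0 with hb
    have key : ∀ m ∈ Icc 1 x, ∀ n ∈ Icc 1 x,
        (if ∏ k, (E * (Pi.mulSingle u m * Pi.mulSingle v n) : K → ℕ) k ≤ x then
          c (E * (Pi.mulSingle u m * Pi.mulSingle v n)) *
            qTerm Φ j (E * (Pi.mulSingle u m * Pi.mulSingle v n)) else 0) =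
        c0 * qTerm Φ j E * if r * (m * n) ≤ x then a m * b n * (jacobiSym m n : ℝ) else 0 := by
      intro m hm n hn
      rw [mem_Icc] at hm hn
      have hp : ∏ k, (E * (Pi.mulSingle u m * Pi.mulSingle v n) : K → ℕ) k = r * (m * n) := by
        rw [← mul_assoc, prod_mul_mulSingle, prod_mul_mulSingle, mul_assoc]
      rw [hp]
      split_ifs with h
      · by_cases h1 : Z < m ∧ Z < n
        · rw [hcc E hEu hEv m n h1.1 h1.2, qTerm_mul_mulSingle_pair huv hvu hu hv j hE0 hEu
            (by omega) (by omega)]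
          simp only [ha, hb, if_pos h1.1, if_pos h1.2]
          ring
        · have : c (E * (Pi.mulSingle u m * Pi.mulSingle v n)) = 0 := by
            by_contra hcon
            have := hcZ _ hcon
            simp [hEu, hEv, hne, hne.symm] at this
            exact h1 this
          rw [this, zero_mul]
          have : a m * b n = 0 := by
            rw [not_and_or] at h1
            rcases h1 with h1 | h1 <;> simp [ha, hb, h1]
          rw [this]
          ring
      · ring
    rw [sum_congr rfl fun m hm => sum_congr rfl (key m hm)]
    simp only [← mul_sum]
    rw [sum_sum_mul_le_eq hr (fun m n => a m * b n * (jacobiSym m n : ℝ)), abs_mul]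
    have hA : |c0 * qTerm Φ j E| ≤ 1 := by
      rw [abs_mul]
      refine mul_le_one₀ (hc1 _) (abs_nonneg _) ((abs_qTerm_le _ _ _).trans ?_)
      split_ifs
      · rw [div_le_one (by positivity)]
        exact one_le_pow₀ (by norm_num)
      · norm_num
    have hab : ∀ w m, |if Z < m then
        (if Squarefree m ∧ r.Coprime m then wt j m * crossProd Φ w m E else 0) else 0| ≤ 1 := by
      intro w m
      split_ifs
      · rw [abs_mul]
        exact mul_le_one₀ (abs_wt_le_one _ _) (abs_nonneg _) (abs_crossProd_le_one _ _ _ _)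
      · simp
      · simp
    have hsup : ∀ w m, (if Z < m then
        (if Squarefree m ∧ r.Coprime m then wt j m * crossProd Φ w m E else 0) else 0) ≠ 0 →
        Odd m ∧ Squarefree m ∧ Z < m := by
      intro w m h
      split_ifs at h with h1 h2
      · exact ⟨odd_of_wt_ne_zero hj (left_ne_zero_of_mul h), h2.1, h1⟩
      · exact absurd rfl h
      · exact absurd rfl h
    have hB := abs_bilinear_le (Y := x / r) hZ a b (hab u) (hab v) (hsup u) (hsup v)
    refine (mul_le_of_le_one_left (abs_nonneg _) hA).trans (hB.trans ?_)
    have h1 : ((x / r : ℕ) : ℝ) ≤ x * (1 / r : ℝ) := by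
      rw [mul_one_div]
      exact Nat.cast_div_le
    have h2 : 1 + Real.log ((x / r : ℕ) : ℝ) ≤ 1 + Real.log x :=
      one_add_log_mono (Nat.div_le_self _ _)
    have h3 := one_le_one_add_log (x / r)
    calc 24 * ((x / r : ℕ) : ℝ) * (1 + Real.log ((x / r : ℕ) : ℝ)) ^ 3 * (Z : ℝ) ^ (-(1 / 8) : ℝ)
        ≤ 24 * (x * (1 / r : ℝ)) * (1 + Real.log x) ^ 3 * (Z : ℝ) ^ (-(1 / 8) : ℝ) := by gcongr
      _ = _ := by ring
  refine (abs_sum_le_sum_abs _ _).trans ((sum_le_sum hin).trans ?_)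
  rw [← mul_sum]
  have hl := one_le_one_add_log x
  refine (mul_le_mul_of_nonneg_left (sum_piFinset_inv_le _ x fun k => ?_) (by positivity)).trans
    (le_of_eq (by ring))
  split_ifs
  · exact Or.inl rfl
  · exact Or.inr rfl

end Linked

section SmallPart

variable {K : Type*} [Fintype K] [DecidableEq K]

/-- All parts of `E` outside `U` are at most `Z`. -/
def SmallOff (U : Finset K) (Z : ℕ) (E : K → ℕ) : Prop := ∀ k ∉ U, E k ≤ Z

theorem abs_sum_smallOff_le (U : Finset K) {Z : ℕ} (hZ : 1 ≤ Z) (x : ℕ) (F : (K → ℕ) → ℝ) {B : ℝ}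
    (hB : 0 ≤ B)
    (h : ∀ E : K → ℕ, (∀ k ∈ U, E k = 1) → (∀ k, 1 ≤ E k ∧ E k ≤ Z) →
      |∑ n ∈ Icc 1 (x / ∏ k, E k), ∑ D ∈ factTuples U n, F (E * D)| ≤ B * (1 / (∏ k, E k : ℕ) : ℝ)) :
    |∑ E ∈ Fintype.piFinset (fun _ : K => Icc 1 x),
      (if ∏ k, E k ≤ x then (if SmallOff U Z E then F E else 0) else 0)| ≤
      B * (1 + Real.log Z) ^ Fintype.card K := by
  rw [sum_piFinset_split _ U]
  have hin : ∀ E ∈ Fintype.piFinset (fun k => if k ∈ U then {1} else Icc 1 x),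
      |∑ D ∈ Fintype.piFinset (fun k => if k ∈ U then Icc 1 x else {1}),
        (if ∏ k, (E * D) k ≤ x then (if SmallOff U Z (E * D) then F (E * D) else 0) else 0)| ≤
      if SmallOff U Z E then B * (1 / (∏ k, E k : ℕ) : ℝ) else 0 := by
    intro E hE
    rw [Fintype.mem_piFinset] at hE
    have hE1 : ∀ k, 1 ≤ E k := by
      intro k
      have := hE k
      split_ifs at this
      · rw [mem_singleton] at this; omega
      · rw [mem_Icc] at this; omega
    have hEU : ∀ k ∈ U, E k = 1 := by
      intro k hk
      have := hE k
      rwa [if_pos hk, mem_singleton] at this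
    have hr : 0 < ∏ k, E k := prod_pos fun k _ => hE1 k
    have e : ∀ D ∈ Fintype.piFinset (fun k => if k ∈ U then Icc 1 x else {1}),
        (if ∏ k, (E * D) k ≤ x then (if SmallOff U Z (E * D) then F (E * D) else 0) else 0) =
        if SmallOff U Z E then (if ∏ k, D k ≤ x / ∏ k, E k then F (E * D) else 0) else 0 := by
      intro D hD
      rw [Fintype.mem_piFinset] at hD
      have h1 : SmallOff U Z (E * D) ↔ SmallOff U Z E := by
        refine forall₂_congr fun k hk => ?_
        have := hD k
        rw [if_neg hk, mem_singleton] at this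
        simp [this]
      have h2 : ∏ k, (E * D) k ≤ x ↔ ∏ k, D k ≤ x / ∏ k, E k := by
        rw [Nat.le_div_iff_mul_le hr, mul_comm, ← prod_mul_distrib]
        rfl
      simp only [h1, h2]
      split_ifs <;> rfl
    rw [sum_congr rfl e]
    by_cases hs : SmallOff U Z E
    · simp only [if_pos hs]
      rw [sum_piFinset_prod_le U (Nat.div_le_self _ _)]
      refine h E hEU fun k => ⟨hE1 k, ?_⟩
      by_cases hk : k ∈ U
      · rw [hEU k hk]; exact hZ
      · exact hs k hk
    · simp [hs]
  refine (abs_sum_le_sum_abs _ _).trans ((sum_le_sum hin).trans ?_)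
  rw [← sum_filter]
  have hsub : (Fintype.piFinset (fun k => if k ∈ U then {1} else Icc 1 x)).filter (SmallOff U Z) ⊆
      Fintype.piFinset (fun k => if k ∈ U then {1} else Icc 1 Z) := by
    intro E hE
    rw [mem_filter, Fintype.mem_piFinset] at hE
    rw [Fintype.mem_piFinset]
    intro k
    have := hE.1 k
    split_ifs at this ⊢ with hk
    · exact this
    · rw [mem_Icc] at this ⊢
      exact ⟨this.1, hE.2 k hk⟩
  refine (sum_le_sum_of_subset_of_nonneg hsub fun E _ _ => by positivity).trans ?_
  rw [← mul_sum]
  refine mul_le_mul_of_nonneg_left (sum_piFinset_inv_le _ Z fun k => ?_) hB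
  split_ifs
  · exact Or.inl rfl
  · exact Or.inr rfl

theorem one_add_log_div_ge {x r : ℕ} (hr : 0 < r) (h : r ^ 2 ≤ x) :
    (1 + Real.log x) / 4 ≤ 1 + Real.log (x / r : ℕ) := by
  have hx : 0 < x := lt_of_lt_of_le (by positivity) h
  have h1 : r ≤ x / r := by rw [Nat.le_div_iff_mul_le hr]; nlinarith
  have h2 : x ≤ 4 * (x / r) ^ 2 := by
    have := Nat.div_add_mod x r
    have := Nat.mod_lt x hr
    nlinarith
  have h3 : Real.log x ≤ Real.log (4 * ((x / r : ℕ) : ℝ) ^ 2) := by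
    refine Real.log_le_log (by exact_mod_cast hx) ?_
    have : (x : ℝ) ≤ ((4 * (x / r) ^ 2 : ℕ) : ℝ) := by exact_mod_cast h2
    push_cast at this ⊢
    linarith
  have h4 : ((x / r : ℕ) : ℝ) ≠ 0 := by
    have : 0 < x / r := by omega
    exact_mod_cast this.ne'
  rw [Real.log_mul (by norm_num) (pow_ne_zero _ h4), Real.log_pow,
    show (4 : ℝ) = 2 ^ 2 by norm_num, Real.log_pow] at h3
  have h5 := Real.log_two_lt_d9
  have h6 : 0 ≤ Real.log (x : ℝ) := Real.log_natCast_nonneg x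
  push_cast at h3
  linarith

theorem prod_sq_le {K : Type*} [Fintype K] {Z x : ℕ} (hx : (Z ^ Fintype.card K) ^ 2 ≤ x) {E : K → ℕ}
    (hE : ∀ k, 1 ≤ E k ∧ E k ≤ Z) : (∏ k, E k) ^ 2 ≤ x := by
  refine le_trans (Nat.pow_le_pow_left ?_ 2) hx
  refine (prod_le_prod' fun k _ => (hE k).2).trans (le_of_eq ?_)
  rw [prod_const, card_univ]

theorem cast_div_mul_rpow_le {x r : ℕ} (hr : 0 < r) (h : r ^ 2 ≤ x) {δ : ℝ} (hδ : δ ≤ 0) :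
    ((x / r : ℕ) : ℝ) * (1 + Real.log (x / r : ℕ)) ^ δ ≤
      x * ((1 + Real.log x) / 4) ^ δ * (1 / r) := by
  have h1 : ((x / r : ℕ) : ℝ) ≤ x * (1 / r) := by
    rw [mul_one_div]; exact Nat.cast_div_le
  have h2 := one_le_one_add_log x
  have h3 := Real.rpow_le_rpow_of_nonpos (by linarith) (one_add_log_div_ge hr h) hδ
  calc _ ≤ (x * (1 / r) : ℝ) * ((1 + Real.log x) / 4) ^ δ := by
        refine mul_le_mul h1 h3 ?_ (by positivity)
        exact Real.rpow_nonneg (by linarith [one_le_one_add_log (x / r)]) _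
    _ = _ := by ring

/-- The majorant of `qTerm`. -/
def qBound (E : K → ℕ) : ℝ :=
  if Squarefree (∏ k, E k) then 1 / 9 ^ (∏ k, E k).primeFactors.card else 0

theorem qBound_nonneg {K : Type*} [Fintype K] (E : K → ℕ) : 0 ≤ qBound E := by
  rw [qBound]; split_ifs <;> positivity

theorem sum_smallOff_qBound_le (U : Finset K) (hU : U.card ≤ 8) {Z x : ℕ} (hZ : 1 ≤ Z)
    (hx : (Z ^ Fintype.card K) ^ 2 ≤ x) :
    ∑ E ∈ Fintype.piFinset (fun _ : K => Icc 1 x),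
      (if ∏ k, E k ≤ x then (if SmallOff U Z E then qBound E else 0) else 0) ≤
      48 * x * ((1 + Real.log x) / 4) ^ (-(1 / 9) : ℝ) * (1 + Real.log Z) ^ Fintype.card K := by
  have hl := one_le_one_add_log x
  refine (le_abs_self _).trans (abs_sum_smallOff_le U hZ x _ (by positivity) ?_)
  intro E hEU hE
  have hr : 0 < ∏ k, E k := prod_pos fun k _ => (hE k).1
  set r := ∏ k, E k with hrdef
  have hn : ∀ n ∈ Icc 1 (x / r), ∑ D ∈ factTuples U n, qBound (E * D) ≤
      sqfProd (fun _ => (U.card / 9 : ℝ)) n := by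
    intro n hn
    have hn0 : n ≠ 0 := by rw [mem_Icc] at hn; omega
    by_cases hs : Squarefree n
    · have hq : ∀ D ∈ factTuples U n, qBound (E * D) ≤ 1 / 9 ^ n.primeFactors.card := by
        intro D hD
        have hD' := ((mem_factTuples hn0).1 hD).2
        rw [qBound]
        split_ifs
        · refine one_div_le_one_div_of_le (by positivity) ?_
          refine pow_le_pow_right₀ (by norm_num) (card_le_card ?_)
          refine Nat.primeFactors_mono ?_ ?_
          · refine ⟨r, ?_⟩
            rw [← hD', hrdef, mul_comm, ← prod_mul_distrib]
            rfl
          · exact (by assumption : Squarefree _).ne_zero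
        · positivity
      refine (sum_le_sum hq).trans (le_of_eq ?_)
      rw [sum_const, card_factTuples U hs, sqfProd, if_pos hs, prod_const, nsmul_eq_mul, div_pow]
      push_cast
      ring
    · rw [sqfProd, if_neg hs]
      refine le_of_eq (sum_eq_zero fun D hD => ?_)
      have hD' := ((mem_factTuples hn0).1 hD).2
      rw [qBound, if_neg]
      intro h
      have : ∏ k, (E * D) k = r * n := by
        rw [← hD', hrdef, ← prod_mul_distrib]; rfl
      rw [this] at h
      exact hs h.of_mul_right
  rw [abs_of_nonneg (sum_nonneg fun n _ => sum_nonneg fun D _ => qBound_nonneg _)]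
  refine (sum_le_sum hn).trans ?_
  have hU' : (U.card : ℝ) ≤ 8 := by exact_mod_cast hU
  refine (sum_sqfProd_const_le (by positivity) (by linarith) _).trans ?_
  have hl' := one_le_one_add_log (x / r)
  have h1 : (1 + Real.log (x / r : ℕ)) ^ ((U.card / 9 : ℝ) - 1) ≤
      (1 + Real.log (x / r : ℕ)) ^ (-(1 / 9) : ℝ) :=
    Real.rpow_le_rpow_of_exponent_le hl' (by linarith)
  have h2 := cast_div_mul_rpow_le hr (prod_sq_le hx hE) (δ := -(1 / 9)) (by norm_num)
  calc _ ≤ 48 * (((x / r : ℕ) : ℝ) * (1 + Real.log (x / r : ℕ)) ^ (-(1 / 9) : ℝ)) := by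
        rw [mul_assoc]; gcongr
    _ ≤ 48 * (x * ((1 + Real.log x) / 4) ^ (-(1 / 9) : ℝ) * (1 / r)) := by gcongr
    _ = _ := by ring

end SmallPart

section Unlinked

variable {K : Type*} [Fintype K] [DecidableEq K]

/-- The sign by which the symbol product changes when a prime `p ≡ 1 (mod 4)` is put into `u`. -/
def linkSign (Φ : K → K → Bool) (E : K → ℕ) (u : K) (p : ℕ) : ℝ :=
  ∏ l, if linkRel Φ u l then (jacobiSym p (E l) : ℝ) else 1

theorem crossProd_eq_linkSign {K : Type*} [Fintype K]
    (Φ : K → K → Bool) (u : K) {p : ℕ} (hp : p % 4 = 1) {E : K → ℕ}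
    (hodd : ∀ k, Odd (E k)) (hcop : ∀ k, p.Coprime (E k)) :
    crossProd Φ u p E = linkSign Φ E u p := by
  rw [crossProd, linkSign, ← prod_mul_distrib]
  refine prod_congr rfl fun l _ => ?_
  have h1 : jacobiSym (E l) p = jacobiSym p (E l) :=
    (jacobiSym.quadratic_reciprocity_one_mod_four hp (hodd l)).symm
  have h2 : (jacobiSym p (E l) : ℝ) * jacobiSym p (E l) = 1 := by
    have := jacobiSym.sq_one (a := (p : ℤ)) (b := E l) (by simpa using hcop l)
    rw [← sq]
    exact_mod_cast this
  rw [h1, linkRel]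
  cases Φ u l <;> cases Φ l u <;> simp [h2]

theorem linkSign_congr {Φ : K → K → Bool} {U : Finset K} (hU : ∀ k ∈ U, ∀ l ∈ U,
    linkRel Φ k l = false) {E E' : K → ℕ} (h : ∀ k ∉ U, E k = E' k) {u : K} (hu : u ∈ U) (p : ℕ) :
    linkSign Φ E u p = linkSign Φ E' u p := by
  refine prod_congr rfl fun l _ => ?_
  by_cases hl : l ∈ U
  · simp [hU u hu l hl]
  · rw [h l hl]

theorem linkSign_mul_linkSign (Φ : K → K → Bool) {E : K → ℕ} (hE : ∀ k, E k ≠ 0) (u u' : K) {p : ℕ}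
    (hcop : ∀ k, p.Coprime (E k)) :
    linkSign Φ E u p * linkSign Φ E u' p =
      jacobiSym p (∏ l, if linkRel Φ u l ≠ linkRel Φ u' l then E l else 1) := by
  have hprod : ∀ s : Finset K, (jacobiSym p (∏ l ∈ s, if linkRel Φ u l ≠ linkRel Φ u' l then E l
      else 1) : ℝ) = ∏ l ∈ s, (jacobiSym p (if linkRel Φ u l ≠ linkRel Φ u' l then E l
      else 1) : ℝ) := by
    intro s
    induction s using Finset.induction_on with
    | empty => simp [jacobiSym.one_right]
    | insert a s ha ih =>
      rw [prod_insert ha, prod_insert ha, ← ih]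
      have : NeZero (if linkRel Φ u a ≠ linkRel Φ u' a then E a else 1) :=
        ⟨by split_ifs; exacts [hE a, one_ne_zero]⟩
      have : NeZero (∏ l ∈ s, if linkRel Φ u l ≠ linkRel Φ u' l then E l else 1) :=
        ⟨prod_ne_zero_iff.2 fun l _ => by split_ifs; exacts [hE l, one_ne_zero]⟩
      rw [jacobiSym.mul_right]
      push_cast
      rfl
  rw [hprod, linkSign, linkSign, ← prod_mul_distrib]
  refine prod_congr rfl fun l _ => ?_
  have h2 : (jacobiSym p (E l) : ℝ) * jacobiSym p (E l) = 1 := by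
    have := jacobiSym.sq_one (a := (p : ℤ)) (b := E l) (by simpa using hcop l)
    rw [← sq]
    exact_mod_cast this
  cases linkRel Φ u l <;> cases linkRel Φ u' l <;> simp [h2, jacobiSym.one_right]

theorem abs_linkSign_le_one {K : Type*} [Fintype K] (Φ : K → K → Bool) (E : K → ℕ) (u : K) (p : ℕ) :
    |linkSign Φ E u p| ≤ 1 := by
  rw [linkSign, abs_prod]
  refine prod_le_one (fun _ _ => abs_nonneg _) fun l _ => ?_
  split_ifs
  · exact abs_jacobiSym_le_one _ _
  · simp

theorem abs_sum_factTuples_symProd_le {Φ : K → K → Bool} {U : Finset K} (hd : ∀ k, Φ k k = false)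
    (hU : ∀ k ∈ U, ∀ l ∈ U, linkRel Φ k l = false) {H : ℕ → ℝ} (E : K → ℕ)
    (hH1 : ∀ p, p.Prime → p % 4 = 1 → (∀ k, p.Coprime (E k)) →
      |∑ u ∈ U, linkSign Φ E u p| ≤ U.card * H p)
    (hH3 : ∀ p, p.Prime → p % 4 = 3 → 1 ≤ H p) (n : ℕ) (hn : Squarefree n) :
    ∀ E' : K → ℕ, (∀ k ∉ U, E' k = E k) → (∀ k ∈ U, E k = 1) → (∀ k, Odd (E' k)) →
      (∀ k, n.Coprime (E' k)) → Odd n →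
      |∑ D ∈ factTuples U n, symProd Φ (E' * D)| ≤
        U.card ^ n.primeFactors.card * ∏ p ∈ n.primeFactors, H p := by
  refine squarefree_induction (P := fun n => ∀ E' : K → ℕ, (∀ k ∉ U, E' k = E k) →
    (∀ k ∈ U, E k = 1) → (∀ k, Odd (E' k)) →
      (∀ k, n.Coprime (E' k)) → Odd n →
      |∑ D ∈ factTuples U n, symProd Φ (E' * D)| ≤
        U.card ^ n.primeFactors.card * ∏ p ∈ n.primeFactors, H p) ?_ ?_ n hn
  · intro E' _ _ _ _ _
    rw [factTuples_one]
    simpa using abs_symProd_le_one Φ E'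
  · intro p n hp hpn hsn ih E' hE' hEU hodd hcop hoddn
    have hn0 : n ≠ 0 := hsn.ne_zero
    have hoddp : Odd p := (Nat.odd_mul.1 hoddn).1
    have hoddn' : Odd n := (Nat.odd_mul.1 hoddn).2
    have hcopp : ∀ k, p.Coprime (E' k) := fun k => (Nat.coprime_mul_iff_left.1 (hcop k)).1
    have hcopn : ∀ k, n.Coprime (E' k) := fun k => (Nat.coprime_mul_iff_left.1 (hcop k)).2
    have hB0 := (abs_nonneg _).trans (ih E' hE' hEU hodd hcopn hoddn')
    rw [sum_factTuples_prime_mul U hp hpn, card_primeFactors_prime_mul hp hpn,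
      prod_primeFactors_prime_mul hp hpn]
    have h4 : p % 4 = 1 ∨ p % 4 = 3 := by
      rcases hoddp with ⟨m, hm⟩
      omega
    rcases h4 with h4 | h4
    · have e : ∀ u ∈ U, ∑ D ∈ factTuples U n, symProd Φ (E' * (Pi.mulSingle u p * D)) =
          linkSign Φ E u p * ∑ D ∈ factTuples U n, symProd Φ (E' * D) := by
        intro u hu
        rw [mul_sum]
        refine sum_congr rfl fun D hD => ?_
        obtain ⟨hD1, hD2⟩ := (mem_factTuples hn0).1 hD
        have hDd : ∀ k, D k ∣ n := fun k => hD2 ▸ Finset.dvd_prod_of_mem D (mem_univ k)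
        have ho : ∀ k, Odd ((E' * D) k) := fun k => (hodd k).mul (hoddn'.of_dvd_nat (hDd k))
        have hc : ∀ k, p.Coprime ((E' * D) k) := fun k =>
          (hcopp k).mul_right (((Nat.Prime.coprime_iff_not_dvd hp).2 hpn).coprime_dvd_right (hDd k))
        have : E' * (Pi.mulSingle u p * D) = E' * D * Pi.mulSingle u p := by
          rw [mul_comm (Pi.mulSingle u p) D, mul_assoc]
        rw [this, symProd_mul_mulSingle (hd u) hp.ne_zero (fun k => (ho k).pos.ne'),
          crossProd_eq_linkSign Φ u h4 ho hc, linkSign_congr hU (E' := E) (fun k hk => ?_) hu,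
          mul_comm]
        simp [hE' k hk, hD1 k hk]
      rw [sum_congr rfl e, ← sum_mul, abs_mul]
      have h1 := hH1 p hp h4 (fun k => by
        by_cases hk : k ∈ U
        · rw [hEU k hk]; exact Nat.coprime_one_right _
        · rw [← hE' k hk]; exact hcopp k)
      have h2 := ih E' hE' hEU hodd hcopn hoddn'
      calc _ ≤ (U.card * H p) * (U.card ^ n.primeFactors.card * ∏ p ∈ n.primeFactors, H p) :=
            mul_le_mul h1 h2 (abs_nonneg _) ((abs_nonneg _).trans h1)
        _ = _ := by ring
    · have h1 : ∀ u ∈ U, |∑ D ∈ factTuples U n, symProd Φ (E' * (Pi.mulSingle u p * D))| ≤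
          U.card ^ n.primeFactors.card * ∏ p ∈ n.primeFactors, H p := by
        intro u hu
        have := ih (E' * Pi.mulSingle u p) (fun k hk => ?_) hEU (fun k => ?_) (fun k => ?_) hoddn'
        · simpa only [mul_assoc] using this
        · have : k ≠ u := fun h => hk (h ▸ hu)
          simp [this, hE' k hk]
        · rcases eq_or_ne k u with rfl | h
          · simpa using (hodd k).mul hoddp
          · simpa [h] using hodd k
        · rcases eq_or_ne k u with rfl | h
          · simpa using Nat.Coprime.mul_right (hcopn k)
              ((Nat.Prime.coprime_iff_not_dvd hp).2 hpn).symm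
          · simpa [h] using hcopn k
      refine (abs_sum_le_sum_abs _ _).trans ((sum_le_sum h1).trans ?_)
      rw [sum_const, nsmul_eq_mul]
      calc _ ≤ (U.card : ℝ) * (U.card ^ n.primeFactors.card * ∏ p ∈ n.primeFactors, H p) * H p :=
            le_mul_of_one_le_right (by positivity) (hH3 p hp h4)
        _ = _ := by ring

theorem detectFactor_of_mod_three {e p : ℕ} (h : p % 4 = 3) : detectFactor e p = 1 := by
  have h2 : p % 2 ≠ 0 := by omega
  rw [detectFactor, chiFour_eq, if_neg h2, if_neg (by omega)]
  ring

theorem detectFactor_of_mod_one {e p : ℕ} (h : p % 4 = 1) :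
    detectFactor e p = 1 - (1 - (jacobiSym p e : ℝ)) / 9 := by
  have h2 : p % 2 ≠ 0 := by omega
  rw [detectFactor, chiFour_eq, if_neg h2, if_pos h]
  ring

theorem abs_sum_le_of_mul_eq_neg_one {K : Type*} [DecidableEq K]
    {U : Finset K} {s : K → ℝ} (hs : ∀ u, |s u| ≤ 1) {u u' : K}
    (hu : u ∈ U) (hu' : u' ∈ U) (h : s u * s u' = -1) : |∑ w ∈ U, s w| ≤ U.card - 2 := by
  have hne : u ≠ u' := by
    rintro rfl
    nlinarith [mul_self_nonneg (s u)]
  have h1 := abs_le.1 (hs u)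
  have h2 := abs_le.1 (hs u')
  have h3 : s u + s u' = 0 := by nlinarith
  have hu2 : u' ∈ U.erase u := mem_erase.2 ⟨hne.symm, hu'⟩
  rw [← add_sum_erase _ _ hu, ← add_sum_erase _ _ hu2, ← add_assoc, h3, zero_add]
  refine (abs_sum_le_sum_abs _ _).trans ((sum_le_sum fun w _ => hs w).trans (le_of_eq ?_))
  rw [sum_const, nsmul_one, card_erase_of_mem hu2, card_erase_of_mem hu]
  have : 0 < (U.erase u).card := card_pos.2 ⟨u', hu2⟩
  rw [card_erase_of_mem hu] at this
  rw [Nat.cast_sub (by omega), Nat.cast_sub (by omega)]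
  push_cast
  ring

end Unlinked

section Unlinked

variable {K : Type*} [Fintype K] [DecidableEq K]

/-- The modulus detecting that two classes react differently to a new prime. -/
def sepModulus (Φ : K → K → Bool) (E : K → ℕ) (u u' : K) : ℕ :=
  ∏ l, if linkRel Φ u l ≠ linkRel Φ u' l then E l else 1

theorem sepModulus_dvd {K : Type*} [Fintype K] (Φ : K → K → Bool) (E : K → ℕ) (u u' : K) :
    sepModulus Φ E u u' ∣ ∏ k, E k := by
  refine prod_dvd_prod_of_dvd _ _ fun l _ => ?_
  split_ifs
  · exact dvd_rfl
  · exact one_dvd _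

theorem one_lt_sepModulus {K : Type*} [Fintype K]
    {Φ : K → K → Bool} {E : K → ℕ} (hE : ∀ k, 1 ≤ E k) {u u' v : K}
    (hv : E v ≠ 1) (h : linkRel Φ u v ≠ linkRel Φ u' v) : 1 < sepModulus Φ E u u' := by
  have h1 : E v ∣ sepModulus Φ E u u' := by
    have := Finset.dvd_prod_of_mem (fun l => if linkRel Φ u l ≠ linkRel Φ u' l then E l else 1)
      (mem_univ v)
    simp only [if_pos h] at this
    exact this
  have h2 : 0 < sepModulus Φ E u u' := prod_pos fun l _ => by
    split_ifs
    · exact hE l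
    · exact one_pos
  have := Nat.le_of_dvd h2 h1
  have := hE v
  omega

theorem abs_sum_linkSign_le {Φ : K → K → Bool} {U : Finset K} (hU9 : U.card = 9) {E : K → ℕ}
    (hE : ∀ k, 1 ≤ E k) {u u' : K} (hu : u ∈ U) (hu' : u' ∈ U) {p : ℕ} (h4 : p % 4 = 1)
    (hcop : ∀ k, p.Coprime (E k)) :
    |∑ w ∈ U, linkSign Φ E w p| ≤ U.card * detectFactor (sepModulus Φ E u u') p := by
  have hmul := linkSign_mul_linkSign Φ (fun k => (Nat.one_le_iff_ne_zero.1 (hE k))) u u' hcop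
  change _ = (jacobiSym p (sepModulus Φ E u u') : ℝ) at hmul
  rw [detectFactor_of_mod_one h4, hU9]
  have hc : p.Coprime (sepModulus Φ E u u') :=
    (Nat.Coprime.prod_right fun k _ => hcop k).coprime_dvd_right (sepModulus_dvd Φ E u u')
  rcases jacobiSym.eq_one_or_neg_one (a := (p : ℤ)) (b := sepModulus Φ E u u')
    (by simpa using hc) with h | h
  · rw [h]
    refine (abs_sum_le_sum_abs _ _).trans
      ((sum_le_sum fun w _ => abs_linkSign_le_one Φ E w p).trans (le_of_eq ?_))
    rw [sum_const, hU9]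
    norm_num
  · rw [h] at hmul ⊢
    have := abs_sum_le_of_mul_eq_neg_one (fun w => abs_linkSign_le_one Φ E w p) hu hu'
      (by rw [hmul]; norm_num)
    rw [hU9] at this
    push_cast at this ⊢
    linarith

theorem exists_abs_sum_unlinked_le : ∃ C : ℝ, 0 ≤ C ∧ ∀ (Φ : K → K → Bool) (U : Finset K),
    (∀ k, Φ k k = false) → (∀ k ∈ U, ∀ l ∈ U, linkRel Φ k l = false) → U.card = 9 →
    (∀ v ∉ U, ∃ u ∈ U, ∃ u' ∈ U, linkRel Φ u v ≠ linkRel Φ u' v) →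
    ∀ j : ℕ, j ≠ 0 → ∀ Z x : ℕ, 1 ≤ Z → (Z ^ Fintype.card K) ^ 2 ≤ x →
    ∀ c : (K → ℕ) → ℝ, (∀ E, |c E| ≤ 1) → (∀ E E', (∀ k ∉ U, E k = E' k) → c E = c E') →
    (∀ E, (∀ k ∉ U, E k = 1) → c E = 0) →
    |∑ E ∈ Fintype.piFinset (fun _ : K => Icc 1 x),
      (if ∏ k, E k ≤ x then (if SmallOff U Z E then c E * qTerm Φ j E else 0) else 0)| ≤
      C * x * ((1 + Real.log x) / 4) ^ (-(1 / 18) : ℝ) *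
        (4 + Fintype.card K * Real.log Z) * (1 + Real.log Z) ^ Fintype.card K := by
  obtain ⟨C, hC, hC'⟩ := exists_sum_sqfProd_detectFactor_le
  refine ⟨C, hC, fun Φ U hd hU hU9 hsep j hj Z x hZ hx c hc1 hcU hc0 => ?_⟩
  have hl := one_le_one_add_log x
  have hlZ := one_le_one_add_log Z
  have hlZ0 : 0 ≤ Real.log (Z : ℝ) := by linarith
  refine abs_sum_smallOff_le U hZ x _ (by positivity) ?_
  intro E hEU hE
  have hr : 0 < ∏ k, E k := prod_pos fun k _ => (hE k).1
  by_cases hv : ∀ k ∉ U, E k = 1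
  · rw [sum_eq_zero]
    · rw [abs_zero]; positivity
    intro n hn
    have hn0 : n ≠ 0 := by rw [mem_Icc] at hn; omega
    refine sum_eq_zero fun D hD => ?_
    rw [hc0, zero_mul]
    intro k hk
    simp [hv k hk, ((mem_factTuples hn0).1 hD).1 k hk]
  push Not at hv
  obtain ⟨v, hvU, hv1⟩ := hv
  obtain ⟨u, hu, u', hu', hne⟩ := hsep v hvU
  set e := sepModulus Φ E u u' with he
  by_cases hgood : Squarefree (∏ k, E k) ∧ Odd (∏ k, E k)
  swap
  · rw [sum_eq_zero]
    · rw [abs_zero]; positivity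
    intro n hn
    have hn0 : n ≠ 0 := by rw [mem_Icc] at hn; omega
    refine sum_eq_zero fun D hD => ?_
    have hp : ∏ k, (E * D) k = (∏ k, E k) * ∏ k, D k := prod_mul_distrib
    have : qTerm Φ j (E * D) = 0 := by
      by_contra hq
      rw [qTerm, hp] at hq
      split_ifs at hq with h1
      · exact hgood ⟨h1.of_mul_left,
          (Nat.odd_mul.1 (odd_of_wt_ne_zero hj (left_ne_zero_of_mul hq))).1⟩
      · exact hq rfl
    rw [this, mul_zero]
  obtain ⟨hsq, hodd⟩ := hgood
  have hEodd : ∀ k, Odd (E k) := fun k => hodd.of_dvd_nat (Finset.dvd_prod_of_mem E (mem_univ k))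
  set r := ∏ k, E k with hrdef
  have hn : ∀ n ∈ Icc 1 (x / r), |∑ D ∈ factTuples U n, c (E * D) * qTerm Φ j (E * D)| ≤
      sqfProd (detectFactor e) n := by
    intro n hn
    have hn0 : n ≠ 0 := by rw [mem_Icc] at hn; omega
    have hDp : ∀ D ∈ factTuples U n, ∏ k, (E * D) k = r * n := by
      intro D hD
      rw [← ((mem_factTuples hn0).1 hD).2, hrdef, ← prod_mul_distrib]; rfl
    have hform : ∀ D ∈ factTuples U n, c (E * D) * qTerm Φ j (E * D) =
        (c E * if Squarefree (r * n) then wt j (r * n) else 0) * symProd Φ (E * D) := by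
      intro D hD
      rw [qTerm, hDp D hD, hcU (E * D) E (fun k hk => by
        simp [((mem_factTuples hn0).1 hD).1 k hk])]
      split_ifs <;> ring
    rw [sum_congr rfl hform, ← mul_sum, abs_mul]
    by_cases hs : Squarefree (r * n) ∧ Odd n
    swap
    · have : (if Squarefree (r * n) then wt j (r * n) else 0) = 0 := by
        by_contra hq
        split_ifs at hq with h1
        · exact hs ⟨h1, (Nat.odd_mul.1 (odd_of_wt_ne_zero hj hq)).2⟩
        · exact hq rfl
      rw [this, mul_zero, abs_zero, zero_mul]
      exact sqfProd_nonneg (fun p _ => detectFactor_nonneg e p) n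
    obtain ⟨hs, hno⟩ := hs
    have hcop : r.Coprime n := (Nat.squarefree_mul_iff.1 hs).1
    have hsn : Squarefree n := hs.of_mul_right
    have hsum := abs_sum_factTuples_symProd_le hd hU (H := detectFactor e) E
      (fun p _ h4 hcp => abs_sum_linkSign_le hU9 (fun k => (hE k).1) hu hu' h4 hcp)
      (fun p _ h4 => (detectFactor_of_mod_three h4).ge) n hsn E (fun _ _ => rfl) hEU hEodd
      (fun k => hcop.symm.coprime_dvd_right (Finset.dvd_prod_of_mem E (mem_univ k))) hno
    rw [if_pos hs, wt_mul j hcop, sqfProd, if_pos hsn]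
    have hw : |c E * (wt j r * wt j n)| ≤ 1 / 9 ^ n.primeFactors.card := by
      rw [abs_mul, abs_mul, ← mul_assoc]
      refine (mul_le_of_le_one_left (abs_nonneg _) ?_).trans (abs_wt_le j n)
      exact mul_le_one₀ (hc1 E) (abs_nonneg _) (abs_wt_le_one j r)
    calc _ ≤ 1 / 9 ^ n.primeFactors.card *
          (U.card ^ n.primeFactors.card * ∏ p ∈ n.primeFactors, detectFactor e p) :=
          mul_le_mul hw hsum (abs_nonneg _) (by positivity)
      _ = _ := by
        rw [hU9]
        push_cast
        field_simp
  refine (abs_sum_le_sum_abs _ _).trans ((sum_le_sum hn).trans ?_)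
  have hed : e ∣ r := sepModulus_dvd Φ E u u'
  have he1 : 1 < e := one_lt_sepModulus (fun k => (hE k).1) hv1 hne
  refine (hC' _ e he1 (hodd.of_dvd_nat hed) (hsq.squarefree_of_dvd hed)).trans ?_
  have h2 := cast_div_mul_rpow_le hr (prod_sq_le hx hE) (δ := -(1 / 18)) (by norm_num)
  have h3 : Real.log e ≤ Fintype.card K * Real.log Z := by
    rw [← Real.log_pow]
    refine Real.log_le_log (by exact_mod_cast (by omega : 0 < e)) ?_
    have h4 : e ≤ Z ^ Fintype.card K := by
      refine (Nat.le_of_dvd hr hed).trans ((prod_le_prod' fun k _ => (hE k).2).trans (le_of_eq ?_))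
      rw [prod_const, card_univ]
    exact_mod_cast h4
  have h5 : 0 ≤ Real.log (e : ℝ) := Real.log_natCast_nonneg e
  calc _ = C * (((x / r : ℕ) : ℝ) * (1 + Real.log (x / r : ℕ)) ^ (-(1 / 18) : ℝ)) *
        (4 + Real.log e) := by ring
    _ ≤ C * (x * ((1 + Real.log x) / 4) ^ (-(1 / 18) : ℝ) * (1 / r)) *
        (4 + Fintype.card K * Real.log Z) := by gcongr
    _ = _ := by ring

end Unlinked

section SecondMoment

/-- The parts of `E` exceeding `Z` are exactly those with index in `U`. -/
def LargeExactly {K : Type*} (U : Finset K) (Z : ℕ) (E : K → ℕ) : Prop := ∀ k, Z < E k ↔ k ∈ U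

/-- Both families of marginal products of `E` are mixed. -/
def AdmissiblePair (E : (Fin 3 × Bool) × (Fin 3 × Bool) → ℕ) : Prop :=
  MixedTuple (fun k => ∏ l, E (k, l)) ∧ MixedTuple (fun l => ∏ k, E (k, l))

theorem nat_prod_eq_one_iff {ι : Type*} [Fintype ι] (f : ι → ℕ) :
    ∏ i, f i = 1 ↔ ∀ i, f i = 1 := by
  refine ⟨fun h i => Nat.dvd_one.1 (h ▸ Finset.dvd_prod_of_mem f (mem_univ i)), fun h => ?_⟩
  exact prod_eq_one fun i _ => h i

theorem mixedTuple_congr {D D' : Fin 3 × Bool → ℕ} (h : ∀ k, D k = 1 ↔ D' k = 1) :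
    MixedTuple D ↔ MixedTuple D' := by
  simp only [MixedTuple, NoUnitPart, ne_eq, nat_prod_eq_one_iff, h]

theorem admissiblePair_congr {E E' : (Fin 3 × Bool) × (Fin 3 × Bool) → ℕ}
    (h : ∀ k, E k = 1 ↔ E' k = 1) : AdmissiblePair E ↔ AdmissiblePair E' := by
  refine and_congr (mixedTuple_congr fun k => ?_) (mixedTuple_congr fun k => ?_) <;>
  simp only [nat_prod_eq_one_iff, h]

theorem not_admissiblePair {E : (Fin 3 × Bool) × (Fin 3 × Bool) → ℕ} {a b : Bool}
    (h : ∀ k ∉ classHalf a ×ˢ classHalf b, E k = 1) : ¬ AdmissiblePair E := by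
  rintro ⟨⟨-, h2⟩, -⟩
  obtain ⟨u, hu, hu1⟩ := h2 (!a)
  refine hu1 ((nat_prod_eq_one_iff _).2 fun l => h _ ?_)
  rw [mem_product, mem_classHalf, hu]
  simp

theorem jacobiSym_prod_prod {ι κ : Type*} [Fintype ι] [Fintype κ] (f : ι → ℕ) (g : κ → ℕ)
    (hg : ∀ i, g i ≠ 0) :
    (jacobiSym ((∏ i, f i : ℕ) : ℤ) (∏ l, g l) : ℝ) = ∏ i, ∏ l, (jacobiSym (f i) (g l) : ℝ) := by
  have hleft : ∀ (s : Finset ι) (n : ℕ), (jacobiSym ((∏ i ∈ s, f i : ℕ) : ℤ) n : ℝ) =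
      ∏ i ∈ s, (jacobiSym (f i) n : ℝ) := by
    intro s n
    induction s using Finset.induction_on with
    | empty => simp [jacobiSym.one_left]
    | insert a s ha ih =>
      rw [prod_insert ha, prod_insert ha, ← ih, Nat.cast_mul, jacobiSym.mul_left]
      push_cast
      rfl
  have hright : ∀ (s : Finset κ) (m : ℕ), (jacobiSym m (∏ i ∈ s, g i) : ℝ) =
      ∏ i ∈ s, (jacobiSym m (g i) : ℝ) := by
    intro s m
    induction s using Finset.induction_on with
    | empty => simp [jacobiSym.one_right]
    | insert a s ha ih =>
      have : NeZero (g a) := ⟨hg a⟩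
      have : NeZero (∏ i ∈ s, g i) := ⟨prod_ne_zero_iff.2 fun i _ => hg i⟩
      rw [prod_insert ha, prod_insert ha, ← ih, jacobiSym.mul_right]
      push_cast
      rfl
  rw [hleft]
  exact prod_congr rfl fun i _ => hright _ _

theorem symProd_mul_symProd (E : (Fin 3 × Bool) × (Fin 3 × Bool) → ℕ)
    (hE : Squarefree (∏ k, E k)) :
    symProd classRel (fun k => ∏ l, E (k, l)) * symProd classRel (fun l => ∏ k, E (k, l)) =
      symProd pairRel E := by
  have h0 : ∀ k, E k ≠ 0 := fun k h => hE.ne_zero (prod_eq_zero (mem_univ k) h)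
  have h1 : symProd classRel (fun k => ∏ l, E (k, l)) = ∏ k, ∏ k', ∏ l, ∏ l',
      if classRel k k' then (jacobiSym (E (k, l)) (E (k', l')) : ℝ) else 1 := by
    refine prod_congr rfl fun k _ => prod_congr rfl fun k' _ => ?_
    rw [jacobiSym_prod_prod _ _ fun l => h0 _]
    split_ifs <;> simp
  have h2 : symProd classRel (fun l => ∏ k, E (k, l)) = ∏ l, ∏ l', ∏ k, ∏ k',
      if classRel l l' then (jacobiSym (E (k, l)) (E (k', l')) : ℝ) else 1 := by
    refine prod_congr rfl fun l _ => prod_congr rfl fun l' _ => ?_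
    rw [jacobiSym_prod_prod _ _ fun l => h0 _]
    split_ifs <;> simp
  have h1' : symProd classRel (fun k => ∏ l, E (k, l)) = ∏ p : (Fin 3 × Bool) × (Fin 3 × Bool),
      ∏ q : (Fin 3 × Bool) × (Fin 3 × Bool),
        if classRel p.1 q.1 then (jacobiSym (E p) (E q) : ℝ) else 1 := by
    rw [h1]
    refine Eq.trans ?_ (Fintype.prod_prod_type _).symm
    refine prod_congr rfl fun k _ => Finset.prod_comm.trans (prod_congr rfl fun l _ => ?_)
    exact (Fintype.prod_prod_type fun q : (Fin 3 × Bool) × (Fin 3 × Bool) =>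
      if classRel k q.1 then (jacobiSym (E (k, l)) (E q) : ℝ) else 1).symm
  have h2' : symProd classRel (fun l => ∏ k, E (k, l)) = ∏ p : (Fin 3 × Bool) × (Fin 3 × Bool),
      ∏ q : (Fin 3 × Bool) × (Fin 3 × Bool),
        if classRel p.2 q.2 then (jacobiSym (E p) (E q) : ℝ) else 1 := by
    rw [h2]
    refine Eq.trans ?_ (Fintype.prod_prod_type_right _).symm
    refine prod_congr rfl fun l _ => Finset.prod_comm.trans (prod_congr rfl fun k _ => ?_)
    exact (Fintype.prod_prod_type_right fun q : (Fin 3 × Bool) × (Fin 3 × Bool) =>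
      if classRel l q.2 then (jacobiSym (E (k, l)) (E q) : ℝ) else 1).symm
  rw [h1', h2', symProd, ← prod_mul_distrib]
  refine prod_congr rfl fun p _ => ?_
  rw [← prod_mul_distrib]
  refine prod_congr rfl fun q _ => ?_
  rw [pairRel]
  have hJ : classRel p.1 q.1 = true → (jacobiSym (E p) (E q) : ℝ) * jacobiSym (E p) (E q) = 1 := by
    intro hc
    have hpq : p ≠ q := by
      rintro rfl
      simp [classRel] at hc
    have hcop : (E p).Coprime (E q) := by
      have := hE
      rw [← mul_prod_erase _ _ (mem_univ p),
        ← mul_prod_erase _ _ (mem_erase.2 ⟨hpq.symm, mem_univ q⟩), ← mul_assoc] at this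
      exact (Nat.squarefree_mul_iff.1 this.of_mul_left).1
    have := jacobiSym.sq_one (a := (E p : ℤ)) (b := E q) (by simpa using hcop)
    rw [← sq]
    exact_mod_cast this
  cases h1 : classRel p.1 q.1 <;> cases h2 : classRel p.2 q.2 <;> simp [hJ, h1]

/-- The part of the expansion of `ftilde` coming from mixed tuples. -/
def mixedSum (d : ℕ) : ℝ :=
  ∑ E ∈ (factTuples (univ : Finset (Fin 3 × Bool)) d).filter MixedTuple, symProd classRel E

theorem mixedSum_sq {d : ℕ} (hd : Squarefree d) :
    mixedSum d ^ 2 = ∑ E ∈ factTuples (univ : Finset ((Fin 3 × Bool) × (Fin 3 × Bool))) d,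
      (if AdmissiblePair E then 1 else 0) * symProd pairRel E := by
  rw [mixedSum, sum_filter, sq, sum_mul_sum, sum_factTuples_mul_sum univ univ d hd,
    univ_product_univ]
  refine sum_congr rfl fun E hE => ?_
  have h := ((mem_factTuples hd.ne_zero).1 hE).2
  rw [← symProd_mul_symProd E (h ▸ hd), AdmissiblePair]
  split_ifs <;> simp_all

end SecondMoment

section ClassBounds

/-- The indicator of admissible tuples. -/
def admissibleInd (E : (Fin 3 × Bool) × (Fin 3 × Bool) → ℕ) : ℝ := if AdmissiblePair E then 1 else 0

theorem abs_admissibleInd_le_one (E : (Fin 3 × Bool) × (Fin 3 × Bool) → ℕ) :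
    |admissibleInd E| ≤ 1 := by
  rw [admissibleInd]; split_ifs <;> simp

theorem admissibleInd_congr {E E' : (Fin 3 × Bool) × (Fin 3 × Bool) → ℕ}
    (h : ∀ k, E k = 1 ↔ E' k = 1) : admissibleInd E = admissibleInd E' := by
  simp only [admissibleInd, admissiblePair_congr h]

/-- The indicator of admissible tuples whose large parts are indexed by `U`. -/
def classInd (U : Finset ((Fin 3 × Bool) × (Fin 3 × Bool))) (Z : ℕ)
    (E : (Fin 3 × Bool) × (Fin 3 × Bool) → ℕ) : ℝ :=
  if LargeExactly U Z E then admissibleInd E else 0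

theorem abs_classInd_le_one (U : Finset ((Fin 3 × Bool) × (Fin 3 × Bool))) (Z : ℕ)
    (E : (Fin 3 × Bool) × (Fin 3 × Bool) → ℕ) : |classInd U Z E| ≤ 1 := by
  rw [classInd]
  split_ifs
  · exact abs_admissibleInd_le_one E
  · simp

/-- The sum over a box of weighted symbol products, restricted by `c`. -/
def boxSum (c : ((Fin 3 × Bool) × (Fin 3 × Bool) → ℕ) → ℝ) (j x : ℕ) : ℝ :=
  ∑ E ∈ Fintype.piFinset (fun _ : (Fin 3 × Bool) × (Fin 3 × Bool) => Icc 1 x),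
    (if ∏ k, E k ≤ x then c E * qTerm pairRel j E else 0)

theorem pairRel_self (k : (Fin 3 × Bool) × (Fin 3 × Bool)) : pairRel k k = false := by
  simp [pairRel, classRel]

theorem abs_boxSum_classInd_linked_le {U : Finset ((Fin 3 × Bool) × (Fin 3 × Bool))}
    {u v : (Fin 3 × Bool) × (Fin 3 × Bool)} (hu : u ∈ U) (hv : v ∈ U)
    (huv : pairRel u v = true) (hvu : pairRel v u = false) {j : ℕ} (hj : j ≠ 0) {Z : ℕ}
    (hZ : 1 ≤ Z) (x : ℕ) :
    |boxSum (classInd U Z) j x| ≤ 24 * x *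
      (1 + Real.log x) ^ (Fintype.card ((Fin 3 × Bool) × (Fin 3 × Bool)) + 3) *
        (Z : ℝ) ^ (-(1 / 8) : ℝ) := by
  have hne : u ≠ v := by
    rintro rfl
    rw [huv] at hvu
    exact absurd hvu (by simp)
  refine abs_sum_linked_le pairRel hne huv hvu (pairRel_self u) (pairRel_self v) hj hZ x
    (classInd U Z) (abs_classInd_le_one U Z) ?_ ?_
  · intro E hE
    have : LargeExactly U Z E := by
      by_contra h
      exact hE (if_neg h)
    exact ⟨(this u).2 hu, (this v).2 hv⟩
  · intro E hEu hEv m n hm hn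
    have h1 : ∀ k, (E * (Pi.mulSingle u m * Pi.mulSingle v n) : (Fin 3 × Bool) × (Fin 3 × Bool) → ℕ) k = 1 ↔
        (E * (Pi.mulSingle u (Z + 1) * Pi.mulSingle v (Z + 1)) :
          (Fin 3 × Bool) × (Fin 3 × Bool) → ℕ) k = 1 := by
      intro k
      rcases eq_or_ne k u with rfl | hk
      · simp [hEu, hne]; omega
      · rcases eq_or_ne k v with rfl | hk'
        · simp [hEv, hk]; omega
        · simp [hk, hk']
    have h2 : ∀ k, Z < (E * (Pi.mulSingle u m * Pi.mulSingle v n) : (Fin 3 × Bool) × (Fin 3 × Bool) → ℕ) k ↔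
        Z < (E * (Pi.mulSingle u (Z + 1) * Pi.mulSingle v (Z + 1)) :
          (Fin 3 × Bool) × (Fin 3 × Bool) → ℕ) k := by
      intro k
      rcases eq_or_ne k u with rfl | hk
      · simp [hEu, hne, hm]
      · rcases eq_or_ne k v with rfl | hk'
        · simp [hEv, hk, hn]
        · simp [hk, hk']
    have h3 : LargeExactly U Z (E * (Pi.mulSingle u m * Pi.mulSingle v n)) ↔
        LargeExactly U Z (E * (Pi.mulSingle u (Z + 1) * Pi.mulSingle v (Z + 1))) :=
      forall_congr' fun k => by rw [h2 k]
    simp only [classInd, h3, admissibleInd_congr h1]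

theorem LargeExactly.smallOff {U : Finset ((Fin 3 × Bool) × (Fin 3 × Bool))} {Z : ℕ}
    {E : (Fin 3 × Bool) × (Fin 3 × Bool) → ℕ} (h : LargeExactly U Z E) : SmallOff U Z E :=
  fun k hk => not_lt.1 fun hlt => hk ((h k).1 hlt)

theorem abs_mul_qTerm_le {c : ℝ} (hc : |c| ≤ 1) (j : ℕ) (E : (Fin 3 × Bool) × (Fin 3 × Bool) → ℕ) :
    |c * qTerm pairRel j E| ≤ qBound E := by
  rw [abs_mul]
  exact (mul_le_of_le_one_left (abs_nonneg _) hc).trans (abs_qTerm_le _ _ _)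

/-- The bound for the contribution of at most eight large parts. -/
def fewBound (Z x : ℕ) : ℝ :=
  48 * x * ((1 + Real.log x) / 4) ^ (-(1 / 9) : ℝ) *
    (1 + Real.log Z) ^ Fintype.card ((Fin 3 × Bool) × (Fin 3 × Bool))

theorem abs_boxSum_classInd_few_le {U : Finset ((Fin 3 × Bool) × (Fin 3 × Bool))}
    (hU : U.card ≤ 8) (j : ℕ) {Z x : ℕ} (hZ : 1 ≤ Z)
    (hx : (Z ^ Fintype.card ((Fin 3 × Bool) × (Fin 3 × Bool))) ^ 2 ≤ x) :
    |boxSum (classInd U Z) j x| ≤ fewBound Z x := by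
  refine (abs_sum_le_sum_abs _ _).trans
    ((sum_le_sum fun E _ => ?_).trans (sum_smallOff_qBound_le U hU hZ hx))
  have h0 := qBound_nonneg E
  split_ifs with h1 h2
  · exact abs_mul_qTerm_le (abs_classInd_le_one U Z E) j E
  · rw [classInd, if_neg fun h => h2 h.smallOff, zero_mul, abs_zero]
  · simp

/-- The bound for the contribution of a maximal unlinked set of large parts. -/
def maximalBound (C : ℝ) (Z x : ℕ) : ℝ :=
  C * x * ((1 + Real.log x) / 4) ^ (-(1 / 18) : ℝ) *
    (4 + Fintype.card ((Fin 3 × Bool) × (Fin 3 × Bool)) * Real.log Z) *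
      (1 + Real.log Z) ^ Fintype.card ((Fin 3 × Bool) × (Fin 3 × Bool))

theorem exists_abs_boxSum_classInd_nine_le : ∃ C : ℝ, 0 ≤ C ∧
    ∀ U : Finset ((Fin 3 × Bool) × (Fin 3 × Bool)),
    (∀ k ∈ U, ∀ l ∈ U, linkRel pairRel k l = false) → U.card = 9 →
    ∀ j : ℕ, j ≠ 0 → ∀ Z x : ℕ, 1 ≤ Z →
    (Z ^ Fintype.card ((Fin 3 × Bool) × (Fin 3 × Bool))) ^ 2 ≤ x →
    |boxSum (classInd U Z) j x| ≤ maximalBound C Z x + 9 * fewBound Z x := by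
  obtain ⟨C, hC, h⟩ := exists_abs_sum_unlinked_le (K := (Fin 3 × Bool) × (Fin 3 × Bool))
  refine ⟨C, hC, fun U hU hU9 j hj Z x hZ hx => ?_⟩
  obtain ⟨a, b, hab⟩ := eq_product_of_card_nine hU hU9
  set c : ((Fin 3 × Bool) × (Fin 3 × Bool) → ℕ) → ℝ :=
    fun E => admissibleInd (fun k => if k ∈ U then 2 else E k) with hc
  have hmain := h pairRel U pairRel_self hU hU9 (fun v hv => ?_) j hj Z x hZ hx c
    (fun E => abs_admissibleInd_le_one _) (fun E E' hE => ?_) (fun E hE => ?_)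
  rotate_left
  · have hv' : ¬ (v.1.2 = a ∧ v.2.2 = b) := by
      rintro ⟨h1, h2⟩
      refine hv ?_
      rw [hab, mem_product, mem_classHalf, mem_classHalf]
      exact ⟨h1, h2⟩
    obtain ⟨i, i1, i', i1', hne⟩ := exists_separating a b v hv'
    have hcomm : ∀ k l, linkRel pairRel k l = linkRel pairRel l k := fun k l => Bool.xor_comm _ _
    refine ⟨((i, a), (i1, b)), ?_, ((i', a), (i1', b)), ?_, ?_⟩
    · rw [hab, mem_product, mem_classHalf, mem_classHalf]; exact ⟨rfl, rfl⟩
    · rw [hab, mem_product, mem_classHalf, mem_classHalf]; exact ⟨rfl, rfl⟩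
    · rwa [hcomm, hcomm _ v]
  · simp only [hc]
    congr 1
    ext k
    split_ifs with hk
    · rfl
    · exact hE k hk
  · simp only [hc]
    refine if_neg (not_admissiblePair (a := a) (b := b) fun k hk => ?_)
    rw [← hab] at hk
    rw [if_neg hk]
    exact hE k hk
  have hdiff : ∀ E, (if ∏ k, E k ≤ x then classInd U Z E * qTerm pairRel j E else 0) =
      (if ∏ k, E k ≤ x then (if SmallOff U Z E then c E * qTerm pairRel j E else 0) else 0) -
      (if ∏ k, E k ≤ x then (if SmallOff U Z E ∧ ¬ LargeExactly U Z E then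
        c E * qTerm pairRel j E else 0) else 0) := by
    intro E
    by_cases hp : ∏ k, E k ≤ x
    swap
    · simp [hp]
    simp only [if_pos hp]
    by_cases hl : LargeExactly U Z E
    · have hs := hl.smallOff
      have hce : c E = admissibleInd E := by
        refine admissibleInd_congr fun k => ?_
        split_ifs with hk
        · have := (hl k).2 hk
          omega
        · rfl
      rw [classInd, if_pos hl, if_pos hs, if_neg (fun h => h.2 hl), hce, sub_zero]
    · rw [classInd, if_neg hl]
      by_cases hs : SmallOff U Z E
      · rw [if_pos hs, if_pos ⟨hs, hl⟩]; ring
      · rw [if_neg hs, if_neg fun h => hs h.1]; ring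
  have hrest : |∑ E ∈ Fintype.piFinset (fun _ : (Fin 3 × Bool) × (Fin 3 × Bool) => Icc 1 x),
      (if ∏ k, E k ≤ x then (if SmallOff U Z E ∧ ¬ LargeExactly U Z E then
        c E * qTerm pairRel j E else 0) else 0)| ≤ 9 * fewBound Z x := by
    have h1 : ∀ u ∈ U, ∑ E ∈ Fintype.piFinset (fun _ : (Fin 3 × Bool) × (Fin 3 × Bool) => Icc 1 x),
        (if ∏ k, E k ≤ x then (if SmallOff (U.erase u) Z E then qBound E else 0) else 0) ≤
        fewBound Z x := fun u hu =>
      sum_smallOff_qBound_le (U.erase u) (by rw [card_erase_of_mem hu, hU9]) hZ hx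
    have h2 := sum_le_sum h1
    rw [sum_const, hU9, nsmul_eq_mul] at h2
    push_cast at h2
    refine (abs_sum_le_sum_abs _ _).trans (le_trans ?_ h2)
    rw [Finset.sum_comm]
    refine sum_le_sum fun E _ => ?_
    have hnn : ∀ u ∈ U, 0 ≤ (if ∏ k, E k ≤ x then
        (if SmallOff (U.erase u) Z E then qBound E else 0) else 0) := by
      intro u _
      have := qBound_nonneg E
      split_ifs <;> simp [this]
    by_cases hp : ∏ k, E k ≤ x
    swap
    · rw [if_neg hp, abs_zero]; exact sum_nonneg hnn
    by_cases hs : SmallOff U Z E ∧ ¬ LargeExactly U Z E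
    swap
    · rw [if_pos hp, if_neg hs, abs_zero]; exact sum_nonneg hnn
    obtain ⟨hs1, hs2⟩ := hs
    have : ∃ u ∈ U, E u ≤ Z := by
      by_contra hcon
      push Not at hcon
      exact hs2 fun k => ⟨fun hk => by
        by_contra hkU
        exact absurd (hs1 k hkU) (not_le.2 hk), fun hk => hcon k hk⟩
    obtain ⟨u, hu, huZ⟩ := this
    refine le_trans ?_ (single_le_sum hnn hu)
    have hse : SmallOff (U.erase u) Z E := by
      intro k hk
      rcases eq_or_ne k u with rfl | hku
      · exact huZ
      · exact hs1 k fun hkU => hk (mem_erase.2 ⟨hku, hkU⟩)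
    rw [if_pos hp, if_pos ⟨hs1, hs2⟩, if_pos hp, if_pos hse]
    exact abs_mul_qTerm_le (abs_admissibleInd_le_one _) j E
  rw [boxSum, sum_congr rfl fun E _ => hdiff E, sum_sub_distrib]
  exact (abs_sub _ _).trans (add_le_add hmain hrest)

theorem boxSum_eq_sum_classInd (j Z x : ℕ) :
    boxSum admissibleInd j x =
      ∑ U : Finset ((Fin 3 × Bool) × (Fin 3 × Bool)), boxSum (classInd U Z) j x := by
  simp only [boxSum]
  rw [Finset.sum_comm]
  refine sum_congr rfl fun E _ => ?_
  have hU : ∀ U : Finset ((Fin 3 × Bool) × (Fin 3 × Bool)),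
      LargeExactly U Z E ↔ U = univ.filter fun k => Z < E k := by
    intro U
    constructor
    · intro h
      ext k
      rw [mem_filter, ← h k]
      simp
    · rintro rfl k
      simp
  split_ifs
  · rw [← sum_mul]
    congr 1
    simp only [classInd, hU]
    rw [sum_ite_eq']
    simp
  · simp

theorem exists_abs_boxSum_le : ∃ C : ℝ, 0 ≤ C ∧ ∀ j : ℕ, j ≠ 0 → ∀ Z x : ℕ, 1 ≤ Z →
    (Z ^ Fintype.card ((Fin 3 × Bool) × (Fin 3 × Bool))) ^ 2 ≤ x →
    |boxSum admissibleInd j x| ≤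
      Fintype.card (Finset ((Fin 3 × Bool) × (Fin 3 × Bool))) * (24 * x *
      (1 + Real.log x) ^ (Fintype.card ((Fin 3 × Bool) × (Fin 3 × Bool)) + 3) *
        (Z : ℝ) ^ (-(1 / 8) : ℝ) + maximalBound C Z x + 9 * fewBound Z x) := by
  obtain ⟨C, hC, h⟩ := exists_abs_boxSum_classInd_nine_le
  refine ⟨C, hC, fun j hj Z x hZ hx => ?_⟩
  have hl := one_le_one_add_log x
  have hlZ := one_le_one_add_log Z
  have hlZ0 : 0 ≤ Real.log (Z : ℝ) := by linarith
  have hA : 0 ≤ 24 * x *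
      (1 + Real.log x) ^ (Fintype.card ((Fin 3 × Bool) × (Fin 3 × Bool)) + 3) *
        (Z : ℝ) ^ (-(1 / 8) : ℝ) := by positivity
  have hM : 0 ≤ maximalBound C Z x := by unfold maximalBound; positivity
  have hF : 0 ≤ fewBound Z x := by unfold fewBound; positivity
  rw [boxSum_eq_sum_classInd j Z x, ← card_univ, ← nsmul_eq_mul, ← sum_const]
  refine (abs_sum_le_sum_abs _ _).trans (sum_le_sum fun U _ => ?_)
  by_cases hU : ∀ k ∈ U, ∀ l ∈ U, linkRel pairRel k l = false
  · rcases (card_le_nine_of_unlinked hU).eq_or_lt with h9 | h9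
    · linarith [h U hU h9 j hj Z x hZ hx]
    · linarith [abs_boxSum_classInd_few_le (U := U) (by omega) j hZ hx]
  · push Not at hU
    obtain ⟨u, hu, v, hv, huv⟩ := hU
    have : (pairRel u v = true ∧ pairRel v u = false) ∨
        (pairRel v u = true ∧ pairRel u v = false) := by
      rw [linkRel] at huv
      revert huv
      cases pairRel u v <;> cases pairRel v u <;> simp
    rcases this with ⟨h1, h2⟩ | ⟨h1, h2⟩
    · linarith [abs_boxSum_classInd_linked_le hu hv h1 h2 hj hZ x]
    · linarith [abs_boxSum_classInd_linked_le hv hu h1 h2 hj hZ x]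

end ClassBounds

section Asymptotic

theorem tendsto_pow_mul_exp_neg_rpow (m : ℕ) {ε : ℝ} (hε : 0 < ε) :
    Tendsto (fun t : ℝ => t ^ m * Real.exp (-(1 / 8) * t ^ ε)) atTop (nhds 0) := by
  have h := (tendsto_rpow_mul_exp_neg_mul_atTop_nhds_zero (m / ε) (1 / 8) (by norm_num)).comp
    (tendsto_rpow_atTop hε)
  refine h.congr' ?_
  filter_upwards [eventually_ge_atTop 0] with t ht
  simp only [Function.comp_apply]
  rw [← Real.rpow_mul ht, mul_div_cancel₀ _ hε.ne', Real.rpow_natCast]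

theorem eventually_mul_rpow_add_one_le (a : ℝ) {ε : ℝ} (hε : ε < 1) :
    ∀ᶠ t : ℝ in atTop, a * (t ^ ε + 1) ≤ t - 1 := by
  have h1 := (tendsto_rpow_neg_atTop (sub_pos.2 hε)).const_mul a
  rw [mul_zero] at h1
  filter_upwards [h1.eventually (gt_mem_nhds (show (0 : ℝ) < 1 / 2 by norm_num)),
    eventually_ge_atTop (2 * (a + 1)), eventually_gt_atTop 0] with t ht1 ht2 ht0
  have h2 : t ^ ε = t ^ (-(1 - ε)) * t := by
    nth_rewrite 3 [← Real.rpow_one t]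
    rw [← Real.rpow_add ht0]
    congr 1
    ring
  have h3 : a * t ^ ε ≤ 1 / 2 * t := by
    rw [h2, ← mul_assoc]
    exact mul_le_mul_of_nonneg_right ht1.le ht0.le
  linarith

/-- A slowly growing cutoff. -/
def cutoff (ε : ℝ) (x : ℕ) : ℕ := ⌈Real.exp ((1 + Real.log x) ^ ε)⌉₊

theorem one_le_cutoff (ε : ℝ) (x : ℕ) : 1 ≤ cutoff ε x :=
  Nat.one_le_iff_ne_zero.2 (Nat.ceil_pos.2 (Real.exp_pos _)).ne'

theorem cutoff_le_exp (ε : ℝ) (x : ℕ) :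
    (cutoff ε x : ℝ) ≤ Real.exp ((1 + Real.log x) ^ ε + 1) := by
  have h := one_le_one_add_log x
  have h0 : 0 ≤ (1 + Real.log x) ^ ε := Real.rpow_nonneg (by linarith) _
  have h1 := (Nat.ceil_lt_add_one (Real.exp_pos ((1 + Real.log x) ^ ε)).le).le
  have h2 : (1 : ℝ) ≤ Real.exp ((1 + Real.log x) ^ ε) := Real.one_le_exp h0
  have h3 := Real.add_one_le_exp (1 : ℝ)
  rw [Real.exp_add]
  refine h1.trans ?_
  nlinarith

theorem log_cutoff_le (ε : ℝ) (x : ℕ) : Real.log (cutoff ε x) ≤ (1 + Real.log x) ^ ε + 1 := by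
  have h0 : (0 : ℝ) < cutoff ε x := by exact_mod_cast one_le_cutoff ε x
  rw [Real.log_le_iff_le_exp h0]
  exact cutoff_le_exp ε x

theorem cutoff_rpow_le (ε : ℝ) (x : ℕ) :
    (cutoff ε x : ℝ) ^ (-(1 / 8) : ℝ) ≤ Real.exp (-(1 / 8) * (1 + Real.log x) ^ ε) := by
  have h1 : Real.exp ((1 + Real.log x) ^ ε) ≤ cutoff ε x := Nat.le_ceil _
  refine (Real.rpow_le_rpow_of_nonpos (Real.exp_pos _) h1 (by norm_num)).trans (le_of_eq ?_)
  rw [← Real.exp_mul]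
  ring_nf

theorem eventually_cutoff_pow_le (n : ℕ) {ε : ℝ} (hε : ε < 1) :
    ∀ᶠ x : ℕ in atTop, (cutoff ε x ^ n) ^ 2 ≤ x := by
  have hlam : Tendsto (fun x : ℕ => 1 + Real.log x) atTop atTop :=
    tendsto_atTop_add_const_left _ _ (Real.tendsto_log_atTop.comp tendsto_natCast_atTop_atTop)
  filter_upwards [hlam.eventually (eventually_mul_rpow_add_one_le (n * 2 : ℕ) hε),
    eventually_ge_atTop 1] with x hx hx1
  have hx0 : (0 : ℝ) < x := by exact_mod_cast hx1
  rw [← pow_mul]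
  have h : ((cutoff ε x ^ (n * 2) : ℕ) : ℝ) ≤ x := by
    push_cast
    calc (cutoff ε x : ℝ) ^ (n * 2) ≤ Real.exp ((1 + Real.log x) ^ ε + 1) ^ (n * 2) := by
          gcongr; exact cutoff_le_exp ε x
      _ = Real.exp ((n * 2 : ℕ) * ((1 + Real.log x) ^ ε + 1)) := by rw [← Real.exp_nat_mul]
      _ ≤ Real.exp (Real.log x) := Real.exp_le_exp.2 (by linarith)
      _ = x := Real.exp_log hx0
  exact_mod_cast h

theorem rpow_mul_log_cutoff_le {δ : ℝ} (hδ : 1 / 18 ≤ δ) (n : ℕ) (x : ℕ) :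
    ((1 + Real.log x) / 4) ^ (-δ) *
      (4 + n * Real.log (cutoff (1 / (36 * (n + 1))) x)) *
        (1 + Real.log (cutoff (1 / (36 * (n + 1))) x)) ^ n ≤
      4 ^ δ * (4 + 2 * n) * 3 ^ n * (1 + Real.log x) ^ (-(1 / 36) : ℝ) := by
  set ε : ℝ := 1 / (36 * (n + 1)) with hε
  have hε0 : 0 < ε := by positivity
  have hl := one_le_one_add_log x
  set t := 1 + Real.log x with ht
  have ht0 : 0 < t := by linarith
  have h1 : 1 ≤ t ^ ε := Real.one_le_rpow hl hε0.le
  have hL : Real.log (cutoff ε x) ≤ t ^ ε + 1 := log_cutoff_le ε x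
  have hL0 : 0 ≤ Real.log (cutoff ε x : ℝ) := Real.log_natCast_nonneg _
  have h2 : 1 + Real.log (cutoff ε x) ≤ 3 * t ^ ε := by linarith
  have h3 : 4 + n * Real.log (cutoff ε x) ≤ (4 + 2 * n) * t ^ ε := by
    have : n * Real.log (cutoff ε x) ≤ n * (2 * t ^ ε) := by gcongr; linarith
    nlinarith
  have h4 : (t / 4) ^ (-δ) = 4 ^ δ * t ^ (-δ) := by
    rw [Real.div_rpow ht0.le (by norm_num), Real.rpow_neg (by norm_num : (0 : ℝ) ≤ 4)]
    field_simp
  have h5 : t ^ (-δ) * t ^ ε * (t ^ ε) ^ n ≤ t ^ (-(1 / 36) : ℝ) := by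
    rw [← Real.rpow_natCast (t ^ ε), ← Real.rpow_mul ht0.le, ← Real.rpow_add ht0,
      ← Real.rpow_add ht0]
    refine Real.rpow_le_rpow_of_exponent_le hl ?_
    have : ε + ε * n = 1 / 36 := by
      rw [hε]; field_simp; ring
    linarith
  calc _ ≤ (4 ^ δ * t ^ (-δ)) * ((4 + 2 * n) * t ^ ε) * (3 * t ^ ε) ^ n := by
        rw [h4]; gcongr
    _ = 4 ^ δ * (4 + 2 * n) * 3 ^ n * (t ^ (-δ) * t ^ ε * (t ^ ε) ^ n) := by ring
    _ ≤ _ := by gcongr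

theorem tendsto_boxSum_div {j : ℕ} (hj : j ≠ 0) :
    Tendsto (fun x : ℕ => boxSum admissibleInd j x / x) atTop (nhds 0) := by
  obtain ⟨C, hC, h⟩ := exists_abs_boxSum_le
  simp only [maximalBound, fewBound] at h
  obtain ⟨n, hn⟩ : ∃ n, Fintype.card ((Fin 3 × Bool) × (Fin 3 × Bool)) = n := ⟨_, rfl⟩
  obtain ⟨N, hN⟩ : ∃ N, Fintype.card (Finset ((Fin 3 × Bool) × (Fin 3 × Bool))) = N := ⟨_, rfl⟩
  rw [hn, hN] at h
  have hlam : Tendsto (fun x : ℕ => 1 + Real.log x) atTop atTop :=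
    tendsto_atTop_add_const_left _ _ (Real.tendsto_log_atTop.comp tendsto_natCast_atTop_atTop)
  set ε : ℝ := 1 / (36 * (n + 1)) with hε
  have hε0 : 0 < ε := by positivity
  have hε1 : ε < 1 := by
    rw [hε, div_lt_one (by positivity)]
    have : (0 : ℝ) ≤ n := n.cast_nonneg
    linarith
  have hT1 := (tendsto_pow_mul_exp_neg_rpow (n + 3) hε0).comp hlam
  have hT2 := (tendsto_rpow_neg_atTop (show (0 : ℝ) < 1 / 36 by norm_num)).comp hlam
  have hT := (((hT1.const_mul 24).add
    (hT2.const_mul (C * ((4 : ℝ) ^ (1 / 18 : ℝ) * (4 + 2 * n) * 3 ^ n)))).add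
    (hT2.const_mul (9 * 48 * ((4 : ℝ) ^ (1 / 9 : ℝ) * (4 + 2 * n) * 3 ^ n)))).const_mul (N : ℝ)
  simp only [mul_zero, add_zero] at hT
  refine squeeze_zero_norm' ?_ hT
  filter_upwards [eventually_cutoff_pow_le n hε1, eventually_ge_atTop 1] with x hx hx1
  have hx0 : (0 : ℝ) < x := by exact_mod_cast hx1
  simp only [Function.comp_apply]
  rw [Real.norm_eq_abs, abs_div, abs_of_pos hx0, div_le_iff₀ hx0]
  refine (h j hj (cutoff ε x) x (one_le_cutoff ε x) hx).trans ?_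
  rw [mul_assoc (N : ℝ)]
  refine mul_le_mul_of_nonneg_left ?_ N.cast_nonneg
  have hl := one_le_one_add_log x
  have hL0 : 0 ≤ Real.log (cutoff ε x : ℝ) := Real.log_natCast_nonneg _
  have b1 := cutoff_rpow_le ε x
  have b2 := rpow_mul_log_cutoff_le (δ := 1 / 18) le_rfl n x
  have b3 := rpow_mul_log_cutoff_le (δ := 1 / 9) (by norm_num) n x
  rw [← hε] at b2 b3
  rw [add_mul, add_mul]
  refine add_le_add (add_le_add ?_ ?_) ?_
  · calc _ ≤ 24 * x * (1 + Real.log x) ^ (n + 3) *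
          Real.exp (-(1 / 8) * (1 + Real.log x) ^ ε) := by gcongr
      _ = _ := by ring
  · calc _ = C * x * (((1 + Real.log x) / 4) ^ (-(1 / 18) : ℝ) *
          (4 + n * Real.log (cutoff ε x)) * (1 + Real.log (cutoff ε x)) ^ n) := by ring
      _ ≤ C * x * (4 ^ (1 / 18 : ℝ) * (4 + 2 * n) * 3 ^ n *
          (1 + Real.log x) ^ (-(1 / 36) : ℝ)) := by gcongr
      _ = _ := by ring
  · have b4 : 1 ≤ 4 + n * Real.log (cutoff ε x : ℝ) := by
      have : 0 ≤ n * Real.log (cutoff ε x : ℝ) := by positivity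
      linarith
    calc _ = 9 * (48 * x * ((1 + Real.log x) / 4) ^ (-(1 / 9) : ℝ) *
          1 * (1 + Real.log (cutoff ε x)) ^ n) := by ring
      _ ≤ 9 * (48 * x * ((1 + Real.log x) / 4) ^ (-(1 / 9) : ℝ) *
          (4 + n * Real.log (cutoff ε x)) * (1 + Real.log (cutoff ε x)) ^ n) := by gcongr
      _ = 9 * 48 * x * (((1 + Real.log x) / 4) ^ (-(1 / 9) : ℝ) *
          (4 + n * Real.log (cutoff ε x)) * (1 + Real.log (cutoff ε x)) ^ n) := by ring
      _ ≤ 9 * 48 * x * (4 ^ (1 / 9 : ℝ) * (4 + 2 * n) * 3 ^ n *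
          (1 + Real.log x) ^ (-(1 / 36) : ℝ)) := by gcongr
      _ = _ := by ring

end Asymptotic

section Moments

theorem boxSum_eq_sum_mixedSum (j x : ℕ) :
    boxSum admissibleInd j x =
      ∑ d ∈ Icc 1 x, if Squarefree d then wt j d * mixedSum d ^ 2 else 0 := by
  have h := sum_piFinset_prod_le (univ : Finset ((Fin 3 × Bool) × (Fin 3 × Bool))) (le_refl x)
    (fun E => admissibleInd E * qTerm pairRel j E)
  simp only [mem_univ, if_true] at h
  rw [boxSum, h]
  refine sum_congr rfl fun d hd => ?_
  have hd0 : d ≠ 0 := by rw [mem_Icc] at hd; omega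
  have hE : ∀ E ∈ factTuples (univ : Finset ((Fin 3 × Bool) × (Fin 3 × Bool))) d,
      admissibleInd E * qTerm pairRel j E =
        if Squarefree d then wt j d * ((if AdmissiblePair E then 1 else 0) * symProd pairRel E)
          else 0 := by
    intro E hE
    rw [qTerm, ((mem_factTuples hd0).1 hE).2, admissibleInd]
    split_ifs <;> ring
  rw [sum_congr rfl hE]
  split_ifs with hs
  · rw [mixedSum_sq hs, mul_sum]
  · simp

/-- The squarefree integers in `(1, x]` that are `1` modulo `4`. -/
def discSet (x : ℕ) : Finset ℕ := (Icc 2 x).filter fun d => Squarefree d ∧ d % 4 = 1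

theorem wt_one_add_wt_two (d : ℕ) :
    wt 1 d + wt 2 d = if d % 4 = 1 then 2 / 9 ^ d.primeFactors.card else 0 := by
  rw [wt, wt, chiFour_eq]
  have : d % 4 = 0 ∨ d % 4 = 1 ∨ d % 4 = 2 ∨ d % 4 = 3 := by omega
  rcases this with h | h | h | h
  · rw [if_pos (by omega), if_neg (by omega)]; norm_num
  · rw [if_neg (by omega), if_pos h, if_pos h]; ring
  · rw [if_pos (by omega), if_neg (by omega)]; norm_num
  · rw [if_neg (by omega), if_neg (by omega), if_neg (by omega)]; ring

theorem sum_mixedSum_sq_le (x : ℕ) :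
    ∑ d ∈ discSet x, mixedSum d ^ 2 / 9 ^ d.primeFactors.card ≤
      (boxSum admissibleInd 1 x + boxSum admissibleInd 2 x) / 2 := by
  rw [boxSum_eq_sum_mixedSum, boxSum_eq_sum_mixedSum, ← sum_add_distrib, sum_div]
  have e : ∀ d ∈ Icc 1 x, ((if Squarefree d then wt 1 d * mixedSum d ^ 2 else 0) +
      (if Squarefree d then wt 2 d * mixedSum d ^ 2 else 0)) / 2 =
      if Squarefree d ∧ d % 4 = 1 then mixedSum d ^ 2 / 9 ^ d.primeFactors.card else 0 := by
    intro d _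
    have h := wt_one_add_wt_two d
    by_cases h1 : Squarefree d
    · rw [if_pos h1, if_pos h1, ← add_mul, h]
      by_cases h2 : d % 4 = 1
      · rw [if_pos h2, if_pos ⟨h1, h2⟩]; ring
      · rw [if_neg h2, if_neg fun h => h2 h.2]; ring
    · rw [if_neg h1, if_neg h1, if_neg fun h => h1 h.1]; ring
  rw [sum_congr rfl e, ← sum_filter]
  refine sum_le_sum_of_subset_of_nonneg (filter_subset_filter _ (Icc_subset_Icc (by omega) le_rfl))
    fun d _ _ => by positivity

/-- A majorant for the deviation of the normalized `ftilde` from its limit. -/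
def devTerm (d : ℕ) : ℝ :=
  mixedSum d ^ 2 / 9 ^ d.primeFactors.card + ((∏ p ∈ d.primeFactors, (2 + chiFour p) / 3) +
    (2 / 3) ^ d.primeFactors.card)

theorem two_add_chiFour_nonneg (p : ℕ) : 0 ≤ (2 + chiFour p) / 3 := by
  have := (abs_le.1 (abs_chiFour_le p)).1
  linarith

theorem tendsto_sum_devTerm_div :
    Tendsto (fun x : ℕ => (∑ d ∈ discSet x, devTerm d) / x) atTop (nhds 0) := by
  obtain ⟨C, hC, hchi⟩ := exists_sum_sqfProd_chiFour_le
  have hlam : Tendsto (fun x : ℕ => 1 + Real.log x) atTop atTop :=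
    tendsto_atTop_add_const_left _ _ (Real.tendsto_log_atTop.comp tendsto_natCast_atTop_atTop)
  have hT := (tendsto_rpow_neg_atTop (show (0 : ℝ) < 1 / 3 by norm_num)).comp hlam
  have h1 := (tendsto_boxSum_div one_ne_zero).add (tendsto_boxSum_div two_ne_zero)
  have h2 := (h1.div_const 2).add (hT.const_mul (C + 48))
  simp only [add_zero, zero_div, mul_zero] at h2
  refine squeeze_zero' (Eventually.of_forall fun x => ?_) ?_ h2
  · refine div_nonneg (sum_nonneg fun d _ => ?_) (Nat.cast_nonneg x)
    have := prod_nonneg fun p (_ : p ∈ d.primeFactors) => two_add_chiFour_nonneg p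
    unfold devTerm
    positivity
  · filter_upwards [eventually_ge_atTop 1] with x hx
    have hx0 : (0 : ℝ) < x := by exact_mod_cast hx
    have hsub : discSet x ⊆ Icc 1 x :=
      (filter_subset _ _).trans (Icc_subset_Icc (by omega) le_rfl)
    have b1 := sum_mixedSum_sq_le x
    have b2 : ∑ d ∈ discSet x, ∏ p ∈ d.primeFactors, (2 + chiFour p) / 3 ≤
        C * x * (1 + Real.log x) ^ (-(1 / 3) : ℝ) := by
      refine le_trans ?_ (hchi x)
      refine le_trans (sum_le_sum fun d hd => ?_) (sum_le_sum_of_subset_of_nonneg hsub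
        fun d _ _ => sqfProd_nonneg (fun p _ => two_add_chiFour_nonneg p) d)
      rw [sqfProd, if_pos (mem_filter.1 hd).2.1]
    have b3 : ∑ d ∈ discSet x, (2 / 3 : ℝ) ^ d.primeFactors.card ≤
        48 * x * (1 + Real.log x) ^ (-(1 / 3) : ℝ) := by
      have h := sum_sqfProd_const_le (θ := 2 / 3) (by norm_num) (by norm_num) x
      rw [show (2 / 3 - 1 : ℝ) = -(1 / 3) by norm_num] at h
      refine le_trans ?_ h
      refine le_trans (sum_le_sum fun d hd => ?_) (sum_le_sum_of_subset_of_nonneg hsub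
        fun d _ _ => sqfProd_nonneg (fun p _ => by norm_num) d)
      rw [sqfProd, if_pos (mem_filter.1 hd).2.1, prod_const]
    simp only [devTerm, sum_add_distrib, Function.comp_apply]
    rw [div_le_iff₀ hx0]
    refine (add_le_add b1 (add_le_add b2 b3)).trans (le_of_eq ?_)
    field_simp

theorem sum_one_div_odd_sq_le (n : ℕ) :
    ∑ k ∈ range (n + 1), (1 / (2 * (k : ℝ) + 3) ^ 2) ≤ 17 / 72 - 1 / (4 * ((n : ℝ) + 2)) := by
  induction n with
  | zero => norm_num
  | succ n ih =>
    rw [sum_range_succ]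
    refine (add_le_add_left ih _).trans ?_
    push_cast
    have h : 1 / (2 * ((n : ℝ) + 1) + 3) ^ 2 ≤ 1 / (4 * ((n : ℝ) + 2)) - 1 / (4 * ((n : ℝ) + 1 + 2)) := by
      rw [div_sub_div _ _ (by positivity) (by positivity), div_le_div_iff₀ (by positivity)
        (by positivity)]
      nlinarith [(Nat.cast_nonneg n : (0 : ℝ) ≤ n)]
    linarith

theorem card_discSet_ge (x : ℕ) : (x : ℝ) / 72 - 3 ≤ (discSet x).card := by
  have hcov : (Icc 1 (x / 4)).image (fun m => 4 * m - 3) ⊆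
      insert 1 (discSet x) ∪ (range x).biUnion fun k =>
        (Icc 1 (x / (2 * k + 3) ^ 2)).image fun m => (2 * k + 3) ^ 2 * m := by
    intro d hd
    obtain ⟨m, hm, rfl⟩ := mem_image.1 hd
    rw [mem_Icc, Nat.le_div_iff_mul_le (by norm_num)] at hm
    set d := 4 * m - 3 with hdef
    have h4 : d % 4 = 1 := by omega
    have hdx : d ≤ x := by omega
    rw [mem_union]
    by_cases hs : Squarefree d
    · left
      rw [mem_insert, discSet, mem_filter, mem_Icc]
      by_cases h1 : d = 1
      · exact Or.inl h1
      · exact Or.inr ⟨⟨by omega, hdx⟩, hs, h4⟩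
    · right
      rw [Nat.squarefree_iff_prime_squarefree] at hs
      push Not at hs
      obtain ⟨p, hp, q, hq⟩ := hs
      have hpo : p % 2 = 1 := by
        by_contra hcon
        have h2 : 2 ∣ p := Nat.dvd_of_mod_eq_zero (by omega)
        have : 2 ∣ d := (h2.mul_right p).trans ⟨q, hq⟩
        omega
      have hp3 : 3 ≤ p := by have := hp.two_le; omega
      have hq1 : 1 ≤ q := Nat.one_le_iff_ne_zero.2 (by rintro rfl; omega)
      have hpd : p ≤ d := by nlinarith
      rw [mem_biUnion]
      refine ⟨(p - 3) / 2, by rw [mem_range]; omega, mem_image.2 ⟨q, ?_, ?_⟩⟩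
      · have : 2 * ((p - 3) / 2) + 3 = p := by omega
        rw [this, mem_Icc, Nat.le_div_iff_mul_le (by positivity)]
        exact ⟨hq1, by nlinarith⟩
      · have : 2 * ((p - 3) / 2) + 3 = p := by omega
        rw [this, hq]; ring
  have h1 := card_le_card hcov
  rw [card_image_of_injOn, Nat.card_Icc] at h1
  swap
  · intro a ha b hb hab
    simp only [coe_Icc, Set.mem_Icc] at ha hb hab
    omega
  have h2 : ((range x).biUnion fun k =>
        (Icc 1 (x / (2 * k + 3) ^ 2)).image fun m => (2 * k + 3) ^ 2 * m).card ≤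
      ∑ k ∈ range x, x / (2 * k + 3) ^ 2 := by
    refine card_biUnion_le.trans (sum_le_sum fun k _ => card_image_le.trans (le_of_eq ?_))
    simp
  have h3 := (h1.trans (card_union_le _ _)).trans (add_le_add (card_insert_le _ _) h2)
  have h4 : ((∑ k ∈ range x, x / (2 * k + 3) ^ 2 : ℕ) : ℝ) ≤ x * (17 / 72) := by
    push_cast
    have h5 : ∀ k ∈ range x, ((x / (2 * k + 3) ^ 2 : ℕ) : ℝ) ≤ x * (1 / (2 * (k : ℝ) + 3) ^ 2) := by
      intro k _
      refine Nat.cast_div_le.trans (le_of_eq ?_)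
      push_cast
      ring
    refine (sum_le_sum h5).trans ?_
    rw [← mul_sum]
    refine mul_le_mul_of_nonneg_left ?_ (Nat.cast_nonneg x)
    have h6 := sum_one_div_odd_sq_le x
    have h7 : ∑ k ∈ range x, (1 / (2 * (k : ℝ) + 3) ^ 2) ≤
        ∑ k ∈ range (x + 1), (1 / (2 * (k : ℝ) + 3) ^ 2) :=
      sum_le_sum_of_subset_of_nonneg (range_mono (Nat.le_succ x)) fun k _ _ => by positivity
    have h8 : 0 ≤ 1 / (4 * (x + 2 : ℝ)) := by positivity
    linarith
  have h9 : (x : ℝ) ≤ 4 * ((x / 4 + 1 - 1 : ℕ) : ℝ) + 3 := by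
    have : x ≤ 4 * (x / 4 + 1 - 1) + 3 := by omega
    exact_mod_cast this
  have h10 : ((x / 4 + 1 - 1 : ℕ) : ℝ) ≤
      ((discSet x).card + 1 : ℕ) + ((∑ k ∈ range x, x / (2 * k + 3) ^ 2 : ℕ) : ℝ) := by
    exact_mod_cast h3
  push_cast at h10 h4 h9
  linarith

end Moments

section WeakConvergence

/-- The value `f̃(d) / 3 ^ ω(d)`. -/
def normVal (d : ℤ) : ℝ := ftilde d / 3 ^ omegaZ d

theorem abs_normVal_sub_le {d : ℕ} (hd : Squarefree d) (h4 : d % 4 = 1) (h1 : d ≠ 1) :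
    |normVal d - 1 / 192| ≤ |mixedSum d| / 3 ^ d.primeFactors.card +
      (∏ p ∈ d.primeFactors, (2 + chiFour p) / 3) + (2 / 3) ^ d.primeFactors.card := by
  have h := abs_sum_fdTriples_sub_le hd h4 h1
  have hpos : (0 : ℤ) < d := by
    have : 0 < d := Nat.pos_of_ne_zero hd.ne_zero
    exact_mod_cast this
  have hP : ∏ p ∈ d.primeFactors, (2 + chiFour p) / 3 =
      (∏ p ∈ d.primeFactors, (2 + chiFour p)) / 3 ^ d.primeFactors.card := by
    rw [prod_div_distrib, prod_const]
  have hP0 := prod_nonneg fun p (_ : p ∈ d.primeFactors) => two_add_chiFour_nonneg p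
  rw [hP] at hP0
  rw [hP, div_pow, ← add_div, ← add_div, le_div_iff₀ (by positivity)]
  have hval : (normVal d - 1 / 192) * 3 ^ d.primeFactors.card =
      1 / 96 * ((∑ t ∈ fdTriples d, (tripleTerm t : ℝ)) - 3 ^ d.primeFactors.card / 2) := by
    rw [normVal, ftilde, alphaFD, if_pos hpos, omegaZ, Int.natAbs_natCast]
    field_simp
    ring
  rw [← abs_of_pos (show (0 : ℝ) < 3 ^ d.primeFactors.card by positivity), ← abs_mul,
    hval, abs_mul,
    abs_of_pos (show (0 : ℝ) < 1 / 96 by norm_num)]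
  rw [← mixedSum] at h
  have hP1 : 0 ≤ ∏ p ∈ d.primeFactors, (2 + chiFour p) := by
    have := mul_nonneg hP0 (show (0 : ℝ) ≤ 3 ^ d.primeFactors.card by positivity)
    rwa [div_mul_cancel₀ _ (by positivity)] at this
  have hT : (0 : ℝ) ≤ 2 ^ d.primeFactors.card := by positivity
  linarith [abs_nonneg (mixedSum d)]

theorem devTerm_nonneg (d : ℕ) : 0 ≤ devTerm d := by
  have := prod_nonneg fun p (_ : p ∈ d.primeFactors) => two_add_chiFour_nonneg p
  unfold devTerm
  positivity

theorem sq_le_devTerm {d : ℕ} (hd : Squarefree d) (h4 : d % 4 = 1) (h1 : d ≠ 1) {δ : ℝ}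
    (hδ : 0 < δ) (hδ1 : δ ≤ 1) (h : δ ≤ |normVal d - 1 / 192|) : δ ^ 2 / 9 ≤ devTerm d := by
  have hb := h.trans (abs_normVal_sub_le hd h4 h1)
  have hP0 := prod_nonneg fun p (_ : p ∈ d.primeFactors) => two_add_chiFour_nonneg p
  have hT : (0 : ℝ) ≤ (2 / 3) ^ d.primeFactors.card := by positivity
  have hm : mixedSum d ^ 2 / 9 ^ d.primeFactors.card =
      (|mixedSum d| / 3 ^ d.primeFactors.card) ^ 2 := by
    rw [div_pow, sq_abs, ← pow_mul, mul_comm, pow_mul]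
    norm_num
  rw [devTerm, hm]
  have hm0 : 0 ≤ |mixedSum d| / 3 ^ d.primeFactors.card := by positivity
  generalize |mixedSum d| / 3 ^ d.primeFactors.card = m at *
  generalize (2 / 3 : ℝ) ^ d.primeFactors.card = T at *
  generalize (∏ p ∈ d.primeFactors, (2 + chiFour p) / 3) = P at *
  by_cases hc : δ / 3 ≤ m
  · nlinarith
  · nlinarith

theorem exists_abs_sub_le_devTerm {φ : ℝ → ℝ} (hφc : Continuous φ)
    (hφb : ∃ C : ℝ, ∀ x : ℝ, |φ x| ≤ C) {η : ℝ} (hη : 0 < η) :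
    ∃ K : ℝ, ∀ x : ℕ, ∀ d ∈ discSet x,
      |φ (normVal d) - φ (1 / 192)| ≤ η + K * devTerm d := by
  obtain ⟨C, hC⟩ := hφb
  have hC0 : 0 ≤ C := (abs_nonneg _).trans (hC 0)
  obtain ⟨δ, hδ, hcont⟩ := Metric.continuous_iff.1 hφc (1 / 192) η hη
  have hδ' : 0 < min δ 1 := lt_min hδ one_pos
  refine ⟨2 * C * (9 / min δ 1 ^ 2), fun x d hd => ?_⟩
  rw [discSet, mem_filter, mem_Icc] at hd
  have hdev := devTerm_nonneg d
  by_cases h : |normVal d - 1 / 192| < δ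
  · have := hcont _ h
    rw [Real.dist_eq] at this
    have hK : 0 ≤ 2 * C * (9 / min δ 1 ^ 2) * devTerm d := by positivity
    linarith
  · have hs := sq_le_devTerm hd.2.1 hd.2.2 (by omega) hδ' (min_le_right _ _)
      ((min_le_left _ _).trans (not_lt.1 h))
    have h1 : 1 ≤ 9 / min δ 1 ^ 2 * devTerm d := by
      have := mul_le_mul_of_nonneg_left hs (show 0 ≤ 9 / min δ 1 ^ 2 by positivity)
      refine le_trans (le_of_eq ?_) this
      field_simp
    have h2 : |φ (normVal d) - φ (1 / 192)| ≤ 2 * C :=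
      (abs_sub _ _).trans (by linarith [hC (normVal d), hC (1 / 192)])
    rw [mul_assoc]
    have h3 := mul_le_mul_of_nonneg_left h1 (show 0 ≤ 2 * C by positivity)
    linarith

theorem tendsto_average_discSet {φ : ℝ → ℝ} (hφc : Continuous φ)
    (hφb : ∃ C : ℝ, ∀ x : ℝ, |φ x| ≤ C) :
    Tendsto (fun x : ℕ => (∑ d ∈ discSet x, φ (normVal d)) / ((discSet x).card : ℝ))
      atTop (nhds (φ (1 / 192))) := by
  rw [Metric.tendsto_nhds]
  intro ε hε
  obtain ⟨K, hK⟩ := exists_abs_sub_le_devTerm hφc hφb (half_pos hε)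
  have hlim : Tendsto (fun x : ℕ => 144 * |K| * ((∑ d ∈ discSet x, devTerm d) / x)) atTop
      (nhds 0) := by
    simpa using tendsto_sum_devTerm_div.const_mul (144 * |K|)
  filter_upwards [hlim.eventually_lt_const (half_pos hε), eventually_ge_atTop 432] with x hx hx1
  have hx1' : (432 : ℝ) ≤ x := by exact_mod_cast hx1
  have hx0 : (0 : ℝ) < x := by linarith
  have hcard : (x : ℝ) / 144 ≤ (discSet x).card := by linarith [card_discSet_ge x]
  have hcard0 : (0 : ℝ) < (discSet x).card := by linarith
  have hdev : 0 ≤ ∑ d ∈ discSet x, devTerm d := sum_nonneg fun d _ => devTerm_nonneg d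
  have e : (∑ d ∈ discSet x, φ (normVal d)) / ((discSet x).card : ℝ) - φ (1 / 192) =
      (∑ d ∈ discSet x, (φ (normVal d) - φ (1 / 192))) / (discSet x).card := by
    rw [sum_sub_distrib, sum_const, nsmul_eq_mul]
    field_simp
  rw [Real.dist_eq, e, abs_div, abs_of_pos hcard0, div_lt_iff₀ hcard0]
  have h1 : |∑ d ∈ discSet x, (φ (normVal d) - φ (1 / 192))| ≤
      (discSet x).card * (ε / 2) + |K| * ∑ d ∈ discSet x, devTerm d := by
    refine (abs_sum_le_sum_abs _ _).trans ((sum_le_sum fun d hd => (hK x d hd).trans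
      (add_le_add_right (mul_le_mul_of_nonneg_right (le_abs_self K) (devTerm_nonneg d)) _)).trans
        (le_of_eq ?_))
    rw [sum_add_distrib, sum_const, nsmul_eq_mul, mul_sum]
  have h2 : |K| * ∑ d ∈ discSet x, devTerm d < (discSet x).card * (ε / 2) := by
    have h3 : |K| * ∑ d ∈ discSet x, devTerm d =
        x / 144 * (144 * |K| * ((∑ d ∈ discSet x, devTerm d) / x)) := by
      field_simp
    rw [h3]
    exact (mul_lt_mul_of_pos_left hx (by positivity)).trans_le
      (mul_le_mul_of_nonneg_right hcard (half_pos hε).le)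
  linarith

theorem DposOdd_eq_map (X : ℝ) :
    DposOdd X = (discSet (⌈X⌉₊ - 1)).map Nat.castEmbedding := by
  ext d
  simp only [DposOdd, discSet, mem_filter, Finset.mem_map, mem_Icc, Nat.castEmbedding_apply]
  constructor
  · rintro ⟨-, h1, h2, h4, hX⟩
    lift d to ℕ using by omega
    have hlt : d < ⌈X⌉₊ := Nat.lt_ceil.2 (by exact_mod_cast hX)
    exact ⟨d, ⟨⟨by omega, by omega⟩, Int.squarefree_natCast.1 h2, by omega⟩, rfl⟩
  · rintro ⟨n, ⟨⟨h1, h2⟩, hs, h4⟩, rfl⟩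
    have hlt : (n : ℝ) < X := Nat.lt_ceil.1 (by omega)
    have hle : (n : ℤ) ≤ ⌈X⌉ := by
      have : ((n : ℤ) : ℝ) < X := by exact_mod_cast hlt
      exact (Int.lt_ceil.2 this).le
    exact ⟨⟨by omega, hle⟩, by omega, Int.squarefree_natCast.2 hs, by omega,
      by exact_mod_cast hlt⟩

end WeakConvergence

theorem weak_convergence_point_mass_pos (φ : ℝ → ℝ)
    (hφc : Continuous φ) (hφb : ∃ C : ℝ, ∀ x : ℝ, |φ x| ≤ C) :
    Tendsto
      (fun X : ℝ =>
        (∑ d ∈ DposOdd X, φ (ftilde d / 3 ^ omegaZ d)) / ((DposOdd X).card : ℝ))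
      atTop (nhds (φ (1 / 192))) := by
  have hceil : Tendsto (fun X : ℝ => ⌈X⌉₊ - 1) atTop atTop :=
    (tendsto_sub_atTop_nat 1).comp tendsto_nat_ceil_atTop
  refine ((tendsto_average_discSet hφc hφb).comp hceil).congr fun X => ?_
  rw [Function.comp_apply, DposOdd_eq_map, sum_map, card_map]
  rfl
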